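/- arXiv:2108.07054 — 2 statements merged into one kernel-verified Lean document; each statement's English description precedes it below -/
import Mathlib

section
/- Let A be an m×m real diagonal matrix and B an m×m real symmetric matrix. Then there exists an m×m real orthogonal matrix R such that A and RᵀBR are in finite free position and, in addition, every diagonal entry of RᵀBR equals Tr(B)/m (the diagonal of RᵀBR is constant). -/
open Polynomial Matrix

/-- The symmetric additive convolution of two polynomials of degree (at most) `m`:
`[p ⊞_m q](x) = (1/m!) ∑_{i=0}^m p^{(i)}(x) · q^{(m-i)}(0)`. -/
noncomputable def boxplus (m : ℕ) (p q : ℝ[X]) : ℝ[X] :=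
  (m.factorial : ℝ)⁻¹ •
    ∑ i ∈ Finset.range (m + 1),
      C ((Polynomial.derivative^[m - i] q).eval 0) * Polynomial.derivative^[i] p

/-- Two `m × m` real symmetric matrices `A`, `B` are in finite free position if
`det(xI - yA - zB) = [det(xI - yA) ⊞_m det(xI - zB)]` for all real `y, z`. -/
def FiniteFreePosition (m : ℕ) (A B : Matrix (Fin m) (Fin m) ℝ) : Prop :=
  ∀ y z : ℝ, (y • A + z • B).charpoly = boxplus m (y • A).charpoly (z • B).charpoly

namespace FiniteFree

section LinearAlgebra

variable {n : Type*} [Fintype n] [DecidableEq n]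

/-- A matrix is nonderogatory if all its eigenspaces are at most one-dimensional. -/
def Nonderogatory {K : Type*} [Field K] (T : Matrix n n K) : Prop :=
  ∀ (μ : K) (u v : n → K), u ≠ 0 → T *ᵥ u = μ • u → T *ᵥ v = μ • v → ∃ k : K, v = k • u

lemma adjugate_eq_zero_of_not_smul {K : Type*} [Field K] {M : Matrix n n K} {u v : n → K}
    (hu0 : u ≠ 0) (hu : M *ᵥ u = 0) (hv : M *ᵥ v = 0) (h : ¬ ∃ k : K, v = k • u) :
    M.adjugate = 0 := by
  ext i j
  rw [adjugate_apply, Matrix.zero_apply]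
  obtain ⟨w, hw0, hw, hwi⟩ : ∃ w : n → K, w ≠ 0 ∧ M *ᵥ w = 0 ∧ w i = 0 := by
    by_cases hui : u i = 0
    · exact ⟨u, hu0, hu, hui⟩
    · refine ⟨u i • v - v i • u, fun h0 => h ⟨v i / u i, ?_⟩, ?_, ?_⟩
      · rw [sub_eq_zero] at h0
        rw [div_eq_inv_mul, mul_smul, ← h0, smul_smul, inv_mul_cancel₀ hui, one_smul]
      · rw [mulVec_sub, mulVec_smul, mulVec_smul, hu, hv]; simp
      · simp [mul_comm]
  refine exists_mulVec_eq_zero_iff.mp ⟨w, hw0, ?_⟩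
  ext k
  change M.updateRow j (Pi.single i 1) k ⬝ᵥ w = 0
  by_cases hk : k = j
  · subst hk
    rw [updateRow_self, single_one_dotProduct, hwi]
  · rw [updateRow_ne hk]
    exact congrFun hw k

lemma Nonderogatory.exists_cyclic {T : Matrix n n ℂ} (hT : Nonderogatory T) (hs : Tᵀ = T) :
    ∃ v : n → ℂ, ∀ w : n → ℂ, ∃ g : ℂ[X], w = aeval T g *ᵥ v := by
  have heig : ∀ μ : {μ // μ ∈ T.charpoly.roots.toFinset}, ∃ u : n → ℂ, u ≠ 0 ∧
      T *ᵥ u = μ.1 • u := by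
    rintro ⟨μ, hμ⟩
    have h1 : (scalar n μ - T).det = 0 := by
      rw [← eval_charpoly]
      exact (mem_roots'.mp (Multiset.mem_toFinset.mp hμ)).2
    obtain ⟨u, hu0, hu⟩ := exists_mulVec_eq_zero_iff.mpr h1
    refine ⟨u, hu0, ?_⟩
    rw [sub_mulVec, sub_eq_zero] at hu
    rw [← hu]
    ext i
    simp [mulVec_diagonal]
  choose u hu0 hu using heig
  obtain ⟨v, hv⟩ := Module.Dual.exists_forall_ne_zero_of_forall_exists
    (fun μ => dotProductBilin ℂ ℂ (u μ)) (by
      intro μ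
      obtain ⟨i, hi⟩ := Function.ne_iff.mp (hu0 μ)
      exact ⟨Pi.single i 1, by simpa using hi⟩)
  refine ⟨v, ?_⟩
  let φ : ℂ[X] →ₗ[ℂ] (n → ℂ) :=
    { toFun := fun g => aeval T g *ᵥ v
      map_add' := by intro a b; simp [add_mulVec]
      map_smul' := by intro a b; simp [smul_mulVec] }
  suffices h : LinearMap.range φ = ⊤ by
    intro w
    obtain ⟨g, hg⟩ := LinearMap.range_eq_top.mp h w
    exact ⟨g, hg.symm⟩
  by_contra hne
  obtain ⟨f, hf0, hf⟩ := Submodule.exists_le_ker_of_lt_top _ (lt_top_iff_ne_top.mpr hne)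
  let P : Submodule ℂ (n → ℂ) :=
    { carrier := {x | ∀ g : ℂ[X], x ⬝ᵥ (aeval T g *ᵥ v) = 0}
      add_mem' := by intro a b ha hb g; rw [add_dotProduct, ha, hb, add_zero]
      zero_mem' := by intro g; simp
      smul_mem' := by intro c x hx g; rw [smul_dotProduct, hx, smul_zero] }
  have hP : P ≠ ⊥ := by
    intro hbot
    apply hf0
    let x : n → ℂ := fun i => f (Pi.single i 1)
    have hfx : ∀ w, f w = x ⬝ᵥ w := by
      intro w
      conv_lhs => rw [pi_eq_sum_univ' w]
      simp [x, dotProduct, mul_comm]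
    have : x ∈ P := fun g => by
      rw [← hfx]
      exact hf ⟨g, rfl⟩
    rw [hbot, Submodule.mem_bot] at this
    refine LinearMap.ext fun w => ?_
    rw [hfx, this, zero_dotProduct, LinearMap.zero_apply]
  have hinv : ∀ x ∈ P, T.mulVecLin x ∈ P := by
    intro x hx g
    have := hx (X * g)
    rw [map_mul, aeval_X, ← mulVec_mulVec, dotProduct_mulVec, ← mulVec_transpose, hs] at this
    exact this
  have : Nontrivial P := Submodule.nontrivial_iff_ne_bot.mpr hP
  obtain ⟨μ, hμ⟩ := Module.End.exists_eigenvalue (T.mulVecLin.restrict hinv)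
  obtain ⟨x, hx⟩ := hμ.exists_hasEigenvector
  have hx1 : T *ᵥ x.1 = μ • x.1 := by
    have := congrArg Subtype.val (Module.End.mem_eigenspace_iff.mp hx.1)
    simpa using this
  have hx0 : x.1 ≠ 0 := fun h => hx.2 (Subtype.ext h)
  have hroot : μ ∈ T.charpoly.roots.toFinset := by
    rw [Multiset.mem_toFinset, mem_roots (charpoly_monic T).ne_zero, IsRoot, eval_charpoly]
    refine exists_mulVec_eq_zero_iff.mp ⟨x.1, hx0, ?_⟩
    rw [sub_mulVec, hx1, sub_eq_zero]
    ext i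
    simp [mulVec_diagonal]
  obtain ⟨k, hk⟩ := hT μ x.1 (u ⟨μ, hroot⟩) hx0 hx1 (hu ⟨μ, hroot⟩)
  apply hv ⟨μ, hroot⟩
  have h1 := x.2 1
  rw [map_one, one_mulVec] at h1
  simp [hk, h1]

lemma Nonderogatory.exists_aeval_of_commute {T : Matrix n n ℂ} (hT : Nonderogatory T)
    (hs : Tᵀ = T) {Y : Matrix n n ℂ} (hY : T * Y = Y * T) : ∃ g : ℂ[X], Y = aeval T g := by
  obtain ⟨v, hv⟩ := hT.exists_cyclic hs
  obtain ⟨g, hg⟩ := hv (Y *ᵥ v)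
  refine ⟨g, ?_⟩
  apply Matrix.toLin'.injective
  ext1 i
  ext1
  obtain ⟨f, hf⟩ := hv (Pi.single i 1)
  have hc : Y * aeval T f = aeval T f * Y := by
    rw [aeval_eq_sum_range, Finset.mul_sum, Finset.sum_mul]
    refine Finset.sum_congr rfl fun k _ => ?_
    rw [mul_smul_comm, smul_mul_assoc, ((show Commute Y T from hY.symm).pow_right k).eq]
  simp only [LinearMap.comp_apply, LinearMap.single_apply, toLin'_apply]
  rw [hf, mulVec_mulVec, hc, ← mulVec_mulVec, hg, mulVec_mulVec, mulVec_mulVec,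
    ← map_mul, ← map_mul, mul_comm]

lemma transpose_aeval (T : Matrix n n ℂ) (hs : Tᵀ = T) (g : ℂ[X]) : (aeval T g)ᵀ = aeval T g := by
  induction g using Polynomial.induction_on' with
  | add p q hp hq => simp [hp, hq]
  | monomial k a =>
    simp [aeval_monomial, transpose_pow, hs, Algebra.algebraMap_eq_smul_one]

lemma Nonderogatory.skew_eq_zero {T : Matrix n n ℂ} (hT : Nonderogatory T) (hs : Tᵀ = T)
    {K : Matrix n n ℂ} (hK : Kᵀ = -K) (hc : T * K = K * T) : K = 0 := by
  obtain ⟨g, rfl⟩ := hT.exists_aeval_of_commute hs hc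
  rw [transpose_aeval T hs] at hK
  ext i j
  exact self_eq_neg.mp (congrFun (congrFun hK i) j)

/-- If `N` is trace-orthogonal to all powers of a symmetric nonderogatory `T`, then `N` is the
commutator of `T` with a skew-symmetric matrix. -/
lemma Nonderogatory.exists_skew_commutator {T : Matrix n n ℂ} (hT : Nonderogatory T) (hs : Tᵀ = T)
    {N : Matrix n n ℂ} (hN : Nᵀ = N) (htr : ∀ k : ℕ, (T ^ k * N).trace = 0) :
    ∃ K : Matrix n n ℂ, Kᵀ = -K ∧ T * K - K * T = N := by
  let S : Submodule ℂ (Matrix n n ℂ) :=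
    { carrier := {Z | ∃ K : Matrix n n ℂ, Kᵀ = -K ∧ T * K - K * T = Z}
      add_mem' := by
        rintro _ _ ⟨K, hK, rfl⟩ ⟨K', hK', rfl⟩
        exact ⟨K + K', by simp [hK, hK', add_comm], by noncomm_ring⟩
      zero_mem' := ⟨0, by simp, by simp⟩
      smul_mem' := by
        rintro c _ ⟨K, hK, rfl⟩
        exact ⟨c • K, by simp [hK], by simp [smul_sub]⟩ }
  change N ∈ S
  by_contra hNS
  obtain ⟨f, hfN, hf⟩ := Submodule.exists_le_ker_of_notMem hNS
  let Y : Matrix n n ℂ := fun i j => f (Matrix.single j i 1)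
  have hY : ∀ Z, f Z = (Y * Z).trace := by
    intro Z
    conv_lhs => rw [matrix_eq_sum_single Z]
    simp only [map_sum, Matrix.trace, diag_apply, mul_apply]
    rw [Finset.sum_comm]
    refine Finset.sum_congr rfl fun i _ => Finset.sum_congr rfl fun j _ => ?_
    have : Matrix.single j i (Z j i) = Z j i • Matrix.single j i (1 : ℂ) := by simp
    rw [this, map_smul, smul_eq_mul, mul_comm]
  have htrT : ∀ Z : Matrix n n ℂ, (Yᵀ * Z).trace = (Y * Zᵀ).trace := by
    intro Z
    rw [← trace_transpose, transpose_mul, transpose_transpose, trace_mul_comm]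
  have hcomm : T * (Y + Yᵀ) = (Y + Yᵀ) * T := by
    set Q := Y + Yᵀ with hQ
    have hQs : Qᵀ = Q := by rw [hQ, transpose_add, transpose_transpose, add_comm]
    have hskew : (Q * T - T * Q)ᵀ = -(Q * T - T * Q) := by
      rw [transpose_sub, transpose_mul, transpose_mul, hs, hQs, neg_sub]
    have hzero : ∀ K : Matrix n n ℂ, Kᵀ = -K → ((Q * T - T * Q) * K).trace = 0 := by
      intro K hK
      have h1 : (Y * (T * K - K * T)).trace = 0 := by
        rw [← hY]; exact hf ⟨K, hK, rfl⟩
      have h2 : (Yᵀ * (T * K - K * T)).trace = 0 := by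
        rw [htrT, transpose_sub, transpose_mul, transpose_mul, hs, hK]
        rw [← h1]; congr 2; noncomm_ring
      have h3 : (Q * (T * K - K * T)).trace = 0 := by
        rw [hQ, add_mul, trace_add, h1, h2, add_zero]
      rw [← h3, mul_sub, sub_mul, trace_sub, trace_sub, ← mul_assoc, ← mul_assoc]
      congr 1
      rw [mul_assoc T, trace_mul_comm]
    have hsq : ∀ i j, (Q * T - T * Q) i j = 0 := by
      intro i j
      have hk := hzero (Matrix.single j i 1 - Matrix.single i j 1) (by
        simp [transpose_sub])
      rw [mul_sub, trace_sub, trace_mul_single, trace_mul_single] at hk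
      have h4 := congrFun (congrFun hskew i) j
      simp only [transpose_apply, Matrix.neg_apply] at h4
      simp only [MulOpposite.smul_eq_mul_unop, MulOpposite.unop_op, mul_one] at hk
      rw [h4] at hk
      linear_combination hk / 2
    have : Q * T - T * Q = 0 := by ext i j; exact hsq i j
    exact (sub_eq_zero.mp this).symm
  obtain ⟨g, hg⟩ := hT.exists_aeval_of_commute hs hcomm
  apply hfN
  have h1 : ((Y + Yᵀ) * N).trace = 0 := by
    rw [hg, aeval_eq_sum_range, Finset.sum_mul, trace_sum]
    refine Finset.sum_eq_zero fun i _ => ?_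
    rw [smul_mul_assoc, trace_smul, htr, smul_zero]
  rw [add_mul, trace_add, htrT, hN, ← two_mul, ← hY] at h1
  simpa using h1

end LinearAlgebra

open Filter Topology

/-- A family of solutions of a linear system depending affinely on a complex parameter is constant,
provided that the system is injective for all parameters, including infinity. -/
lemma solution_const {E F : Type*} [NormedAddCommGroup E] [NormedSpace ℂ E]
    [NormedAddCommGroup F] [NormedSpace ℂ F] [FiniteDimensional ℂ E] [FiniteDimensional ℂ F]
    (L₀ L₁ : E →L[ℂ] F) (D₀ D₁ : F) (hinj : ∀ z : ℂ, Function.Injective (L₀ + z • L₁))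
    (hinf : Function.Injective L₁) (k : ℂ → E) (hk : ∀ z, (L₀ + z • L₁) (k z) = D₀ + z • D₁) :
    ∃ c : E, ∀ z, k z = c := by
  have : CompleteSpace E := FiniteDimensional.complete ℂ E
  have leftInv : ∀ L : E →L[ℂ] F, Function.Injective L → ∃ P : F →L[ℂ] E, P ∘L L = 1 := by
    intro L hL
    obtain ⟨P, hP⟩ := LinearMap.exists_leftInverse_of_injective (L : E →ₗ[ℂ] F)
      (LinearMap.ker_eq_bot.mpr hL)
    refine ⟨LinearMap.toContinuousLinearMap P, ?_⟩
    ext x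
    exact LinearMap.congr_fun hP x
  have key : ∀ (P : F →L[ℂ] E) (L : E →L[ℂ] F) (x : E), IsUnit (P ∘L L) →
      x = Ring.inverse (P ∘L L) (P (L x)) := by
    intro P L x hu
    have h := Ring.inverse_mul_cancel _ hu
    exact (congrArg (fun T : E →L[ℂ] E => T x) h).symm
  have hdiff : Differentiable ℂ k := by
    intro z₀
    obtain ⟨P, hP⟩ := leftInv _ (hinj z₀)
    have hG : DifferentiableAt ℂ (fun z : ℂ => P ∘L (L₀ + z • L₁)) z₀ := by fun_prop
    have hunit : ∀ᶠ z in 𝓝 z₀, IsUnit (P ∘L (L₀ + z • L₁)) := by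
      refine hG.continuousAt.eventually (p := fun T => IsUnit T) ?_
      simp only [hP]
      exact Units.nhds 1
    have hinv : DifferentiableAt ℂ
        (fun z : ℂ => Ring.inverse (P ∘L (L₀ + z • L₁)) (P (D₀ + z • D₁))) z₀ := by
      refine DifferentiableAt.clm_apply ?_ (by fun_prop)
      refine DifferentiableAt.comp z₀ (g := Ring.inverse) ?_ hG
      rw [hP]
      exact differentiableAt_inverse isUnit_one
    refine hinv.congr_of_eventuallyEq ?_
    filter_upwards [hunit] with z hz
    rw [← hk z]
    exact key P _ _ hz
  obtain ⟨P, hP⟩ := leftInv _ hinf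
  have hG : ContinuousAt (fun w : ℂ => P ∘L (w • L₀ + L₁)) 0 := by fun_prop
  have hG0 : P ∘L ((0 : ℂ) • L₀ + L₁) = 1 := by rw [zero_smul, zero_add, hP]
  have hunit : ∀ᶠ w in 𝓝 (0 : ℂ), IsUnit (P ∘L (w • L₀ + L₁)) := by
    refine hG.eventually (p := fun T => IsUnit T) ?_
    simp only [hG0]
    exact Units.nhds 1
  have hlim : Tendsto (fun w : ℂ => Ring.inverse (P ∘L (w • L₀ + L₁)) (P (w • D₀ + D₁)))
      (𝓝 0) (𝓝 (P D₁)) := by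
    have : ContinuousAt
        (fun w : ℂ => Ring.inverse (P ∘L (w • L₀ + L₁)) (P (w • D₀ + D₁))) 0 := by
      refine ContinuousAt.clm_apply ?_ (by fun_prop)
      refine ContinuousAt.comp (g := Ring.inverse) ?_ hG
      rw [hG0]
      exact (differentiableAt_inverse (𝕜 := ℂ) isUnit_one).continuousAt
    have h := this.tendsto
    rw [hG0, Ring.inverse_one] at h
    simpa using h
  have hinv0 : Tendsto (fun z : ℂ => z⁻¹) (cocompact ℂ) (𝓝 0) := by
    rw [← Metric.cobounded_eq_cocompact]
    exact tendsto_inv₀_cobounded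
  refine ⟨P D₁, fun z => hdiff.apply_eq_of_tendsto_cocompact z ?_⟩
  refine (hlim.comp hinv0).congr' ?_
  have hne : ∀ᶠ z : ℂ in cocompact ℂ, z ≠ 0 := by
    rw [← Metric.cobounded_eq_cocompact]
    exact Bornology.eventually_ne_cobounded 0
  filter_upwards [hinv0.eventually hunit, hne] with z hz hz0
  have h1 : (z⁻¹ • L₀ + L₁) (k z) = z⁻¹ • D₀ + D₁ := by
    have := congrArg (fun y => z⁻¹ • y) (hk z)
    simpa [smul_add, smul_smul, hz0] using this
  rw [Function.comp_apply, ← h1]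
  exact (key P _ _ hz).symm

lemma hasDerivAt_det_add_smul {𝕜 n : Type*} [NontriviallyNormedField 𝕜] [Fintype n]
    [DecidableEq n] (M N : Matrix n n 𝕜) :
    HasDerivAt (fun s : 𝕜 => (M + s • N).det) (M.adjugate * N).trace 0 := by
  have h1 : HasDerivAt (fun s : 𝕜 => (M + s • N).det)
      (∑ σ : Equiv.Perm n, Equiv.Perm.sign σ •
        ∑ i, (∏ j ∈ Finset.univ.erase i, M (σ j) j) • N (σ i) i) 0 := by
    simp_rw [det_apply]
    refine HasDerivAt.fun_sum fun σ _ => ?_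
    simp_rw [Units.smul_def, zsmul_eq_mul]
    refine HasDerivAt.const_mul _ ?_
    have := HasDerivAt.fun_finsetProd (u := Finset.univ) (x := (0 : 𝕜))
      (f := fun j s => (M + s • N) (σ j) j) (f' := fun j => N (σ j) j) (fun j _ => by
        simpa using ((hasDerivAt_id (0 : 𝕜)).mul_const (N (σ j) j)).const_add (M (σ j) j))
    simpa using this
  convert h1 using 1
  have h2 : (M.adjugate * N).trace = ∑ i, (M.updateCol i (fun j => N j i)).det := by
    refine Finset.sum_congr rfl fun i _ => ?_
    rw [← cramer_apply, cramer_eq_adjugate_mulVec]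
    rfl
  rw [h2]
  simp_rw [det_apply, Finset.smul_sum]
  rw [Finset.sum_comm]
  refine Finset.sum_congr rfl fun σ _ => Finset.sum_congr rfl fun i _ => ?_
  congr 1
  rw [← Finset.mul_prod_erase _ _ (Finset.mem_univ i), updateCol_self, smul_eq_mul, mul_comm]
  congr 1
  refine Finset.prod_congr rfl fun j hj => ?_
  rw [updateCol_ne (Finset.ne_of_mem_erase hj)]

section Pencil
open Filter Topology

variable {n : Type*} [Fintype n] [DecidableEq n]

lemma eq_zero_of_mul_eq_zero {f : ℂ → ℂ} (hf : Continuous f) (h : ∀ w, w * f w = 0) (w : ℂ) :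
    f w = 0 := by
  have h1 : Set.EqOn f (fun _ => 0) {0}ᶜ := fun w hw => by
    simpa [show w ≠ 0 from hw] using h w
  exact congrFun (hf.ext_on (dense_compl_singleton 0) continuous_const h1) w

lemma trace_pow_mul_eq_zero {T N : Matrix n n ℂ}
    (h : ∀ w : ℂ, w * ((1 - w • T).adjugate * N).trace = 0) (k : ℕ) : (T ^ k * N).trace = 0 := by
  have hcont : ∀ k : ℕ, Continuous fun w : ℂ => (T ^ k * (1 - w • T).adjugate * N).trace := by
    intro k
    refine Continuous.matrix_trace (Continuous.matrix_mul (Continuous.matrix_mul continuous_const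
      (Continuous.matrix_adjugate ?_)) continuous_const)
    fun_prop
  suffices H : ∀ k : ℕ, ∀ w : ℂ, (T ^ k * (1 - w • T).adjugate * N).trace = 0 by
    simpa using H k 0
  intro k
  induction k with
  | zero =>
    refine eq_zero_of_mul_eq_zero (hcont 0) fun w => ?_
    simpa using h w
  | succ k ih =>
    refine eq_zero_of_mul_eq_zero (hcont (k + 1)) fun w => ?_
    have h0 : (T ^ k * N).trace = 0 := by simpa using ih 0
    have h1 : w • (T ^ (k + 1) * (1 - w • T).adjugate * N) =
        T ^ k * (1 - w • T).adjugate * N - (1 - w • T).det • (T ^ k * N) := by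
      have h2 := mul_adjugate (1 - w • T)
      rw [sub_mul, one_mul, sub_eq_iff_eq_add] at h2
      have h3 : w • (T * (1 - w • T).adjugate) = (1 - w • T).adjugate - (1 - w • T).det • 1 := by
        rw [← smul_mul_assoc]; exact eq_sub_of_add_eq' h2.symm
      have h4 := congrArg (fun Z => T ^ k * Z * N) h3
      simpa [mul_assoc, pow_succ, mul_sub, sub_mul] using h4
    have h5 := congrArg trace h1
    rw [trace_smul, trace_sub, ih w, trace_smul, h0] at h5
    simpa using h5

attribute [local instance] Matrix.normedAddCommGroup Matrix.normedSpace

/-- If an infinitesimal deformation of a symmetric pencil preserves the determinant to first order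
and all members of the pencil are nonderogatory, then it is an infinitesimal rotation. -/
lemma exists_skew_commutator_pencil {A C A' C' : Matrix n n ℂ} (hA : Aᵀ = A) (hC : Cᵀ = C)
    (hA' : A'ᵀ = A') (hC' : C'ᵀ = C')
    (h : ∀ y z : ℂ, ((1 - y • A - z • C).adjugate * (y • A' + z • C')).trace = 0)
    (hnd : ∀ z : ℂ, Nonderogatory (A + z • C)) (hinf : Nonderogatory C) :
    ∃ K : Matrix n n ℂ, Kᵀ = -K ∧ A * K - K * A = A' ∧ C * K - K * C = C' := by
  have hsol : ∀ y z : ℂ, ∀ k : ℕ, ((y • A + z • C) ^ k * (y • A' + z • C')).trace = 0 := by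
    intro y z k
    refine trace_pow_mul_eq_zero (fun w => ?_) k
    have := h (w * y) (w * z)
    simp only [mul_smul, ← smul_add, sub_sub, mul_smul_comm, trace_smul, smul_eq_mul] at this
    exact this
  let S : Submodule ℂ (Matrix n n ℂ) :=
    { carrier := {K | Kᵀ = -K}
      add_mem' := fun {a b} ha hb => by
        simp only [Set.mem_ofPred_eq] at ha hb ⊢
        rw [transpose_add, ha, hb]; abel
      zero_mem' := by simp
      smul_mem' := fun c a ha => by
        simp only [Set.mem_ofPred_eq] at ha ⊢
        rw [transpose_smul, ha, smul_neg] }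
  let ad : Matrix n n ℂ → (S →L[ℂ] Matrix n n ℂ) := fun T => LinearMap.toContinuousLinearMap
    { toFun := fun K => T * K.1 - K.1 * T
      map_add' := fun a b => by simp only [Submodule.coe_add, mul_add, add_mul]; abel
      map_smul' := fun c a => by
        simp only [Submodule.coe_smul, mul_smul_comm, smul_mul_assoc, smul_sub, RingHom.id_apply] }
  have had : ∀ T K, ad T K = T * K.1 - K.1 * T := fun T K => rfl
  have hadinj : ∀ T : Matrix n n ℂ, Tᵀ = T → Nonderogatory T → Function.Injective (ad T) := by
    intro T hT hTn
    rw [injective_iff_map_eq_zero]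
    rintro ⟨K, hK⟩ hKT
    rw [had, sub_eq_zero] at hKT
    exact Subtype.ext (hTn.skew_eq_zero hT hK hKT)
  have hlin : ∀ z : ℂ, ad A + z • ad C = ad (A + z • C) := by
    intro z
    ext1 K
    simp only [_root_.add_apply, _root_.smul_apply, had, add_mul, mul_add,
      smul_mul_assoc, mul_smul_comm, smul_sub]
    abel
  have hsymm : ∀ z : ℂ, (A + z • C)ᵀ = A + z • C := fun z => by
    rw [transpose_add, transpose_smul, hA, hC]
  have hex : ∀ z : ℂ, ∃ K : S, (ad A + z • ad C) K = A' + z • C' := by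
    intro z
    obtain ⟨K, hK, hKN⟩ := (hnd z).exists_skew_commutator (hsymm z) (N := A' + z • C')
      (by rw [transpose_add, transpose_smul, hA', hC'])
      (fun k => by simpa using hsol 1 z k)
    exact ⟨⟨K, hK⟩, by rw [hlin, had, hKN]⟩
  choose k hk using hex
  obtain ⟨K, hK⟩ := solution_const (ad A) (ad C) A' C'
    (fun z => by
      have := hadinj _ (hsymm z) (hnd z)
      rw [← hlin] at this
      exact this) (hadinj C hC hinf) k hk
  have h0 : ad A K = A' := by simpa [hK] using hk 0
  have h1 : ad A K + ad C K = A' + C' := by simpa [hK] using hk 1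
  refine ⟨K.1, K.2, h0, ?_⟩
  rw [h0] at h1
  exact add_left_cancel h1

/-- Infinitesimal rigidity for pencils whose first matrix is diagonal with distinct entries. -/
lemma deformation_eq_zero {a a' : n → ℂ} (ha : Function.Injective a) {C C' : Matrix n n ℂ}
    (hC : Cᵀ = C) (hC' : C'ᵀ = C')
    (h : ∀ y z : ℂ,
      ((1 - y • diagonal a - z • C).adjugate * (y • diagonal a' + z • C')).trace = 0)
    (hnd : ∀ z : ℂ, Nonderogatory (diagonal a + z • C)) (hinf : Nonderogatory C) :
    a' = 0 ∧ C' = 0 := by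
  obtain ⟨K, hskew, hA, hCK⟩ := exists_skew_commutator_pencil (diagonal_transpose a) hC
    (diagonal_transpose a') hC' h hnd hinf
  have hent : ∀ i j, a i * K i j - K i j * a j = diagonal a' i j := fun i j => by
    rw [← hA, Matrix.sub_apply, diagonal_mul, mul_diagonal]
  have ha' : a' = 0 := by
    ext i
    have := hent i i
    rw [diagonal_apply_eq] at this
    rw [← this, Pi.zero_apply]; ring
  have hK : ∀ i j, i ≠ j → K i j = 0 := by
    intro i j hij
    have := hent i j
    rw [diagonal_apply_ne _ hij, mul_comm, ← mul_sub, mul_eq_zero, sub_eq_zero] at this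
    exact this.resolve_right fun h => hij (ha h)
  have hK0 : K = 0 := by
    ext i j
    by_cases hij : i = j
    · subst hij
      have := congrFun (congrFun hskew i) i
      rw [transpose_apply, Matrix.neg_apply] at this
      simpa using self_eq_neg.mp this
    · exact hK i j hij
  exact ⟨ha', by rw [← hCK, hK0]; simp⟩

end Pencil

section Walsh

/-- The polar derivative of `q` (regarded as having degree `k`) with respect to the point `w`. -/
noncomputable def polarDerivative (k : ℕ) (w : ℂ) (q : ℂ[X]) : ℂ[X] :=
  (k : ℂ) • q - (X - C w) * derivative q

lemma iterate_derivative_X_sub_C_mul (w : ℂ) (p : ℂ[X]) (i : ℕ) :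
    derivative^[i] ((X - C w) * p) =
      (X - C w) * derivative^[i] p + (i : ℂ) • derivative^[i - 1] p := by
  rw [sub_mul, iterate_derivative_sub, mul_comm X, iterate_derivative_mul_X,
    iterate_derivative_C_mul]
  rw [Nat.cast_smul_eq_nsmul]
  ring

lemma eval_iterate_derivative_polarDerivative (m i : ℕ) (hi : i ≤ m) (w : ℂ) (q : ℂ[X]) :
    (derivative^[m - i] (polarDerivative (m + 1) w q)).eval 0 =
      w * (derivative^[m + 1 - i] q).eval 0 + (i + 1) * (derivative^[m - i] q).eval 0 := by
  have h : derivative^[m - i - 1] (derivative q) = derivative^[m - i - 1 + 1] q :=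
    (Function.iterate_succ_apply _ _ _).symm
  have h' : derivative^[m - i] (derivative q) = derivative^[m - i + 1] q :=
    (Function.iterate_succ_apply _ _ _).symm
  rw [polarDerivative, iterate_derivative_sub, iterate_derivative_X_sub_C_mul, h', h,
    iterate_derivative_smul, show m + 1 - i = m - i + 1 by omega]
  rcases Nat.eq_zero_or_pos (m - i) with h0 | h0
  · have : i = m := by omega
    subst this
    simp
    ring
  · rw [Nat.sub_add_cancel h0]
    simp [Nat.cast_sub hi]
    ring

/-- Twice applying Leibniz: the apolar pairing with `(X - a) p`. -/
lemma sum_eval_derivative_X_sub_C_mul (m : ℕ) (a x : ℂ) (p q : ℂ[X])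
    (hp : p.natDegree ≤ m) :
    ∑ i ∈ Finset.range (m + 2), (derivative^[i] ((X - C a) * p)).eval x *
        (derivative^[m + 1 - i] q).eval 0 =
      ∑ i ∈ Finset.range (m + 1), (derivative^[i] p).eval x *
        (derivative^[m - i] (polarDerivative (m + 1) (x - a) q)).eval 0 := by
  have h0 : derivative^[m + 1] p = 0 :=
    iterate_derivative_eq_zero (by omega)
  simp only [iterate_derivative_X_sub_C_mul, eval_add, eval_mul, eval_sub, eval_X, eval_C,
    eval_smul, smul_eq_mul, add_mul, Finset.sum_add_distrib]
  rw [Finset.sum_range_succ, h0, eval_zero, mul_zero, zero_mul, add_zero,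
    Finset.sum_range_succ' (fun i => (i : ℂ) * _ * _)]
  simp only [Nat.cast_zero, zero_mul, add_zero]
  rw [← Finset.sum_add_distrib]
  refine Finset.sum_congr rfl fun i hi => ?_
  have hi : i ≤ m := by simpa [Nat.lt_succ_iff] using hi
  rw [eval_iterate_derivative_polarDerivative m i hi, Nat.add_sub_add_right m 1 i,
    Nat.add_sub_cancel]
  push_cast
  ring

lemma normSq_mul_im_inv_sub_le {ξ r : ℂ} (hξ : 0 < ξ.im) (hr : r.im ≤ 0) :
    ξ.im * Complex.normSq (1 / (ξ - r)) + (1 / (ξ - r)).im ≤ 0 := by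
  have h0 : ξ - r ≠ 0 := fun h => by
    have := congrArg Complex.im h
    simp at this; linarith
  have hn : 0 < Complex.normSq (ξ - r) := Complex.normSq_pos.mpr h0
  rw [one_div, Complex.inv_im, Complex.normSq_inv, ← div_eq_mul_inv, ← add_div]
  exact div_nonpos_of_nonpos_of_nonneg (by simp; linarith) hn.le

lemma coeff_polarDerivative (m : ℕ) (w : ℂ) (q : ℂ[X]) (j : ℕ) :
    (polarDerivative (m + 1) w q).coeff j =
      (m + 1 - j) * q.coeff j + w * ((j + 1) * q.coeff (j + 1)) := by
  rcases j with _ | j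
  · simp [polarDerivative, sub_mul, coeff_derivative]
  · simp [polarDerivative, sub_mul, coeff_X_mul, coeff_derivative]
    ring

lemma natDegree_polarDerivative {m : ℕ} {w : ℂ} {q : ℂ[X]} (hq : q.natDegree = m + 1)
    (hroots : ∀ r ∈ q.roots, r.im ≤ 0) (hw : 0 < w.im) :
    (polarDerivative (m + 1) w q).natDegree = m ∧ polarDerivative (m + 1) w q ≠ 0 := by
  have hq0 : q ≠ 0 := by rintro rfl; simp at hq
  have hsp : q.Splits := IsAlgClosed.splits q
  have hcard : q.roots.card = m + 1 := by rw [← hq, hsp.natDegree_eq_card_roots]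
  have hne : (polarDerivative (m + 1) w q).coeff m ≠ 0 := by
    have h1 : q.coeff m = -q.leadingCoeff * q.roots.sum := by
      rw [← hsp.nextCoeff_eq_neg_sum_roots_mul_leadingCoeff, nextCoeff, hq]
      simp
    have h2 : q.coeff (m + 1) = q.leadingCoeff := by rw [leadingCoeff, hq]
    rw [coeff_polarDerivative, h1, h2]
    intro h
    have h3 : q.leadingCoeff * ((m + 1) * w - q.roots.sum) = 0 := by
      rw [← h]; ring
    rw [mul_eq_zero, or_iff_right (leadingCoeff_ne_zero.mpr hq0), sub_eq_zero] at h3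
    have h4 := congrArg Complex.im h3
    have h5 : q.roots.sum.im ≤ 0 := by
      rw [show q.roots.sum.im = (q.roots.map Complex.im).sum from
        map_multiset_sum Complex.imAddGroupHom _]
      simpa using Multiset.sum_le_card_nsmul (q.roots.map Complex.im) 0 fun x hx => by
        obtain ⟨r, hr, rfl⟩ := Multiset.mem_map.mp hx
        exact hroots r hr
    have h6 : ((m + 1 : ℂ) * w).im = (m + 1) * w.im := by simp
    rw [h6] at h4
    have : (0:ℝ) < (m + 1) * w.im := by positivity
    linarith
  refine ⟨le_antisymm ?_ (le_natDegree_of_ne_zero hne), fun h => hne (by simp [h])⟩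
  rw [natDegree_le_iff_coeff_eq_zero]
  intro j hj
  have hj1 : q.coeff (j + 1) = 0 := coeff_eq_zero_of_natDegree_lt (by omega)
  rw [coeff_polarDerivative, hj1]
  rcases Nat.lt_or_ge (m + 1) j with h | h
  · rw [coeff_eq_zero_of_natDegree_lt (by omega)]; simp
  · have : j = m + 1 := by omega
    subst this; simp

lemma im_le_zero_of_mem_roots_polarDerivative {m : ℕ} {w : ℂ} {q : ℂ[X]}
    (hq : q.natDegree = m + 1) (hroots : ∀ r ∈ q.roots, r.im ≤ 0) (hw : 0 < w.im) {ξ : ℂ}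
    (hξ : (polarDerivative (m + 1) w q).eval ξ = 0) : ξ.im ≤ 0 := by
  by_contra! hξ0
  have hq0 : q ≠ 0 := by rintro rfl; simp at hq
  have hqξ : q.eval ξ ≠ 0 := fun h => by
    have := hroots ξ ((mem_roots hq0).mpr h)
    linarith
  have hsp : q.Splits := IsAlgClosed.splits q
  have hcard : q.roots.card = m + 1 := by rw [← hq, hsp.natDegree_eq_card_roots]
  have hm : ((m : ℂ) + 1) ≠ 0 := by exact_mod_cast Nat.succ_ne_zero m
  have h1 : (m + 1 : ℂ) = (ξ - w) * (q.roots.map fun z => 1 / (ξ - z)).sum := by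
    rw [← hsp.eval_derivative_div_eval_of_ne_zero hqξ]
    simp [polarDerivative] at hξ
    field_simp
    linear_combination hξ
  have hξw : ξ - w ≠ 0 := by
    intro h
    rw [h, zero_mul] at h1
    exact hm h1
  set u : ℂ := 1 / (ξ - w) with hu
  have hupos : 0 < ξ.im * Complex.normSq u + u.im := by
    have hn : 0 < Complex.normSq (ξ - w) := Complex.normSq_pos.mpr hξw
    rw [hu, one_div, Complex.inv_im, Complex.normSq_inv, ← div_eq_mul_inv, ← add_div]
    refine div_pos (by simpa using hw) hn
  have hsum : (q.roots.map fun z => 1 / (ξ - z)).sum = (m + 1) * u := by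
    rw [hu, h1]; field_simp
  let ℓ : ℂ →+ ℝ :=
    { toFun := fun v => 2 * ξ.im * (u.re * v.re + u.im * v.im) + v.im
      map_zero' := by simp
      map_add' := fun a b => by simp; ring }
  have hlt : ∀ z ∈ q.roots, ℓ (1 / (ξ - z)) < ℓ u := by
    intro z hz
    have h2 := normSq_mul_im_inv_sub_le hξ0 (hroots z hz)
    set v := 1 / (ξ - z)
    simp only [ℓ, AddMonoidHom.coe_mk, ZeroHom.coe_mk]
    rw [Complex.normSq_apply] at h2 hupos
    nlinarith [mul_nonneg hξ0.le (add_nonneg (mul_self_nonneg (v.re - u.re))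
      (mul_self_nonneg (v.im - u.im)))]
  have h3 := congrArg ℓ hsum
  rw [map_multiset_sum, Multiset.map_map] at h3
  have h4 := Multiset.sum_lt_sum_of_nonempty (s := q.roots) (f := fun z => ℓ (1 / (ξ - z)))
    (g := fun _ => ℓ u) (by rintro h; simp [h] at hcard) hlt
  have h5 : ℓ ((m + 1) * u) = (m + 1) * ℓ u := by simp [ℓ]; ring
  rw [Multiset.map_const', Multiset.sum_replicate, hcard, nsmul_eq_mul] at h4
  rw [h5] at h3
  push_cast at h4
  exact absurd h3 h4.ne

/-- A form of the Grace–Walsh–Szegő theorem for the symmetric additive convolution. -/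
lemma sum_eval_derivative_ne_zero (s : Multiset ℂ) (q : ℂ[X]) (x : ℂ) (hq0 : q ≠ 0)
    (hq : q.natDegree = s.card) (hroots : ∀ r ∈ q.roots, r.im ≤ 0)
    (hs : ∀ a ∈ s, 0 < (x - a).im) :
    ∑ i ∈ Finset.range (s.card + 1), (derivative^[i] (s.map fun a => X - C a).prod).eval x *
        (derivative^[s.card - i] q).eval 0 ≠ 0 := by
  induction s using Multiset.induction generalizing q with
  | empty =>
    rw [Multiset.card_zero] at hq
    rw [natDegree_eq_zero] at hq
    obtain ⟨c, rfl⟩ := hq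
    simpa using hq0
  | cons a s ih =>
    have ha := hs a (Multiset.mem_cons_self a s)
    rw [Multiset.card_cons] at hq
    obtain ⟨hdeg, hne⟩ := natDegree_polarDerivative hq hroots ha
    rw [Multiset.map_cons, Multiset.prod_cons, Multiset.card_cons,
      sum_eval_derivative_X_sub_C_mul _ _ _ _ _
        (by rw [natDegree_multiset_prod_X_sub_C_eq_card])]
    exact ih _ hne hdeg
      (fun r hr => im_le_zero_of_mem_roots_polarDerivative hq hroots ha
        ((mem_roots hne).mp hr))
      (fun b hb => hs b (Multiset.mem_cons_of_mem hb))

end Walsh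

section RealRooted
open Filter Topology

lemma eval_map_boxplus (m : ℕ) (p q : ℝ[X]) (ξ : ℂ) :
    ((boxplus m p q).map (algebraMap ℝ ℂ)).eval ξ = (m.factorial : ℂ)⁻¹ *
      ∑ i ∈ Finset.range (m + 1), (derivative^[i] (p.map (algebraMap ℝ ℂ))).eval ξ *
        (derivative^[m - i] (q.map (algebraMap ℝ ℂ))).eval 0 := by
  have h : ∀ k : ℕ, (derivative^[k] (q.map (algebraMap ℝ ℂ))).eval 0 =
      (((derivative^[k] q).eval 0 : ℝ) : ℂ) := fun k => by
    rw [Polynomial.iterate_derivative_map, ← map_zero (algebraMap ℝ ℂ), eval_map_apply]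
    rfl
  simp only [boxplus, Polynomial.map_smul, eval_smul, Polynomial.map_sum, eval_finsetSum,
    Polynomial.map_mul, Polynomial.map_C, eval_mul, eval_C, Polynomial.iterate_derivative_map]
  rw [smul_eq_mul]
  congr 1
  · simp
  · exact Finset.sum_congr rfl fun i _ => by
      rw [← Polynomial.iterate_derivative_map q, h, mul_comm]; rfl

/-- The symmetric additive convolution preserves real-rootedness. -/
lemma splits_boxplus {m : ℕ} {p q : ℝ[X]} (hp : p.Monic) (hps : p.Splits) (hpm : p.natDegree = m)
    (hq : q.Monic) (hqs : q.Splits) (hqm : q.natDegree = m) : (boxplus m p q).Splits := by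
  have key : ∀ ξ : ℂ, 0 < ξ.im → ((boxplus m p q).map (algebraMap ℝ ℂ)).eval ξ ≠ 0 := by
    intro ξ hξ
    have hcard : (p.roots.map (algebraMap ℝ ℂ)).card = m := by
      rw [Multiset.card_map, ← hps.natDegree_eq_card_roots, hpm]
    have h := sum_eval_derivative_ne_zero (p.roots.map (algebraMap ℝ ℂ)) (q.map (algebraMap ℝ ℂ)) ξ
      (hq.map _).ne_zero (by rw [hcard, natDegree_map, hqm])
      (fun r hr => by
        rw [hqs.roots_map] at hr
        obtain ⟨s, -, rfl⟩ := Multiset.mem_map.mp hr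
        simp)
      (fun a ha => by
        obtain ⟨s, -, rfl⟩ := Multiset.mem_map.mp ha
        simpa using hξ)
    rw [eval_map_boxplus]
    refine mul_ne_zero (inv_ne_zero (by exact_mod_cast m.factorial_ne_zero)) ?_
    rw [hcard, ← hps.roots_map, ← (hps.map _).eq_prod_roots_of_monic (hp.map _)] at h
    exact h
  refine Splits.of_splits_map (algebraMap ℝ ℂ) (IsAlgClosed.splits _) fun ξ hξ => ?_
  have hroot : ((boxplus m p q).map (algebraMap ℝ ℂ)).eval ξ = 0 := (mem_roots'.mp hξ).2
  have him : ξ.im = 0 := by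
    rcases lt_trichotomy ξ.im 0 with h | h | h
    · refine absurd ?_ (key (starRingEnd ℂ ξ) (by simpa using h))
      rw [eval_map_algebraMap] at hroot ⊢
      rw [aeval_conj, hroot, map_zero]
    · exact h
    · exact absurd hroot (key ξ h)
  exact ⟨ξ.re, by apply Complex.ext <;> simp [him]⟩

lemma laguerre_nonneg (s : Multiset ℝ) (x : ℝ) :
    0 ≤ ((derivative (s.map fun r => X - C r).prod).eval x) ^ 2 -
      (s.map fun r => X - C r).prod.eval x *
        (derivative (derivative (s.map fun r => X - C r).prod)).eval x := by
  induction s using Multiset.induction with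
  | empty => simp
  | cons r s ih =>
    simp only [Multiset.map_cons, Multiset.prod_cons, derivative_mul, derivative_add, derivative_sub,
      derivative_X, derivative_C, sub_zero, one_mul, eval_add, eval_mul, eval_sub, eval_X, eval_C]
    set P := (s.map fun r => X - C r).prod
    nlinarith [mul_nonneg (sq_nonneg (x - r)) ih, sq_nonneg (P.eval x)]

/-- The Laguerre inequality. -/
lemma laguerre_pos {G : ℝ[X]} (hG : G.Monic) (hs : G.Splits) (hd : G.natDegree ≠ 0) {x : ℝ}
    (hx : G.eval x ≠ 0) :
    0 < ((derivative G).eval x) ^ 2 - G.eval x * (derivative (derivative G)).eval x := by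
  have h := hs.eq_prod_roots_of_monic hG
  rw [hs.natDegree_eq_card_roots] at hd
  obtain ⟨r, hr⟩ := Multiset.exists_mem_of_ne_zero (Multiset.card_eq_zero.not.mp hd)
  obtain ⟨s, hs'⟩ := Multiset.exists_cons_of_mem hr
  have hnn := laguerre_nonneg s x
  rw [hs'] at h
  rw [h] at hx ⊢
  simp only [Multiset.map_cons, Multiset.prod_cons, derivative_mul, derivative_add, derivative_sub,
    derivative_X, derivative_C, sub_zero, one_mul, eval_add, eval_mul, eval_sub, eval_X, eval_C]
    at hx ⊢
  set P := (s.map fun r => X - C r).prod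
  have hP : 0 < (P.eval x) ^ 2 := by
    have := right_ne_zero_of_mul hx
    positivity
  nlinarith [mul_nonneg (sq_nonneg (x - r)) hnn]

lemma iterate_derivative_eq_factorial {m : ℕ} {p : ℝ[X]} (hp : p.Monic) (hpm : p.natDegree = m) :
    derivative^[m] p = C (m.factorial : ℝ) := by
  have h := natDegree_iterate_derivative p m
  rw [hpm, Nat.sub_self, Nat.le_zero] at h
  rw [eq_C_of_natDegree_eq_zero h, coeff_iterate_derivative, zero_add, Nat.descFactorial_self,
    ← hpm, hp.coeff_natDegree]
  simp

lemma boxplus_add_C {m : ℕ} {p q : ℝ[X]} (hp : p.Monic) (hpm : p.natDegree = m) (c : ℝ) :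
    boxplus m p (q + C c) = boxplus m p q + C c := by
  have h1 := iterate_derivative_eq_factorial hp hpm
  have h2 : ∑ i ∈ Finset.range (m + 1), C ((derivative^[m - i] (C c : ℝ[X])).eval 0) *
      derivative^[i] p = C c * C (m.factorial : ℝ) := by
    rw [Finset.sum_eq_single m]
    · simp [h1]
    · intro i hi him
      have : 0 < m - i := by have := Finset.mem_range.mp hi; omega
      rw [iterate_derivative_C this]; simp
    · simp
  simp only [boxplus, iterate_map_add, eval_add, C_add, add_mul, Finset.sum_add_distrib, h2,
    smul_add]
  congr 1
  rw [← C_mul, smul_C, smul_eq_mul]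
  congr 1
  have := m.factorial_ne_zero
  field_simp

/-- Small constant perturbations of a polynomial with simple real roots are real-rooted. -/
lemma eventually_splits_add_C {m : ℕ} {b : Fin m → ℝ} (hb : Function.Injective b) (hm : m ≠ 0) :
    ∀ᶠ c in 𝓝 (0 : ℝ), ((∏ i, (X - C (b i))) + C c : ℝ[X]).Splits := by
  set q : ℝ[X] := ∏ i, (X - C (b i)) with hq
  have hdeg : q.natDegree = m := by rw [hq, natDegree_prod_of_monic _ _ (fun i _ => monic_X_sub_C _)]; simp
  obtain ⟨U, hU, hdis⟩ := (Set.finite_range b).t2_separation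
  have hloc : ∀ i, ∀ᶠ c in 𝓝 (0 : ℝ), ∃ x ∈ U (b i), q.eval x + c = 0 := by
    intro i
    have h0 : q.eval (b i) = 0 := by
      rw [hq, eval_prod]; exact Finset.prod_eq_zero (Finset.mem_univ i) (by simp)
    have hd : (derivative q).eval (b i) ≠ 0 := by
      rw [hq, derivative_prod_finset, eval_finsetSum, Finset.sum_eq_single i]
      · simp only [derivative_sub, derivative_X, derivative_C, sub_zero, mul_one, eval_prod,
          eval_sub, eval_X, eval_C]
        rw [Finset.prod_ne_zero_iff]
        intro j hj
        exact sub_ne_zero.mpr fun h => Finset.ne_of_mem_erase hj (hb h).symm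
      · intro j _ hj
        rw [eval_mul, eval_prod, Finset.prod_eq_zero (i := i) (by simp [hj.symm]) (by simp), zero_mul]
      · simp
    have hmap := (q.hasStrictDerivAt (b i)).map_nhds_eq hd
    have hn : (fun x => q.eval x) '' U (b i) ∈ 𝓝 (0 : ℝ) := by
      rw [← h0, ← hmap]
      exact image_mem_map ((hU _).2.mem_nhds (hU _).1)
    have hneg : Tendsto (fun c : ℝ => -c) (𝓝 0) (𝓝 0) := by
      simpa using (continuous_neg (G := ℝ)).tendsto 0
    filter_upwards [hneg hn] with c hc
    obtain ⟨x, hx, hxc⟩ := hc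
    exact ⟨x, hx, by simp only at hxc; linarith⟩
  filter_upwards [eventually_all.mpr hloc] with c hc
  choose x hxU hx using hc
  have hxinj : Function.Injective x := by
    intro i j hij
    by_contra hne
    have := hdis ⟨i, rfl⟩ ⟨j, rfl⟩ (fun h => hne (hb h))
    exact Set.disjoint_left.mp this (hxU i) (hij ▸ hxU j)
  have hdeg' : (q + C c).natDegree = m := by rw [natDegree_add_C, hdeg]
  have hne : q + C c ≠ 0 := by intro h; rw [h] at hdeg'; simp at hdeg'; omega
  rw [splits_iff_card_roots, hdeg']
  refine le_antisymm (hdeg' ▸ card_roots' _) ?_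
  calc m = (Finset.univ.image x).card := by rw [Finset.card_image_of_injective _ hxinj]; simp
    _ ≤ (q + C c).roots.toFinset.card := by
      refine Finset.card_le_card fun y hy => ?_
      obtain ⟨i, -, rfl⟩ := Finset.mem_image.mp hy
      rw [Multiset.mem_toFinset, mem_roots hne, IsRoot, eval_add, eval_C, hx]
    _ ≤ _ := Multiset.toFinset_card_le _

lemma monic_boxplus {m : ℕ} {p q : ℝ[X]} (hp : p.Monic) (hpm : p.natDegree = m)
    (hq : q.Monic) (hqm : q.natDegree = m) :
    (boxplus m p q).Monic ∧ (boxplus m p q).natDegree = m := by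
  obtain ⟨R, hR, hRd⟩ : ∃ R : ℝ[X], boxplus m p q = p + R ∧ R.degree < p.degree := by
    have hf := m.factorial_ne_zero
    refine ⟨(m.factorial : ℝ)⁻¹ • ∑ i ∈ Finset.range m,
      C ((derivative^[m - (i + 1)] q).eval 0) * derivative^[i + 1] p, ?_, ?_⟩
    · rw [boxplus, Finset.sum_range_succ', smul_add, add_comm, Nat.sub_zero,
        iterate_derivative_eq_factorial hq hqm]
      congr 1
      rw [eval_C, Function.iterate_zero_apply, smul_eq_C_mul, ← mul_assoc, ← C_mul,
        inv_mul_cancel₀ (by exact_mod_cast hf), C_1, one_mul]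
    · refine (degree_smul_le _ _).trans_lt ?_
      refine (degree_sum_le _ _).trans_lt ?_
      rw [Finset.sup_lt_iff (bot_lt_iff_ne_bot.mpr (degree_ne_bot.mpr hp.ne_zero))]
      intro i hi
      have him := Finset.mem_range.mp hi
      rw [← smul_eq_C_mul]
      refine (degree_smul_le _ _).trans_lt ?_
      rw [degree_eq_natDegree hp.ne_zero, hpm]
      refine degree_le_natDegree.trans_lt ?_
      have := natDegree_iterate_derivative p (i + 1)
      exact_mod_cast show (derivative^[i + 1] p).natDegree < m by omega
  have hm : (boxplus m p q).Monic := hR ▸ hp.add_of_left hRd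
  exact ⟨hm, by rw [hR, natDegree_add_eq_left_of_degree_lt hRd, hpm]⟩

/-- If one of two real-rooted polynomials has simple roots, so has their convolution. -/
lemma boxplus_simple_roots {m : ℕ} {p : ℝ[X]} (hp : p.Monic) (hps : p.Splits)
    (hpm : p.natDegree = m) {b : Fin m → ℝ} (hb : Function.Injective b) (x : ℝ) :
    ¬ ((boxplus m p (∏ i, (X - C (b i)))).eval x = 0 ∧
      (derivative (boxplus m p (∏ i, (X - C (b i))))).eval x = 0) := by
  rintro ⟨h0, h1⟩
  set q : ℝ[X] := ∏ i, (X - C (b i)) with hq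
  have hqm : q.Monic := monic_prod_of_monic _ _ fun i _ => monic_X_sub_C _
  have hdeg : q.natDegree = m := by
    rw [hq, natDegree_prod_of_monic _ _ (fun i _ => monic_X_sub_C _)]; simp
  obtain ⟨hGm, hGd⟩ := monic_boxplus hp hpm hqm hdeg
  set G := boxplus m p q with hG
  have hm : m ≠ 0 := by
    rintro rfl
    rw [eq_one_of_monic_natDegree_zero hGm hGd] at h0
    simp at h0
  have hev : ∀ c : ℝ, c ≠ 0 → (q + C c).Splits → 0 < -c * (derivative (derivative G)).eval x := by
    intro c hc hs
    have hqc : (q + C c).natDegree = m := by rw [natDegree_add_C, hdeg]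
    have hqcm : (q + C c).Monic := by
      refine hqm.add_of_left (degree_C_le.trans_lt ?_)
      rw [← natDegree_pos_iff_degree_pos, hdeg]
      omega
    have hsp := splits_boxplus hp hps hpm hqcm hs hqc
    obtain ⟨hm', hd'⟩ := monic_boxplus hp hpm hqcm hqc
    rw [boxplus_add_C hp hpm] at hsp hm' hd'
    have := laguerre_pos hm' hsp (by omega) (x := x) (by rw [eval_add, h0]; simpa using hc)
    simpa [← hG, h0, h1] using this
  obtain ⟨ε, hε, hball⟩ := Metric.eventually_nhds_iff.mp (eventually_splits_add_C hb hm)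
  have hp1 := hev (ε / 2) (by positivity) (hball (by rw [Real.dist_eq]; rw [sub_zero, abs_of_pos] <;> linarith))
  have hp2 := hev (-(ε / 2)) (by simpa using hε.ne') (hball (by rw [Real.dist_eq, sub_zero, abs_neg, abs_of_pos] <;> linarith))
  linarith

end RealRooted

section Forms
open Filter Topology

/-- Indices of the monomials `x ^ i y ^ (j - i) z ^ (m - j)` other than `x ^ m`; the same type
indexes the entries of a real diagonal matrix (`j = m`) together with the entries of a real
symmetric matrix (`j < m`). -/
abbrev Idx (m : ℕ) : Type := {p : Fin m × Fin (m + 1) // (p.1 : ℕ) ≤ p.2}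

variable {m : ℕ}

/-- The exponent vector of the monomial with the given index. -/
noncomputable def expo (p : Idx m) : Fin 3 →₀ ℕ :=
  Finsupp.single 0 (p.1.1 : ℕ) + Finsupp.single 1 ((p.1.2 : ℕ) - p.1.1) +
    Finsupp.single 2 (m - p.1.2)

lemma expo_zero (p : Idx m) : expo p 0 = p.1.1 := by simp [expo]

lemma expo_one (p : Idx m) : expo p 1 = (p.1.2 : ℕ) - p.1.1 := by simp [expo]

lemma expo_two (p : Idx m) : expo p 2 = m - p.1.2 := by simp [expo]

lemma degree_fin_three (d : Fin 3 →₀ ℕ) : d.degree = d 0 + d 1 + d 2 := by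
  rw [Finsupp.degree_eq_sum, Fin.sum_univ_three]

lemma degree_expo (p : Idx m) : (expo p).degree = m := by
  have h1 := p.2
  have h2 := p.1.2.2
  rw [degree_fin_three, expo_zero, expo_one, expo_two]
  omega

lemma expo_injective : Function.Injective (expo (m := m)) := by
  intro p q h
  have h0 := DFunLike.congr_fun h 0
  have h1 := DFunLike.congr_fun h 1
  rw [expo_zero, expo_zero] at h0
  rw [expo_one, expo_one] at h1
  have hp := p.2
  have hq := q.2
  exact Subtype.ext (Prod.ext (Fin.ext h0) (Fin.ext (by omega)))

lemma expo_ne_single (p : Idx m) : expo p ≠ Finsupp.single 0 m := by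
  intro h
  have h0 := DFunLike.congr_fun h 0
  rw [expo_zero, Finsupp.single_eq_same] at h0
  have := p.1.1.2
  omega

lemma exists_expo_eq {d : Fin 3 →₀ ℕ} (hd : d.degree = m) (hd' : d ≠ Finsupp.single 0 m) :
    ∃ p : Idx m, expo p = d := by
  rw [degree_fin_three] at hd
  have h0 : d 0 < m := by
    by_contra! h
    refine hd' (Finsupp.ext fun i => ?_)
    fin_cases i <;> simp <;> omega
  refine ⟨⟨(⟨d 0, h0⟩, ⟨d 0 + d 1, by omega⟩), by simp⟩, Finsupp.ext fun i => ?_⟩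
  fin_cases i
  · simp [expo_zero]
  · simp [expo_one]
  · simp [expo_two]; omega

/-- The ternary form of degree `m`, monic in the first variable, with the given coefficients. -/
noncomputable def form (e : Idx m → ℝ) : MvPolynomial (Fin 3) ℝ :=
  MvPolynomial.X 0 ^ m + ∑ p, MvPolynomial.monomial (expo p) (e p)

/-- The coefficients of a form. -/
noncomputable def coeffs (D : MvPolynomial (Fin 3) ℝ) : Idx m → ℝ := fun p => D.coeff (expo p)

lemma form_coeffs {D : MvPolynomial (Fin 3) ℝ} (hD : D.IsHomogeneous m)
    (h1 : D.coeff (Finsupp.single 0 m) = 1) : form (coeffs D : Idx m → ℝ) = D := by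
  classical
  ext d
  simp only [form, coeffs, MvPolynomial.coeff_add, MvPolynomial.coeff_sum,
    MvPolynomial.coeff_monomial, MvPolynomial.coeff_X_pow]
  by_cases hd : d.degree = m
  · by_cases hd' : d = Finsupp.single 0 m
    · subst hd'
      rw [if_pos rfl, h1, Finset.sum_eq_zero fun p _ => if_neg (expo_ne_single p), add_zero]
    · obtain ⟨p, rfl⟩ := exists_expo_eq hd hd'
      rw [if_neg fun h => hd' h.symm, zero_add, Finset.sum_eq_single p]
      · simp
      · intro q _ hq
        exact if_neg fun h => hq (expo_injective h)
      · simp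
  · rw [hD.coeff_eq_zero hd, if_neg, Finset.sum_eq_zero, add_zero]
    · intro p _
      exact if_neg fun h : expo p = d => hd (h ▸ degree_expo p)
    · rintro rfl
      simp at hd

lemma isHomogeneous_form (e : Idx m → ℝ) : (form e).IsHomogeneous m := by
  refine (MvPolynomial.isHomogeneous_X_pow 0 m).add (MvPolynomial.IsHomogeneous.sum _ _ _ fun p _ =>
    MvPolynomial.isHomogeneous_monomial _ (degree_expo p))

lemma coeff_single_eq_eval {D : MvPolynomial (Fin 3) ℝ} (hD : D.IsHomogeneous m) :
    D.coeff (Finsupp.single 0 m) = MvPolynomial.eval ![1, 0, 0] D := by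
  classical
  rw [MvPolynomial.eval_eq', Finset.sum_eq_single (Finsupp.single 0 m)]
  · rw [Fin.prod_univ_three]; simp
  · intro d hd hne
    have hdeg : d.degree = m := by
      by_contra h
      exact MvPolynomial.mem_support_iff.mp hd (hD.coeff_eq_zero h)
    rw [degree_fin_three] at hdeg
    have : d 1 ≠ 0 ∨ d 2 ≠ 0 := by
      by_contra! h
      refine hne (Finsupp.ext fun i => ?_)
      fin_cases i <;> simp <;> omega
    rw [Fin.prod_univ_three]
    rcases this with h | h <;> simp [h]
  · intro h
    rw [MvPolynomial.notMem_support_iff.mp h, zero_mul]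

/-- A family of polynomials whose coefficients depend smoothly on the parameter. -/
def SmoothFamily {E : Type*} [NormedAddCommGroup E] [NormedSpace ℝ E]
    (D : E → MvPolynomial (Fin 3) ℝ) : Prop :=
  ∀ d, ContDiff ℝ 1 fun s => (D s).coeff d

section SmoothFamily

variable {E : Type*} [NormedAddCommGroup E] [NormedSpace ℝ E] {D D' : E → MvPolynomial (Fin 3) ℝ}

lemma smoothFamily_const (P : MvPolynomial (Fin 3) ℝ) : SmoothFamily fun _ : E => P :=
  fun _ => contDiff_const

lemma smoothFamily_C {f : E → ℝ} (hf : ContDiff ℝ 1 f) :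
    SmoothFamily fun s => MvPolynomial.C (f s) := by
  classical
  intro d
  simp only [MvPolynomial.coeff_C]
  split_ifs
  · exact hf
  · exact contDiff_const

lemma SmoothFamily.sub (h : SmoothFamily D) (h' : SmoothFamily D') :
    SmoothFamily fun s => D s - D' s := fun d => by
  simpa only [MvPolynomial.coeff_sub] using (h d).sub (h' d)

lemma SmoothFamily.mul (h : SmoothFamily D) (h' : SmoothFamily D') :
    SmoothFamily fun s => D s * D' s := fun d => by
  classical
  simp only [MvPolynomial.coeff_mul]
  exact ContDiff.sum fun x _ => (h x.1).mul (h' x.2)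

lemma SmoothFamily.sum {ι : Type*} {D : ι → E → MvPolynomial (Fin 3) ℝ} (s : Finset ι)
    (h : ∀ i ∈ s, SmoothFamily (D i)) : SmoothFamily fun t => ∑ i ∈ s, D i t := fun d => by
  simp only [MvPolynomial.coeff_sum]
  exact ContDiff.sum fun i hi => h i hi d

lemma SmoothFamily.prod {ι : Type*} {D : ι → E → MvPolynomial (Fin 3) ℝ} (s : Finset ι)
    (h : ∀ i ∈ s, SmoothFamily (D i)) : SmoothFamily fun t => ∏ i ∈ s, D i t := by
  classical
  induction s using Finset.induction with
  | empty => simpa using smoothFamily_const 1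
  | insert i s hi ih =>
    simp only [Finset.prod_insert hi]
    exact (h i (by simp)).mul (ih fun j hj => h j (by simp [hj]))

lemma SmoothFamily.iterate_pderiv (h : SmoothFamily D) (i : Fin 3) (k : ℕ) :
    SmoothFamily fun s => (MvPolynomial.pderiv i)^[k] (D s) := by
  induction k with
  | zero => exact h
  | succ k ih =>
    intro d
    simp only [Function.iterate_succ_apply', MvPolynomial.coeff_pderiv]
    exact (ih _).mul contDiff_const

end SmoothFamily

/-- The determinantal form `det (x - y diag(a) - z C)`. -/
noncomputable def detForm (a : Fin m → ℝ) (S : Matrix (Fin m) (Fin m) ℝ) :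
    MvPolynomial (Fin 3) ℝ :=
  Matrix.det (Matrix.of fun i j =>
    MvPolynomial.C ((1 : Matrix (Fin m) (Fin m) ℝ) i j) * MvPolynomial.X 0 -
      MvPolynomial.C (diagonal a i j) * MvPolynomial.X 1 - MvPolynomial.C (S i j) * MvPolynomial.X 2)

lemma aeval_detForm {R : Type*} [CommRing R] [Algebra ℝ R] (a : Fin m → ℝ)
    (S : Matrix (Fin m) (Fin m) ℝ) (v : Fin 3 → R) :
    MvPolynomial.aeval v (detForm a S) = (v 0 • (1 : Matrix (Fin m) (Fin m) R) -
      v 1 • (diagonal a).map (algebraMap ℝ R) - v 2 • S.map (algebraMap ℝ R)).det := by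
  rw [detForm, AlgHom.map_det]
  congr 1
  ext i j
  by_cases hij : i = j <;> simp [mul_comm, Matrix.one_apply, diagonal_apply, hij]

lemma isHomogeneous_detForm (a : Fin m → ℝ) (S : Matrix (Fin m) (Fin m) ℝ) :
    (detForm a S).IsHomogeneous m := by
  rw [detForm, det_apply]
  refine MvPolynomial.IsHomogeneous.sum _ _ _ fun σ _ => ?_
  have h : MvPolynomial.IsHomogeneous (∏ i, (Matrix.of fun i j =>
      MvPolynomial.C ((1 : Matrix (Fin m) (Fin m) ℝ) i j) * MvPolynomial.X 0 -
      MvPolynomial.C (diagonal a i j) * MvPolynomial.X 1 -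
      MvPolynomial.C (S i j) * MvPolynomial.X (2 : Fin 3)) (σ i) i) (∑ _i : Fin m, 1) := by
    refine MvPolynomial.IsHomogeneous.prod _ _ _ fun i _ => ?_
    exact ((MvPolynomial.isHomogeneous_C_mul_X _ _).sub (MvPolynomial.isHomogeneous_C_mul_X _ _)).sub
      (MvPolynomial.isHomogeneous_C_mul_X _ _)
  rw [Finset.sum_const, Finset.card_univ, Fintype.card_fin, smul_eq_mul, mul_one] at h
  rw [Units.smul_def, zsmul_eq_mul]
  simpa using h.C_mul ((Equiv.Perm.sign σ : ℤ) : ℝ)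

lemma form_coeffs_detForm (a : Fin m → ℝ) (S : Matrix (Fin m) (Fin m) ℝ) :
    form (coeffs (detForm a S) : Idx m → ℝ) = detForm a S := by
  refine form_coeffs (isHomogeneous_detForm a S) ?_
  rw [coeff_single_eq_eval (isHomogeneous_detForm a S), ← MvPolynomial.coe_aeval_eq_eval]
  change MvPolynomial.aeval _ _ = _
  rw [aeval_detForm]
  simp

lemma smoothFamily_detForm {E : Type*} [NormedAddCommGroup E] [NormedSpace ℝ E]
    {a : E → Fin m → ℝ} {S : E → Matrix (Fin m) (Fin m) ℝ} (ha : ∀ i, ContDiff ℝ 1 fun s => a s i)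
    (hS : ∀ i j, ContDiff ℝ 1 fun s => S s i j) : SmoothFamily fun s => detForm (a s) (S s) := by
  simp only [detForm, det_apply]
  refine SmoothFamily.sum _ fun σ _ => ?_
  simp only [Units.smul_def, zsmul_eq_mul]
  refine (smoothFamily_const _).mul (SmoothFamily.prod _ fun i _ => ?_)
  simp only [Matrix.of_apply]
  refine ((smoothFamily_const _).sub ((smoothFamily_C ?_).mul (smoothFamily_const _))).sub
    ((smoothFamily_C (hS _ _)).mul (smoothFamily_const _))
  by_cases h : σ i = i
  · simpa [diagonal_apply, h] using ha i
  · simpa [diagonal_apply, h] using contDiff_const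

/-- The diagonal matrix encoded by a parameter vector. -/
def paramDiag (c : Idx m → ℝ) (i : Fin m) : ℝ := c ⟨(i, Fin.last m), i.2.le⟩

/-- The symmetric matrix encoded by a parameter vector. -/
def paramSymm (c : Idx m → ℝ) : Matrix (Fin m) (Fin m) ℝ :=
  Matrix.of fun i j => c ⟨(min i j, (max i j).castSucc), by simp⟩

lemma paramSymm_transpose (c : Idx m → ℝ) : (paramSymm c)ᵀ = paramSymm c := by
  ext i j
  simp only [paramSymm, transpose_apply, Matrix.of_apply, min_comm j i, max_comm j i]

lemma exists_param (a : Fin m → ℝ) (S : Matrix (Fin m) (Fin m) ℝ) (hS : Sᵀ = S) :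
    ∃ c : Idx m → ℝ, paramDiag c = a ∧ paramSymm c = S := by
  refine ⟨fun p => if h : (p.1.2 : ℕ) < m then S p.1.1 ⟨p.1.2, h⟩ else a p.1.1, ?_, ?_⟩
  · ext i; simp [paramDiag]
  · ext i j
    simp only [paramSymm, Matrix.of_apply, Fin.val_castSucc, Fin.is_lt, dite_true]
    rcases le_total i j with h | h
    · simp [h]
    · simp only [h, min_eq_right, max_eq_left]
      exact congrFun (congrFun hS i) j

lemma eq_zero_of_param {c : Idx m → ℝ} (ha : paramDiag c = 0) (hS : paramSymm c = 0) : c = 0 := by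
  ext ⟨⟨i, j⟩, hij⟩
  induction j using Fin.lastCases with
  | last => exact congrFun ha i
  | cast j =>
    have h := congrFun (congrFun hS i) j
    have hij' : i ≤ j := hij
    simp only [paramSymm, Matrix.of_apply, min_eq_left hij', max_eq_right hij'] at h
    exact h

/-- The coefficients of the determinantal form, as a function of the parameters. -/
noncomputable def detMap (c : Idx m → ℝ) : Idx m → ℝ := coeffs (detForm (paramDiag c) (paramSymm c))

lemma form_detMap (c : Idx m → ℝ) : form (detMap c) = detForm (paramDiag c) (paramSymm c) :=
  form_coeffs_detForm _ _

lemma contDiff_detMap : ContDiff ℝ 1 (detMap (m := m)) := by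
  rw [contDiff_pi]
  intro p
  refine smoothFamily_detForm (fun i => ?_) (fun i j => ?_) (expo p)
  · exact contDiff_apply ℝ ℝ _
  · exact contDiff_apply ℝ ℝ _

end Forms

section Rigidity
open Filter Topology

variable {m : ℕ}

lemma hasDerivAt_aeval_update {𝕜 : Type*} [NontriviallyNormedField 𝕜] [Algebra ℝ 𝕜]
    (P : MvPolynomial (Fin 3) ℝ) (v : Fin 3 → 𝕜) (k : Fin 3) :
    HasDerivAt (fun s => MvPolynomial.aeval (Function.update v k s) P)
      (MvPolynomial.aeval v (MvPolynomial.pderiv k P)) (v k) := by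
  induction P using MvPolynomial.induction_on with
  | C a => simpa using hasDerivAt_const (v k) (algebraMap ℝ 𝕜 a)
  | add p q hp hq => simp only [map_add]; exact hp.add hq
  | mul_X p i hp =>
    have hX : HasDerivAt (fun s => Function.update v k s i)
        (MvPolynomial.aeval v (MvPolynomial.pderiv k (MvPolynomial.X i : MvPolynomial (Fin 3) ℝ)))
        (v k) := by
      by_cases h : i = k
      · subst h
        simpa using hasDerivAt_id' (v i)
      · simpa [MvPolynomial.pderiv_X, h, Pi.single_apply, eq_comm] using hasDerivAt_const (v k) (v i)
    have := hp.mul hX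
    simp only [Function.update_eq_self, MvPolynomial.pderiv_mul, map_add, map_mul,
      MvPolynomial.aeval_X] at this ⊢
    exact this

/-- The complex pencil `v₀ - v₁ diag(a) - v₂ S`. -/
noncomputable def pencil (a : Fin m → ℝ) (S : Matrix (Fin m) (Fin m) ℝ) (v : Fin 3 → ℂ) :
    Matrix (Fin m) (Fin m) ℂ :=
  v 0 • (1 : Matrix (Fin m) (Fin m) ℂ) - v 1 • (diagonal a).map (algebraMap ℝ ℂ) -
    v 2 • S.map (algebraMap ℝ ℂ)

lemma aeval_pderiv_detForm_eq_zero {a : Fin m → ℝ} {S : Matrix (Fin m) (Fin m) ℝ} {v : Fin 3 → ℂ}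
    (h : (pencil a S v).adjugate = 0) (k : Fin 3) :
    MvPolynomial.aeval v (MvPolynomial.pderiv k (detForm a S)) = 0 := by
  obtain ⟨N, hN⟩ : ∃ N, ∀ s, pencil a S (Function.update v k s) = pencil a S v + (s - v k) • N := by
    fin_cases k
    · refine ⟨1, fun s => ?_⟩
      simp [pencil, sub_smul]; abel
    · refine ⟨-(diagonal a).map (algebraMap ℝ ℂ), fun s => ?_⟩
      simp only [pencil, Function.update_self, ne_eq, Fin.reduceEq, not_false_eq_true,
        Function.update_of_ne, Fin.mk_one, sub_smul, smul_neg]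
      abel
    · refine ⟨-S.map (algebraMap ℝ ℂ), fun s => ?_⟩
      simp [pencil, sub_smul]
  have h1 := hasDerivAt_aeval_update (𝕜 := ℂ) (detForm a S) v k
  have h2 := hasDerivAt_det_add_smul (pencil a S v) N
  rw [h, zero_mul, trace_zero] at h2
  have h3 : HasDerivAt (fun s => (pencil a S v + s • N).det) 0 (v k - v k) := by
    rwa [sub_self]
  replace h3 := h3.comp (h := fun s => s - v k) (v k) ((hasDerivAt_id' (v k)).sub_const (v k))
  rw [zero_mul] at h3
  refine h1.unique (h3.congr_of_eventuallyEq (Eventually.of_forall fun s => ?_))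
  change MvPolynomial.aeval _ _ = (pencil a S v + (s - v k) • N).det
  rw [aeval_detForm, ← hN]
  rfl

open ComplexOrder in
lemma im_eq_zero_of_eigenvector {T : Matrix (Fin m) (Fin m) ℂ} (hT : T.IsHermitian) {μ : ℂ}
    {u : Fin m → ℂ} (hu : u ≠ 0) (h : T *ᵥ u = μ • u) : μ.im = 0 := by
  have h1 : star u ⬝ᵥ T *ᵥ u = μ * (star u ⬝ᵥ u) := by rw [h, dotProduct_smul, smul_eq_mul]
  have h2 : star (star u ⬝ᵥ T *ᵥ u) = star u ⬝ᵥ T *ᵥ u := by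
    rw [← star_dotProduct, star_mulVec, hT.eq, ← dotProduct_mulVec]
  have h3 : star (star u ⬝ᵥ u) = star u ⬝ᵥ u := (star_dotProduct u u).symm
  have h4 : star u ⬝ᵥ u ≠ 0 := fun h => hu (dotProduct_star_self_eq_zero.mp h)
  rw [h1, star_mul', h3] at h2
  have := mul_right_cancel₀ h4 h2
  exact Complex.conj_eq_iff_im.mp this

/-- All real lines through `(1, 0, 0)` meet the curve in simple points. -/
def RealSimple (e : Idx m → ℝ) : Prop :=
  ∀ v : Fin 3 → ℝ, v ≠ 0 → ¬ (MvPolynomial.aeval v (form e) = 0 ∧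
    MvPolynomial.aeval v (MvPolynomial.pderiv 0 (form e)) = 0)

/-- The curve has no singular points `(x, 1, z)` with nonreal `z`. -/
def NonrealSmooth (e : Idx m → ℝ) : Prop :=
  ∀ x z : ℂ, z.im ≠ 0 → ¬ (MvPolynomial.aeval ![x, 1, z] (form e) = 0 ∧
    MvPolynomial.aeval ![x, 1, z] (MvPolynomial.pderiv 0 (form e)) = 0 ∧
    MvPolynomial.aeval ![x, 1, z] (MvPolynomial.pderiv 2 (form e)) = 0)

lemma RealSimple.not_of_ofReal {e : Idx m → ℝ} (h : RealSimple e) {v : Fin 3 → ℝ} (hv : v ≠ 0)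
    (h0 : MvPolynomial.aeval (fun i => (v i : ℂ)) (form e) = 0)
    (h1 : MvPolynomial.aeval (fun i => (v i : ℂ)) (MvPolynomial.pderiv 0 (form e)) = 0) : False := by
  have key : ∀ P : MvPolynomial (Fin 3) ℝ,
      MvPolynomial.aeval (fun i => (v i : ℂ)) P = ((MvPolynomial.aeval v P : ℝ) : ℂ) := fun P =>
    MvPolynomial.aeval_algebraMap_apply ℂ v P
  rw [key] at h0 h1
  exact h v hv ⟨by exact_mod_cast h0, by exact_mod_cast h1⟩

lemma isHermitian_map_ofReal {S : Matrix (Fin m) (Fin m) ℝ} (hS : Sᵀ = S) :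
    (S.map (algebraMap ℝ ℂ)).IsHermitian := by
  ext i j
  simp only [conjTranspose_apply, map_apply]
  rw [← congrFun (congrFun hS i) j]
  simp

lemma adjugate_pencil_eq_zero {a : Fin m → ℝ} {S : Matrix (Fin m) (Fin m) ℝ} {x y z : ℂ}
    {u w : Fin m → ℂ} (hu0 : u ≠ 0)
    (hu : (y • (diagonal a).map (algebraMap ℝ ℂ) + z • S.map (algebraMap ℝ ℂ)) *ᵥ u = x • u)
    (hw : (y • (diagonal a).map (algebraMap ℝ ℂ) + z • S.map (algebraMap ℝ ℂ)) *ᵥ w = x • w)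
    (h : ¬ ∃ k : ℂ, w = k • u) :
    (pencil a S ![x, y, z]).adjugate = 0 ∧ (pencil a S ![x, y, z]).det = 0 := by
  have key : ∀ u, (y • (diagonal a).map (algebraMap ℝ ℂ) + z • S.map (algebraMap ℝ ℂ)) *ᵥ u = x • u →
      pencil a S ![x, y, z] *ᵥ u = 0 := by
    intro u hu
    have : pencil a S ![x, y, z] = x • (1 : Matrix (Fin m) (Fin m) ℂ) -
        (y • (diagonal a).map (algebraMap ℝ ℂ) + z • S.map (algebraMap ℝ ℂ)) := by
      simp [pencil, sub_sub]
    rw [this, sub_mulVec, hu, smul_mulVec, one_mulVec, sub_self]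
  exact ⟨adjugate_eq_zero_of_not_smul hu0 (key u hu) (key w hw) h,
    exists_mulVec_eq_zero_iff.mp ⟨u, hu0, key u hu⟩⟩

section

variable {c : Idx m → ℝ}

lemma vanish_of_adjugate {v : Fin 3 → ℂ}
    (h : (pencil (paramDiag c) (paramSymm c) v).adjugate = 0 ∧
      (pencil (paramDiag c) (paramSymm c) v).det = 0) :
    MvPolynomial.aeval v (form (detMap c)) = 0 ∧
      ∀ k, MvPolynomial.aeval v (MvPolynomial.pderiv k (form (detMap c))) = 0 := by
  rw [form_detMap]
  exact ⟨by rw [aeval_detForm]; exact h.2, fun k => aeval_pderiv_detForm_eq_zero h.1 k⟩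

lemma nonderogatory_real (hR : RealSimple (detMap c)) (y z : ℝ) (hyz : ![y, z] ≠ 0) :
    Nonderogatory ((y : ℂ) • (diagonal (paramDiag c)).map (algebraMap ℝ ℂ) +
      (z : ℂ) • (paramSymm c).map (algebraMap ℝ ℂ)) := by
  intro μ u w hu0 hu hw
  by_contra hk
  have hH : ((y : ℂ) • (diagonal (paramDiag c)).map (algebraMap ℝ ℂ) +
      (z : ℂ) • (paramSymm c).map (algebraMap ℝ ℂ)).IsHermitian := by
    have h1 := isHermitian_map_ofReal (diagonal_transpose (paramDiag c))
    have h2 := isHermitian_map_ofReal (paramSymm_transpose c)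
    rw [IsHermitian, conjTranspose_add, conjTranspose_smul, conjTranspose_smul, h1.eq, h2.eq]
    simp
  have hμ := im_eq_zero_of_eigenvector hH hu0 hu
  obtain ⟨h1, h2⟩ := vanish_of_adjugate (adjugate_pencil_eq_zero hu0 hu hw hk)
  have hv : (![μ, (y : ℂ), (z : ℂ)] : Fin 3 → ℂ) = fun i => ((![μ.re, y, z] i : ℝ) : ℂ) := by
    ext i
    fin_cases i
    · apply Complex.ext <;> simp [hμ]
    · simp
    · simp
  rw [hv] at h1 h2
  refine hR.not_of_ofReal ?_ h1 (h2 0)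
  intro h
  refine hyz ?_
  ext i
  fin_cases i
  · simpa using congrFun h 1
  · simpa using congrFun h 2

lemma paramDiag_injective (hR : RealSimple (detMap c)) : Function.Injective (paramDiag c) := by
  intro i j hij
  by_contra hne
  have := nonderogatory_real hR 1 0 (by simp) (paramDiag c i) (Pi.single i 1) (Pi.single j 1)
    (by simp) (by ext k; by_cases h : k = i <;> simp [h])
    (by rw [hij]; ext k; by_cases h : k = j <;> simp [h])
  obtain ⟨k, hk⟩ := this
  have := congrFun hk j
  simp [Ne.symm hne] at this

lemma nonderogatory_of_small (hR : RealSimple (detMap c)) (hm : m < 3) (z : ℂ) (hz : z.im ≠ 0) :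
    Nonderogatory ((diagonal (paramDiag c)).map (algebraMap ℝ ℂ) +
      z • (paramSymm c).map (algebraMap ℝ ℂ)) := by
  intro μ u w hu0 hu hw
  by_contra hk
  rw [← one_smul ℂ ((diagonal (paramDiag c)).map (algebraMap ℝ ℂ))] at hu hw
  obtain ⟨h1, -⟩ := adjugate_pencil_eq_zero hu0 hu hw hk
  have hinj := paramDiag_injective hR
  interval_cases m
  · exact hu0 (Subsingleton.elim _ _)
  · rw [adjugate_subsingleton] at h1
    exact one_ne_zero h1
  · rw [adjugate_fin_two] at h1
    have e0 := congrFun (congrFun h1 0) 0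
    have e1 := congrFun (congrFun h1 1) 1
    simp [pencil] at e0 e1
    have i0 := congrArg Complex.im e0
    have i1 := congrArg Complex.im e1
    have r0 := congrArg Complex.re e0
    have r1 := congrArg Complex.re e1
    simp at i0 i1 r0 r1
    have hS : paramSymm c 0 0 = paramSymm c 1 1 := by
      have : z.im * (paramSymm c 0 0 - paramSymm c 1 1) = 0 := by linear_combination i0 - i1
      exact sub_eq_zero.mp ((mul_eq_zero.mp this).resolve_left hz)
    have : paramDiag c 0 = paramDiag c 1 := by
      rw [hS] at r1
      linear_combination r0 - r1
    exact absurd (hinj this) (by simp)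

lemma nonderogatory_pencil (hR : RealSimple (detMap c)) (hC : 3 ≤ m → NonrealSmooth (detMap c)) (z : ℂ) :
    Nonderogatory ((diagonal (paramDiag c)).map (algebraMap ℝ ℂ) +
      z • (paramSymm c).map (algebraMap ℝ ℂ)) := by
  by_cases hz : z.im = 0
  · have h := nonderogatory_real hR 1 z.re (by simp)
    rw [show (z.re : ℂ) = z by apply Complex.ext <;> simp [hz]] at h
    simpa using h
  · rcases Nat.lt_or_ge m 3 with hm | hm
    · exact nonderogatory_of_small hR hm z hz
    · intro μ u w hu0 hu hw
      by_contra hk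
      rw [← one_smul ℂ ((diagonal (paramDiag c)).map (algebraMap ℝ ℂ))] at hu hw
      obtain ⟨h1, h2⟩ := vanish_of_adjugate (adjugate_pencil_eq_zero hu0 hu hw hk)
      exact hC hm μ z hz ⟨h1, h2 0, h2 2⟩

lemma nonderogatory_paramSymm (hR : RealSimple (detMap c)) : Nonderogatory ((paramSymm c).map (algebraMap ℝ ℂ)) := by
  simpa using nonderogatory_real hR 0 1 (by simp)

end

lemma aeval_form (e : Idx m → ℝ) (v : Fin 3 → ℂ) : MvPolynomial.aeval v (form e) =
    v 0 ^ m + ∑ p, (e p : ℂ) * MvPolynomial.aeval v (MvPolynomial.monomial (R := ℝ) (expo p) 1) := by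
  simp [form, MvPolynomial.aeval_monomial]

/-- Where the pencil is everywhere nonderogatory, the coefficient map is a local submersion. -/
lemma range_detMap_mem_nhds {c : Idx m → ℝ} (ha : Function.Injective (paramDiag c))
    (hnd : ∀ z : ℂ, Nonderogatory ((diagonal (paramDiag c)).map (algebraMap ℝ ℂ) +
      z • (paramSymm c).map (algebraMap ℝ ℂ)))
    (hinf : Nonderogatory ((paramSymm c).map (algebraMap ℝ ℂ))) :
    Set.range (detMap (m := m)) ∈ 𝓝 (detMap c) := by
  have hstrict := (contDiff_detMap (m := m)).contDiffAt.hasStrictFDerivAt (x := c) one_ne_zero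
  set L := fderiv ℝ (detMap (m := m)) c
  have hinj : Function.Injective L := by
    rw [injective_iff_map_eq_zero]
    intro d hd
    have hline : HasDerivAt (fun s : ℝ => detMap (c + s • d)) 0 0 := by
      have h1 : HasDerivAt (fun s : ℝ => c + s • d) d 0 := by
        simpa using ((hasDerivAt_id (0 : ℝ)).smul_const d).const_add c
      have h2 := HasFDerivAt.comp_hasDerivAt (f := fun s : ℝ => c + s • d) (0 : ℝ)
        (l := detMap) (l' := L) (by simpa using hstrict.hasFDerivAt) h1
      rwa [hd] at h2
    have htr : ∀ v : Fin 3 → ℂ, ((pencil (paramDiag c) (paramSymm c) v).adjugate *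
        (v 1 • (diagonal (paramDiag d)).map (algebraMap ℝ ℂ) +
          v 2 • (paramSymm d).map (algebraMap ℝ ℂ))).trace = 0 := by
      intro v
      have h1 : HasDerivAt (fun s : ℝ => MvPolynomial.aeval v (form (detMap (c + s • d)))) 0 0 := by
        simp only [aeval_form]
        have h2 : HasDerivAt (fun s : ℝ => v 0 ^ m + ∑ p : Idx m, (detMap (c + s • d) p : ℂ) *
            MvPolynomial.aeval v (MvPolynomial.monomial (R := ℝ) (expo p) 1))
            (∑ p : Idx m, ((0 : ℝ) : ℂ) *
              MvPolynomial.aeval v (MvPolynomial.monomial (R := ℝ) (expo p) 1)) 0 := by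
          refine HasDerivAt.const_add _ (HasDerivAt.fun_sum fun p _ => ?_)
          refine HasDerivAt.mul_const ?_ _
          exact (hasDerivAt_pi.mp hline p).ofReal_comp
        simpa using h2
      set N := v 1 • (diagonal (paramDiag d)).map (algebraMap ℝ ℂ) +
          v 2 • (paramSymm d).map (algebraMap ℝ ℂ) with hN
      have h2 := (hasDerivAt_det_add_smul (pencil (paramDiag c) (paramSymm c) v) (-N)).comp_ofReal
        (z := 0)
      have h3 : ∀ s : ℝ, MvPolynomial.aeval v (form (detMap (c + s • d))) =
          (pencil (paramDiag c) (paramSymm c) v + (s : ℂ) • (-N)).det := by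
        intro s
        rw [form_detMap, aeval_detForm]
        congr 1
        ext i j
        by_cases hij : i = j
        · subst hij
          simp [pencil, hN, paramDiag, paramSymm]; ring
        · simp [pencil, hN, paramDiag, paramSymm, hij]; ring
      simp only [h3] at h1
      have h4 := h2.unique h1
      rw [mul_neg, trace_neg, neg_eq_zero] at h4
      exact h4
    have hdiag : ∀ f : Fin m → ℝ, (diagonal f).map (algebraMap ℝ ℂ) =
        diagonal fun i => (f i : ℂ) := fun f => by
      rw [diagonal_map (map_zero _)]; rfl
    have hsymm : ∀ c : Idx m → ℝ, ((paramSymm c).map (algebraMap ℝ ℂ))ᵀ =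
        (paramSymm c).map (algebraMap ℝ ℂ) := fun c => by
      rw [← transpose_map, paramSymm_transpose]
    have := deformation_eq_zero (a := fun i => (paramDiag c i : ℂ))
      (a' := fun i => (paramDiag d i : ℂ)) (fun i j h => ha (Complex.ofReal_injective h)) (hsymm c) (hsymm d)
      (fun y z => by
        have := htr ![1, y, z]
        simpa [pencil, hdiag] using this)
      (fun z => by simpa only [hdiag] using hnd z) hinf
    refine eq_zero_of_param ?_ ?_
    · ext i
      simpa using congrFun this.1 i
    · ext i j
      simpa using congrFun (congrFun this.2 i) j
  have hsurj : L.range = ⊤ := LinearMap.range_eq_top.mpr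
    ((LinearMap.injective_iff_surjective (f := (L : (Idx m → ℝ) →ₗ[ℝ] (Idx m → ℝ)))).mp hinj)
  rw [← hstrict.map_nhds_eq_of_surj hsurj]
  exact range_mem_map

end Rigidity

section Proper
open Filter Topology

variable {m : ℕ}

lemma aeval_form_real (e : Idx m → ℝ) (v : Fin 3 → ℝ) : MvPolynomial.aeval v (form e) =
    v 0 ^ m + ∑ p, e p * (v 0 ^ expo p 0 * v 1 ^ expo p 1 * v 2 ^ expo p 2) := by
  simp only [form, map_add, map_pow, MvPolynomial.aeval_X, map_sum, MvPolynomial.aeval_monomial]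
  congr 1
  refine Finset.sum_congr rfl fun p _ => ?_
  rw [Finsupp.prod_fintype _ _ (by simp), Fin.prod_univ_three]
  rfl

lemma abs_root_le {e : Idx m → ℝ} {v : Fin 3 → ℝ} (h : MvPolynomial.aeval v (form e) = 0)
    (h1 : |v 1| ≤ 1) (h2 : |v 2| ≤ 1) : |v 0| ≤ 1 + ∑ p, |e p| := by
  have hS : 0 ≤ ∑ p, |e p| := Finset.sum_nonneg fun _ _ => abs_nonneg _
  by_contra! hlt
  have hx : 1 ≤ |v 0| := by linarith
  have hx0 : 0 < |v 0| := by linarith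
  rw [aeval_form_real] at h
  have hm : m ≠ 0 := by
    rintro rfl
    rw [Fintype.sum_eq_zero _ fun p => p.1.1.elim0] at h
    simp at h
  have key : |v 0| ^ m ≤ (∑ p, |e p|) * |v 0| ^ (m - 1) := by
    rw [← abs_pow, eq_neg_of_add_eq_zero_left h, abs_neg, Finset.sum_mul]
    refine (Finset.abs_sum_le_sum_abs _ _).trans (Finset.sum_le_sum fun p _ => ?_)
    rw [abs_mul]
    refine mul_le_mul_of_nonneg_left ?_ (abs_nonneg _)
    rw [abs_mul, abs_mul, abs_pow, abs_pow, abs_pow, mul_assoc]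
    have hp : expo p 0 ≤ m - 1 := by rw [expo_zero]; have := p.1.1.2; omega
    calc |v 0| ^ expo p 0 * (|v 1| ^ expo p 1 * |v 2| ^ expo p 2)
        ≤ |v 0| ^ (m - 1) * (1 * 1) := by
          gcongr
          · exact pow_le_one₀ (abs_nonneg _) h1
          · exact pow_le_one₀ (abs_nonneg _) h2
      _ = |v 0| ^ (m - 1) := by ring
  rw [← mul_pow_sub_one hm] at key
  have := le_of_mul_le_mul_right key (by positivity)
  linarith

lemma abs_paramDiag_le (c : Idx m → ℝ) (i : Fin m) : |paramDiag c i| ≤ 1 + ∑ p, |detMap c p| := by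
  refine abs_root_le (v := ![paramDiag c i, 1, 0]) ?_ (by simp) (by simp)
  rw [form_detMap, aeval_detForm]
  refine det_eq_zero_of_row_eq_zero i fun j => ?_
  by_cases h : i = j
  · subst h; simp
  · simp [h]

lemma abs_entry_le_of_eigenvalues {S : Matrix (Fin m) (Fin m) ℝ} (hS : S.IsHermitian) {K : ℝ}
    (hK : ∀ i, |hS.eigenvalues i| ≤ K) (i j : Fin m) : |S i j| ≤ m * K := by
  rw [hS.spectral_theorem]
  have hU : ∀ i j, |(hS.eigenvectorUnitary : Matrix (Fin m) (Fin m) ℝ) i j| ≤ 1 := fun i j =>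
    entry_norm_bound_of_unitary hS.eigenvectorUnitary.2 i j
  simp only [Unitary.conjStarAlgAut_apply, mul_apply, diagonal_apply, mul_ite, mul_zero,
    Finset.sum_ite_eq', Finset.mem_univ, if_true]
  refine (Finset.abs_sum_le_sum_abs _ _).trans ?_
  calc _ ≤ ∑ _k : Fin m, K := by
        refine Finset.sum_le_sum fun k _ => ?_
        have h0 : 0 ≤ K := (abs_nonneg _).trans (hK i)
        rw [abs_mul, abs_mul]
        have h1 := hU i k
        have h2 := hU j k
        have h3 := hK k
        simp only [Function.comp_apply, RCLike.ofReal_real_eq_id, id, star_apply, star_trivial]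
        calc _ ≤ 1 * K * 1 := by gcongr
          _ = K := by ring
    _ = m * K := by simp

lemma abs_paramSymm_le (c : Idx m → ℝ) (i j : Fin m) :
    |paramSymm c i j| ≤ m * (1 + ∑ p, |detMap c p|) := by
  have hS : (paramSymm c).IsHermitian := by
    rw [IsHermitian, conjTranspose_eq_transpose_of_trivial, paramSymm_transpose]
  refine abs_entry_le_of_eigenvalues hS (fun k => ?_) i j
  refine abs_root_le (v := ![hS.eigenvalues k, 0, 1]) ?_ (by simp) (by simp)
  rw [form_detMap, aeval_detForm]
  have h : (paramSymm c).charpoly.eval (hS.eigenvalues k) = 0 := by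
    rw [hS.charpoly_eq, eval_prod]
    exact Finset.prod_eq_zero (Finset.mem_univ k) (by simp)
  rw [eval_charpoly] at h
  convert h using 2
  ext a b
  simp [scalar_apply, one_apply, diagonal_apply]

lemma isClosed_range_detMap : IsClosed (Set.range (detMap (m := m))) := by
  refine IsProperMap.isClosed_range (isProperMap_iff_isCompact_preimage.mpr
    ⟨contDiff_detMap.continuous, fun K hK => ?_⟩)
  refine Metric.isCompact_of_isClosed_isBounded
    (hK.isClosed.preimage contDiff_detMap.continuous) ?_
  obtain ⟨M, hM⟩ := hK.isBounded.exists_norm_le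
  set T := 1 + ∑ _p : Idx m, |M| 
  have hT0 : 0 ≤ T := add_nonneg zero_le_one (Finset.sum_nonneg fun _ _ => abs_nonneg _)
  refine (Metric.isBounded_closedBall (x := 0) (r := (m + 1) * T)).subset fun c hc => ?_
  have hle : 1 + ∑ p, |detMap c p| ≤ T := by
    refine add_le_add_right (Finset.sum_le_sum fun p _ => ?_) 1
    exact (norm_le_pi_norm (detMap c) p).trans ((hM _ hc).trans (le_abs_self M))
  rw [mem_closedBall_zero_iff, pi_norm_le_iff_of_nonneg (by positivity)]
  rintro ⟨⟨i, j⟩, hij⟩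
  induction j using Fin.lastCases with
  | last =>
    have := abs_paramDiag_le c i
    refine (this.trans hle).trans ?_
    nlinarith [mul_nonneg (Nat.cast_nonneg (α := ℝ) m) hT0]
  | cast j =>
    have h := abs_paramSymm_le c i j
    have hij' : i ≤ j := hij
    simp only [paramSymm, Matrix.of_apply, min_eq_left hij', max_eq_right hij'] at h
    refine h.trans ?_
    nlinarith [mul_le_mul_of_nonneg_left hle (Nat.cast_nonneg (α := ℝ) m)]

end Proper

section Path
open Filter Topology

variable {m : ℕ}

/-- Restriction of a ternary polynomial to the line `(X, y, z)`. -/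
noncomputable def slice (y z : ℝ) : MvPolynomial (Fin 3) ℝ →ₐ[ℝ] ℝ[X] :=
  MvPolynomial.aeval ![X, C y, C z]

lemma eval_slice (v : Fin 3 → ℝ) (P : MvPolynomial (Fin 3) ℝ) :
    (slice (v 1) (v 2) P).eval (v 0) = MvPolynomial.aeval v P := by
  rw [slice, ← coe_evalRingHom, ← coe_aeval_eq_evalRingHom, RingHom.coe_coe,
    ← AlgHom.comp_apply, MvPolynomial.comp_aeval]
  congr 2
  ext i
  fin_cases i <;> simp

lemma derivative_slice (y z : ℝ) (P : MvPolynomial (Fin 3) ℝ) :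
    derivative (slice y z P) = slice y z (MvPolynomial.pderiv 0 P) := by
  induction P using MvPolynomial.induction_on with
  | C a => simp [slice]
  | add p q hp hq => simp only [map_add, hp, hq]
  | mul_X p i hp =>
    have : derivative (slice y z (MvPolynomial.X i)) =
        slice y z (MvPolynomial.pderiv 0 (MvPolynomial.X i)) := by
      fin_cases i <;> simp [slice, MvPolynomial.pderiv_X]
    rw [map_mul, derivative_mul, hp, this, MvPolynomial.pderiv_mul, map_add, map_mul, map_mul]

lemma iterate_derivative_slice (y z : ℝ) (P : MvPolynomial (Fin 3) ℝ) (k : ℕ) :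
    derivative^[k] (slice y z P) = slice y z ((MvPolynomial.pderiv 0)^[k] P) := by
  induction k with
  | zero => rfl
  | succ k ih => rw [Function.iterate_succ_apply', Function.iterate_succ_apply', ih, derivative_slice]

lemma slice_detForm (y z : ℝ) (a : Fin m → ℝ) (S : Matrix (Fin m) (Fin m) ℝ) :
    slice y z (detForm a S) = (y • diagonal a + z • S).charpoly := by
  rw [slice, aeval_detForm, charpoly]
  congr 1
  ext i j : 2
  by_cases h : i = j
  · subst h; simp [sub_sub]
  · simp [h]

lemma prod_X_sub_C_scale (b : Fin m → ℝ) (s : ℝ) :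
    ∏ j, (X - C (s * b j)) = (∏ j, (X - C (b j))).scaleRoots s := by
  have : ∀ T : Finset (Fin m), ∏ j ∈ T, (X - C (s * b j)) = (∏ j ∈ T, (X - C (b j))).scaleRoots s := by
    intro T
    induction T using Finset.induction with
    | empty => simp
    | insert i T hi ih =>
      rw [Finset.prod_insert hi, Finset.prod_insert hi, mul_scaleRoots_of_noZeroDivisors, ih,
        X_sub_C_scaleRoots, mul_comm s]
  exact this _

lemma natDegree_prod_X_sub_C (b : Fin m → ℝ) : (∏ j, (X - C (b j))).natDegree = m := by
  rw [natDegree_prod_of_monic _ _ (fun i _ => monic_X_sub_C _)]; simp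

lemma eval_iterate_derivative_scale (b : Fin m → ℝ) (s : ℝ) {i : ℕ} (hi : i ≤ m) :
    (derivative^[m - i] (∏ j, (X - C (s * b j)))).eval 0 =
      s ^ i * (derivative^[m - i] (∏ j, (X - C (b j)))).eval 0 := by
  rw [prod_X_sub_C_scale, ← coeff_zero_eq_eval_zero, ← coeff_zero_eq_eval_zero,
    coeff_iterate_derivative, coeff_iterate_derivative, coeff_scaleRoots, natDegree_prod_X_sub_C]
  rw [show m - (0 + (m - i)) = i by omega, mul_comm (s ^ i), smul_mul_assoc]

/-- The forms `det (x - y diag(a) - z (1 - t) S) ⊞ det (x - z t diag(b))`. -/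
noncomputable def pathForm (a b : Fin m → ℝ) (S : Matrix (Fin m) (Fin m) ℝ) (t : ℝ) :
    MvPolynomial (Fin 3) ℝ :=
  ∑ i ∈ Finset.range (m + 1),
    MvPolynomial.C ((m.factorial : ℝ)⁻¹ * (derivative^[m - i] (∏ j, (X - C (b j)))).eval 0 * t ^ i) *
      (MvPolynomial.X 2 ^ i * (MvPolynomial.pderiv 0)^[i] (detForm a ((1 - t) • S)))

lemma slice_pathForm (a b : Fin m → ℝ) (S : Matrix (Fin m) (Fin m) ℝ) (t y z : ℝ) :
    slice y z (pathForm a b S t) = boxplus m (y • diagonal a + z • (1 - t) • S).charpoly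
      (∏ j, (X - C (z * t * b j))) := by
  rw [pathForm, boxplus, map_sum, Finset.smul_sum]
  refine Finset.sum_congr rfl fun i hi => ?_
  rw [eval_iterate_derivative_scale b _ (by simpa [Nat.lt_succ_iff] using hi), ← slice_detForm,
    iterate_derivative_slice, map_mul (slice y z) (MvPolynomial.C _), map_mul (slice y z) (_ ^ _),
    smul_eq_C_mul, ← mul_assoc, ← mul_assoc, ← C_mul]
  congr 1
  have h1 : ∀ r, slice y z (MvPolynomial.C r) = C r := fun r => by simp [slice]
  have h2 : slice y z (MvPolynomial.X 2) = C z := by simp [slice]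
  rw [map_pow, h1, h2, ← C_pow, ← C_mul]
  congr 1
  ring

lemma isHomogeneous_iterate_pderiv {P : MvPolynomial (Fin 3) ℝ} (hP : P.IsHomogeneous m) (k : ℕ) :
    ((MvPolynomial.pderiv 0)^[k] P).IsHomogeneous (m - k) := by
  induction k with
  | zero => exact hP
  | succ k ih =>
    rw [Function.iterate_succ_apply', ← Nat.sub_sub]
    exact ih.pderiv

lemma isHomogeneous_pathForm (a b : Fin m → ℝ) (S : Matrix (Fin m) (Fin m) ℝ) (t : ℝ) :
    (pathForm a b S t).IsHomogeneous m := by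
  refine MvPolynomial.IsHomogeneous.sum _ _ _ fun i hi => MvPolynomial.IsHomogeneous.C_mul ?_ _
  have := (MvPolynomial.isHomogeneous_X_pow (R := ℝ) (2 : Fin 3) i).mul
    (isHomogeneous_iterate_pderiv (isHomogeneous_detForm a ((1 - t) • S)) i)
  rwa [Nat.add_sub_cancel' (by simpa [Nat.lt_succ_iff] using hi)] at this

lemma slice_pathForm_of_eq_zero (a b : Fin m → ℝ) (S : Matrix (Fin m) (Fin m) ℝ) (t y z : ℝ)
    (h : z * t = 0) :
    slice y z (pathForm a b S t) = (y • diagonal a + z • (1 - t) • S).charpoly := by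
  have hmon : (∏ j, (X - C (b j)) : ℝ[X]).Monic := monic_prod_of_monic _ _ fun i _ => monic_X_sub_C _
  rw [slice_pathForm, boxplus, Finset.sum_eq_single 0]
  · rw [eval_iterate_derivative_scale b _ (Nat.zero_le m), Nat.sub_zero,
      iterate_derivative_eq_factorial hmon (natDegree_prod_X_sub_C b), smul_eq_C_mul, ← mul_assoc,
      ← C_mul]
    simp [Nat.factorial_ne_zero]
  · intro i hi hi0
    rw [eval_iterate_derivative_scale b _ (by simpa [Nat.lt_succ_iff] using hi), h]
    simp [hi0]
  · simp

lemma form_coeffs_pathForm (a b : Fin m → ℝ) (S : Matrix (Fin m) (Fin m) ℝ) (t : ℝ) :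
    form (coeffs (pathForm a b S t) : Idx m → ℝ) = pathForm a b S t := by
  refine form_coeffs (isHomogeneous_pathForm a b S t) ?_
  rw [coeff_single_eq_eval (isHomogeneous_pathForm a b S t), ← MvPolynomial.coe_aeval_eq_eval]
  change MvPolynomial.aeval _ _ = _
  rw [← eval_slice]
  simp only [cons_val_zero, cons_val_one, cons_val]
  rw [slice_pathForm_of_eq_zero a b S t 0 0 (zero_mul t)]
  simp [charpoly_zero]

lemma contDiff_coeffs_pathForm (a b : Fin m → ℝ) (S : Matrix (Fin m) (Fin m) ℝ) :
    ContDiff ℝ 1 fun t => (coeffs (pathForm a b S t) : Idx m → ℝ) := by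
  rw [contDiff_pi]
  intro p
  refine SmoothFamily.sum _ (fun i _ => SmoothFamily.mul (smoothFamily_C ?_)
    ((smoothFamily_const _).mul (SmoothFamily.iterate_pderiv ?_ 0 i))) (expo p)
  · fun_prop
  · refine smoothFamily_detForm (fun _ => contDiff_const) fun i j => ?_
    exact (contDiff_const.sub contDiff_id).mul contDiff_const

lemma eval_derivative_ne_zero_of_prod {b : Fin m → ℝ} (hb : Function.Injective b) (x : ℝ) :
    ¬ ((∏ j, (X - C (b j))).eval x = 0 ∧ (derivative (∏ j, (X - C (b j)))).eval x = 0) := by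
  rintro ⟨h0, h1⟩
  obtain ⟨p, q, h⟩ : IsCoprime _ _ := separable_prod_X_sub_C_iff.mpr hb
  have := congrArg (eval x) h
  simp [h0, h1] at this

/-- A real symmetric matrix with one-dimensional eigenspaces has simple eigenvalues. -/
lemma Nonderogatory.charpoly_simple {M : Matrix (Fin m) (Fin m) ℝ} (hM : Mᵀ = M)
    (h : Nonderogatory M) (x : ℝ) :
    ¬ (M.charpoly.eval x = 0 ∧ (derivative M.charpoly).eval x = 0) := by
  have hS : M.IsHermitian := by
    rw [IsHermitian, conjTranspose_eq_transpose_of_trivial, hM]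
  have hinj : Function.Injective hS.eigenvalues := by
    intro i j hij
    by_contra hne
    have h0 : hS.eigenvectorBasis i ≠ 0 := hS.eigenvectorBasis.orthonormal.ne_zero i
    obtain ⟨k, hk⟩ := h (hS.eigenvalues i) (hS.eigenvectorBasis i) (hS.eigenvectorBasis j)
      (fun h => h0 (by ext l; exact congrFun h l)) (hS.mulVec_eigenvectorBasis i)
      (by rw [hij]; exact hS.mulVec_eigenvectorBasis j)
    have hk' : hS.eigenvectorBasis j = k • hS.eigenvectorBasis i := by
      ext l; exact congrFun hk l
    have h1 : inner ℝ (hS.eigenvectorBasis i) (hS.eigenvectorBasis j) = 0 :=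
      hS.eigenvectorBasis.orthonormal.2 hne
    rw [hk', inner_smul_right, real_inner_self_eq_norm_sq, hS.eigenvectorBasis.orthonormal.1 i] at h1
    have h2 := hS.eigenvectorBasis.orthonormal.1 j
    rw [hk', norm_smul, hS.eigenvectorBasis.orthonormal.1 i] at h2
    simp at h1
    simp [h1] at h2
  have := eval_derivative_ne_zero_of_prod hinj x
  rwa [hS.charpoly_eq]

section Jacobi

variable {K : Type*} [Field K]

/-- The Jacobi matrix with ones next to the diagonal. -/
def jacobi (m : ℕ) (K : Type*) [Field K] : Matrix (Fin m) (Fin m) K :=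
  Matrix.of fun i j => if (i : ℕ) + 1 = j ∨ (j : ℕ) + 1 = i then 1 else 0

lemma jacobi_transpose : (jacobi m K)ᵀ = jacobi m K := by
  ext i j
  simp only [jacobi, transpose_apply, Matrix.of_apply, or_comm]

lemma eq_zero_of_jacobi {a : Fin m → K} {y z μ : K} (hz : z ≠ 0) {u : Fin m → K}
    (hu : (y • diagonal a + z • jacobi m K) *ᵥ u = μ • u) (h0 : ∀ i : Fin m, (i : ℕ) = 0 → u i = 0) :
    u = 0 := by
  have key : ∀ n : ℕ, ∀ i : Fin m, (i : ℕ) ≤ n → u i = 0 := by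
    intro n
    induction n with
    | zero => exact fun i hi => h0 i (Nat.le_zero.mp hi)
    | succ n ih =>
      intro i hi
      rcases hi.lt_or_eq with h | h
      · exact ih i (Nat.lt_succ_iff.mp h)
      · have hn : n < m := by have := i.2; omega
        have hrow := congrFun hu ⟨n, hn⟩
        have hun : u ⟨n, hn⟩ = 0 := ih _ le_rfl
        rw [add_mulVec, smul_mulVec, smul_mulVec] at hrow
        simp only [Pi.add_apply, Pi.smul_apply, smul_eq_mul, mulVec_diagonal, hun, mul_zero,
          zero_add, mul_eq_zero, hz, false_or] at hrow
        rw [mulVec, dotProduct, Finset.sum_eq_single i] at hrow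
        · simpa [jacobi, h] using hrow
        · intro j _ hj
          have hji : (j : ℕ) ≠ n + 1 := fun hj' => hj (Fin.ext (hj'.trans h.symm))
          by_cases hjn : (j : ℕ) ≤ n
          · rw [ih j hjn, mul_zero]
          · simp only [jacobi, Matrix.of_apply]
            rw [if_neg, zero_mul]
            omega
        · simp
  ext i
  exact key i i le_rfl

lemma nonderogatory_jacobi (a : Fin m → K) (y : K) {z : K} (hz : z ≠ 0) :
    Nonderogatory (y • diagonal a + z • jacobi m K) := by
  intro μ u w hu0 hu hw
  rcases Nat.eq_zero_or_pos m with rfl | hm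
  · exact absurd (Subsingleton.elim _ _) hu0
  · have hu0' : u ⟨0, hm⟩ ≠ 0 := fun h => hu0 (eq_zero_of_jacobi hz hu fun i hi => by
      rw [← h]; congr 1; exact Fin.ext hi)
    refine ⟨w ⟨0, hm⟩ / u ⟨0, hm⟩, sub_eq_zero.mp (eq_zero_of_jacobi (a := a) (y := y) (μ := μ) hz ?_ ?_)⟩
    · rw [mulVec_sub, mulVec_smul, hu, hw, smul_sub, smul_comm]
    · intro i hi
      obtain rfl : i = ⟨0, hm⟩ := Fin.ext hi
      simp [hu0']

lemma nonderogatory_diagonal {a : Fin m → K} (ha : Function.Injective a) :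
    Nonderogatory (diagonal a) := by
  intro μ u w hu0 hu hw
  obtain ⟨i, hi⟩ := Function.ne_iff.mp hu0
  have key : ∀ {u : Fin m → K}, diagonal a *ᵥ u = μ • u → ∀ j, (a j - μ) * u j = 0 := by
    intro u hu j
    have := congrFun hu j
    rw [mulVec_diagonal, Pi.smul_apply, smul_eq_mul] at this
    rw [sub_mul, this, sub_self]
  have hμ : a i = μ := sub_eq_zero.mp ((mul_eq_zero.mp (key hu i)).resolve_right hi)
  refine ⟨w i / u i, ?_⟩
  ext j
  by_cases hj : j = i
  · subst hj
    simp only [Pi.smul_apply, smul_eq_mul]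
    rw [div_mul_cancel₀ _ hi]
  · have hne : a j - μ ≠ 0 := fun h => hj (ha ((sub_eq_zero.mp h).trans hμ.symm))
    have h1 := (mul_eq_zero.mp (key hu j)).resolve_left hne
    have h2 := (mul_eq_zero.mp (key hw j)).resolve_left hne
    simp [h1, h2]

end Jacobi

lemma charpoly_monic_splits {M : Matrix (Fin m) (Fin m) ℝ} (hM : Mᵀ = M) :
    M.charpoly.Monic ∧ M.charpoly.Splits ∧ M.charpoly.natDegree = m := by
  have hS : M.IsHermitian := by
    rw [IsHermitian, conjTranspose_eq_transpose_of_trivial, hM]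
  refine ⟨charpoly_monic M, ?_, by simp⟩
  rw [hS.charpoly_eq]
  exact Splits.prod fun i _ => Splits.X_sub_C _

/-- All forms along the path have simple real slices. -/
lemma realSimple_path {a b : Fin m → ℝ} (ha : Function.Injective a) (hb : Function.Injective b)
    (t : ℝ) : RealSimple (coeffs (pathForm a b (jacobi m ℝ) t) : Idx m → ℝ) := by
  intro v hv
  rw [form_coeffs_pathForm, ← eval_slice, ← eval_slice, ← derivative_slice]
  by_cases h : v 2 * t = 0
  · rw [slice_pathForm_of_eq_zero _ _ _ _ _ _ h]
    by_cases h2 : v 2 = 0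
    · by_cases h1 : v 1 = 0
      · have h0 : v 0 ≠ 0 := fun h0 => hv (by ext i; fin_cases i <;> assumption)
        simp [h1, h2, charpoly_zero, h0]
      · refine Nonderogatory.charpoly_simple ?_ ?_ _
        · simp [h2]
        · rw [h2, zero_smul, add_zero, ← diagonal_smul]
          exact nonderogatory_diagonal fun i j hij => ha (mul_left_cancel₀ h1 hij)
    · have ht : t = 0 := (mul_eq_zero.mp h).resolve_left h2
      rw [ht, sub_zero, one_smul]
      refine Nonderogatory.charpoly_simple ?_ (nonderogatory_jacobi a (v 1) h2) _
      simp [jacobi_transpose]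
  · rw [slice_pathForm]
    obtain ⟨h1, h2, h3⟩ := charpoly_monic_splits
      (M := v 1 • diagonal a + v 2 • (1 - t) • jacobi m ℝ) (by simp [jacobi_transpose])
    exact boxplus_simple_roots h1 h2 h3 (fun i j hij => hb (mul_left_cancel₀ h hij)) _

end Path

section Perturbation
open Filter Topology

variable {m : ℕ}

lemma coeffs_form (e : Idx m → ℝ) : coeffs (form e) = e := by
  classical
  ext p
  simp only [form, coeffs, MvPolynomial.coeff_add, MvPolynomial.coeff_sum,
    MvPolynomial.coeff_monomial, MvPolynomial.coeff_X_pow]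
  rw [if_neg fun h => expo_ne_single p h.symm, zero_add, Finset.sum_eq_single p]
  · simp
  · intro q _ hq
    exact if_neg fun h => hq (expo_injective h)
  · simp

lemma coeff_form_single (e : Idx m → ℝ) : (form e).coeff (Finsupp.single 0 m) = 1 := by
  classical
  simp only [form, MvPolynomial.coeff_add, MvPolynomial.coeff_sum,
    MvPolynomial.coeff_monomial, MvPolynomial.coeff_X_pow]
  rw [if_pos trivial, Finset.sum_eq_zero fun p _ => if_neg (expo_ne_single p), add_zero]

lemma form_add_coeffs (e : Idx m → ℝ) {D : MvPolynomial (Fin 3) ℝ} (hD : D.IsHomogeneous m)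
    (h0 : MvPolynomial.eval ![1, 0, 0] D = 0) : form (e + coeffs D) = form e + D := by
  have h : (coeffs (form e + D) : Idx m → ℝ) = e + coeffs D := by
    conv_rhs => rw [← coeffs_form e]
    ext p
    simp [coeffs]
  rw [← h, form_coeffs ((isHomogeneous_form e).add hD)]
  rw [MvPolynomial.coeff_add, coeff_form_single, coeff_single_eq_eval hD, h0, add_zero]

/-- A six-parameter family of forms, `q(z) + x r(z)` at `y = 1` with `deg q ≤ 3`, `deg r ≤ 1`. -/
noncomputable def perturb (m : ℕ) (w : Fin 6 → ℝ) : MvPolynomial (Fin 3) ℝ :=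
  MvPolynomial.C (w 0) * MvPolynomial.X 1 ^ m +
    MvPolynomial.C (w 1) * (MvPolynomial.X 2 ^ 1 * MvPolynomial.X 1 ^ (m - 1)) +
    MvPolynomial.C (w 2) * (MvPolynomial.X 2 ^ 2 * MvPolynomial.X 1 ^ (m - 2)) +
    MvPolynomial.C (w 3) * (MvPolynomial.X 2 ^ 3 * MvPolynomial.X 1 ^ (m - 3)) +
    MvPolynomial.C (w 4) * (MvPolynomial.X 0 ^ 1 * MvPolynomial.X 1 ^ (m - 1)) +
    MvPolynomial.C (w 5) * (MvPolynomial.X 0 ^ 1 * MvPolynomial.X 2 ^ 1 * MvPolynomial.X 1 ^ (m - 2))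

lemma isHomogeneous_perturb (hm : 3 ≤ m) (w : Fin 6 → ℝ) : (perturb m w).IsHomogeneous m := by
  have hX : ∀ (i : Fin 3) (k : ℕ), (MvPolynomial.X i ^ k : MvPolynomial (Fin 3) ℝ).IsHomogeneous k :=
    fun i k => MvPolynomial.isHomogeneous_X_pow i k
  have h2 : ∀ (i j : Fin 3) (k : ℕ), k ≤ m →
      (MvPolynomial.X i ^ k * MvPolynomial.X j ^ (m - k) : MvPolynomial (Fin 3) ℝ).IsHomogeneous m :=
    fun i j k hk => by
      have := (hX i k).mul (hX j (m - k))
      rwa [Nat.add_sub_cancel' hk] at this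
  have h3 := ((hX 0 1).mul (hX 2 1)).mul (hX 1 (m - 2))
  rw [show 1 + 1 + (m - 2) = m by omega] at h3
  exact ((((((hX 1 m).C_mul _).add ((h2 2 1 1 (by omega)).C_mul _)).add
    ((h2 2 1 2 (by omega)).C_mul _)).add ((h2 2 1 3 (by omega)).C_mul _)).add
    ((h2 0 1 1 (by omega)).C_mul _)).add (h3.C_mul _)

lemma form_add_perturb (hm : 3 ≤ m) (e : Idx m → ℝ) (w : Fin 6 → ℝ) :
    form (e + coeffs (perturb m w)) = form e + perturb m w := by
  refine form_add_coeffs e (isHomogeneous_perturb hm w) ?_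
  have h0 : m ≠ 0 := by omega
  have h1 : m - 1 ≠ 0 := by omega
  simp [perturb, h0, h1]

lemma continuous_coeffs_perturb : Continuous fun w => (coeffs (perturb m w) : Idx m → ℝ) := by
  refine continuous_pi fun p => ?_
  simp only [coeffs, perturb, MvPolynomial.coeff_add, MvPolynomial.coeff_C_mul]
  fun_prop

lemma coeffs_perturb_zero : (coeffs (perturb m 0) : Idx m → ℝ) = 0 := by
  ext p
  simp [coeffs, perturb]

lemma aeval_perturb (w : Fin 6 → ℝ) (x z : ℂ) : MvPolynomial.aeval ![x, 1, z] (perturb m w) =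
    w 0 + w 1 * z + w 2 * z ^ 2 + w 3 * z ^ 3 + w 4 * x + w 5 * (x * z) := by
  simp [perturb]

lemma aeval_pderiv_zero_perturb (w : Fin 6 → ℝ) (x z : ℂ) :
    MvPolynomial.aeval ![x, 1, z] (MvPolynomial.pderiv 0 (perturb m w)) = w 4 + w 5 * z := by
  simp [perturb, MvPolynomial.pderiv_X]

lemma aeval_pderiv_two_perturb (w : Fin 6 → ℝ) (x z : ℂ) :
    MvPolynomial.aeval ![x, 1, z] (MvPolynomial.pderiv 2 (perturb m w)) =
      w 1 + 2 * w 2 * z + 3 * w 3 * z ^ 2 + w 5 * x := by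
  simp [perturb, MvPolynomial.pderiv_X]
  ring

lemma contDiff_aeval_point (P : MvPolynomial (Fin 3) ℝ) :
    ContDiff ℝ 1 fun s : ℝ × ℂ × ℂ => MvPolynomial.aeval ![s.2.1, 1, s.2.2] P := by
  induction P using MvPolynomial.induction_on with
  | C a => simpa using contDiff_const
  | add p q hp hq => simpa only [map_add] using hp.add hq
  | mul_X p i hp =>
    simp only [map_mul, MvPolynomial.aeval_X]
    refine hp.mul ?_
    fin_cases i
    · simp; fun_prop
    · simp; fun_prop
    · simp; fun_prop

lemma aeval_pderiv_form {R : Type*} [CommRing R] [Algebra ℝ R] (L : Module.End ℝ (MvPolynomial (Fin 3) ℝ))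
    (e : Idx m → ℝ) (v : Fin 3 → R) : MvPolynomial.aeval v (L (form e)) =
    MvPolynomial.aeval v (L (MvPolynomial.X 0 ^ m)) +
      ∑ p, e p • MvPolynomial.aeval v (L (MvPolynomial.monomial (expo p) 1)) := by
  have h : ∀ p, MvPolynomial.monomial (expo p) (e p) = e p • MvPolynomial.monomial (expo p) (1 : ℝ) :=
    fun p => by rw [MvPolynomial.smul_monomial, smul_eq_mul, mul_one]
  simp only [form, h, map_add, map_sum, map_smul]

lemma contDiff_aeval_form {e : ℝ → Idx m → ℝ} (he : ContDiff ℝ 1 e)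
    (L : Module.End ℝ (MvPolynomial (Fin 3) ℝ)) :
    ContDiff ℝ 1 fun s : ℝ × ℂ × ℂ => MvPolynomial.aeval ![s.2.1, 1, s.2.2] (L (form (e s.1))) := by
  simp only [aeval_pderiv_form]
  refine (contDiff_aeval_point _).add (ContDiff.sum fun p _ => ContDiff.fun_smul ?_ (contDiff_aeval_point _))
  exact (contDiff_pi.mp he p).comp contDiff_fst

lemma aeval_conj (v : Fin 3 → ℂ) (P : MvPolynomial (Fin 3) ℝ) :
    MvPolynomial.aeval (fun i => (starRingEnd ℂ) (v i)) P =
      (starRingEnd ℂ) (MvPolynomial.aeval v P) := by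
  have := MvPolynomial.comp_aeval_apply (f := v) (Complex.conjAe : ℂ →ₐ[ℝ] ℂ) P
  exact this.symm

/-- The parameters for which the perturbed form is singular at a given nonreal point, in terms of
the values `κ`, `ρ`, `ν` at this point of the unperturbed form and its partial derivatives. -/
noncomputable def hermite (x z κ ρ ν : ℂ) : Fin 6 → ℝ :=
  let w5 := -ρ.im / z.im
  let w4 := -ρ.re - z.re * w5
  let k : ℂ := x * ρ - κ
  let n : ℂ := -ν - w5 * x
  let w3 := (k.im / z.im - n.re) / (2 * (z.im * z.im))
  let w2 := n.im / (2 * z.im) - 3 * z.re * w3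
  let w1 := n.re - 2 * z.re * w2 - 3 * w3 * (z.re * z.re - z.im * z.im)
  let w0 := k.re - w1 * z.re - w2 * (z.re * z.re - z.im * z.im) -
    w3 * (z.re * z.re * z.re - 3 * z.re * (z.im * z.im))
  ![w0, w1, w2, w3, w4, w5]

lemma eq_hermite {w : Fin 6 → ℝ} {x z κ ρ ν : ℂ} (hz : z.im ≠ 0)
    (h0 : κ + (w 0 + w 1 * z + w 2 * z ^ 2 + w 3 * z ^ 3 + w 4 * x + w 5 * (x * z)) = 0)
    (h1 : ρ + (w 4 + w 5 * z) = 0)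
    (h2 : ν + (w 1 + 2 * w 2 * z + 3 * w 3 * z ^ 2 + w 5 * x) = 0) :
    w = hermite x z κ ρ ν := by
  have hk : x * ρ - κ = w 0 + w 1 * z + w 2 * z ^ 2 + w 3 * z ^ 3 := by
    linear_combination x * h1 - h0
  have hn : -ν - w 5 * x = w 1 + 2 * w 2 * z + 3 * w 3 * z ^ 2 := by linear_combination -h2
  have e5 : w 5 = -ρ.im / z.im := by
    have := congrArg Complex.im h1
    simp at this
    field_simp
    linarith
  have e4 : w 4 = -ρ.re - z.re * w 5 := by
    have := congrArg Complex.re h1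
    simp at this
    linarith
  have kr : (x * ρ - κ).re = w 0 + w 1 * z.re + w 2 * (z.re * z.re - z.im * z.im) +
      w 3 * (z.re * z.re * z.re - 3 * z.re * (z.im * z.im)) := by
    rw [hk]; simp [pow_succ, -mul_eq_mul_left_iff]; ring
  have ki : (x * ρ - κ).im = z.im * (w 1 + 2 * z.re * w 2 +
      w 3 * (3 * z.re * z.re - z.im * z.im)) := by
    rw [hk]; simp [pow_succ, -mul_eq_mul_left_iff]; ring
  have nr : (-ν - w 5 * x).re = w 1 + 2 * z.re * w 2 + 3 * w 3 * (z.re * z.re - z.im * z.im) := by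
    rw [hn]; simp [pow_succ]; ring
  have ni : (-ν - w 5 * x).im = z.im * (2 * w 2 + 6 * z.re * w 3) := by
    rw [hn]; simp [pow_succ]; ring
  have e3 : w 3 = ((x * ρ - κ).im / z.im - (-ν - w 5 * x).re) / (2 * (z.im * z.im)) := by
    rw [ki, nr]; field_simp; ring
  have e2 : w 2 = (-ν - w 5 * x).im / (2 * z.im) - 3 * z.re * w 3 := by
    rw [ni]; field_simp; ring
  have e1 : w 1 = (-ν - w 5 * x).re - 2 * z.re * w 2 - 3 * w 3 * (z.re * z.re - z.im * z.im) := by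
    rw [nr]; ring
  have e0 : w 0 = (x * ρ - κ).re - w 1 * z.re - w 2 * (z.re * z.re - z.im * z.im) -
      w 3 * (z.re * z.re * z.re - 3 * z.re * (z.im * z.im)) := by
    rw [kr]; ring
  simp only [hermite]
  rw [← e5, ← e4, ← e3, ← e2, ← e1, ← e0]
  ext i
  fin_cases i <;> rfl

lemma contDiffOn_hermite {s : Set (ℝ × ℂ × ℂ)} {x z κ ρ ν : ℝ × ℂ × ℂ → ℂ} (hs : ∀ p ∈ s, (z p).im ≠ 0)
    (hx : ContDiff ℝ 1 x) (hz : ContDiff ℝ 1 z) (hκ : ContDiff ℝ 1 κ) (hρ : ContDiff ℝ 1 ρ)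
    (hν : ContDiff ℝ 1 ν) : ContDiffOn ℝ 1 (fun p => hermite (x p) (z p) (κ p) (ρ p) (ν p)) s := by
  have hre : ∀ {f : ℝ × ℂ × ℂ → ℂ}, ContDiffOn ℝ 1 f s → ContDiffOn ℝ 1 (fun p => (f p).re) s :=
    fun hf => Complex.reCLM.contDiff.comp_contDiffOn hf
  have him : ∀ {f : ℝ × ℂ × ℂ → ℂ}, ContDiffOn ℝ 1 f s → ContDiffOn ℝ 1 (fun p => (f p).im) s :=
    fun hf => Complex.imCLM.contDiff.comp_contDiffOn hf
  have hof : ∀ {f : ℝ × ℂ × ℂ → ℝ}, ContDiffOn ℝ 1 f s → ContDiffOn ℝ 1 (fun p => (f p : ℂ)) s :=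
    fun hf => Complex.ofRealCLM.contDiff.comp_contDiffOn hf
  have zr := hre hz.contDiffOn
  have zi := him hz.contDiffOn
  have w5 := (him hρ.contDiffOn).neg.div zi hs
  have w4 := (hre hρ.contDiffOn).neg.sub (zr.mul w5)
  have k := (hx.mul hρ).contDiffOn (s := s).sub hκ.contDiffOn
  have n := hν.contDiffOn (s := s).neg.sub ((hof w5).mul hx.contDiffOn)
  have w3 := (((him k).div zi hs).sub (hre n)).div (contDiffOn_const (c := (2 : ℝ)).mul (zi.mul zi))
    fun p hp => mul_ne_zero two_ne_zero (mul_ne_zero (hs p hp) (hs p hp))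
  have w2 := ((him n).div (contDiffOn_const (c := (2 : ℝ)).mul zi)
    fun p hp => mul_ne_zero two_ne_zero (hs p hp)).sub
      ((contDiffOn_const (c := (3 : ℝ)).mul zr).mul w3)
  have d := (zr.mul zr).sub (zi.mul zi)
  have w1 := ((hre n).sub ((contDiffOn_const (c := (2 : ℝ)).mul zr).mul w2)).sub
    ((contDiffOn_const (c := (3 : ℝ)).mul w3).mul d)
  have w0 := (((hre k).sub (w1.mul zr)).sub (w2.mul d)).sub
    (w3.mul (((zr.mul zr).mul zr).sub ((contDiffOn_const (c := (3 : ℝ)).mul zr).mul (zi.mul zi))))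
  rw [contDiffOn_pi]
  intro i
  fin_cases i
  · exact w0
  · exact w1
  · exact w2
  · exact w3
  · exact w4
  · exact w5

lemma dense_nonrealSmooth (hm : 3 ≤ m) {e : ℝ → Idx m → ℝ} (he : ContDiff ℝ 1 e) :
    Dense {w : Fin 6 → ℝ | ∀ t, NonrealSmooth (e t + coeffs (perturb m w))} := by
  set Ψ : ℝ × ℂ × ℂ → Fin 6 → ℝ := fun s => hermite s.2.1 s.2.2
    (MvPolynomial.aeval ![s.2.1, 1, s.2.2] (form (e s.1)))
    (MvPolynomial.aeval ![s.2.1, 1, s.2.2] (MvPolynomial.pderiv 0 (form (e s.1))))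
    (MvPolynomial.aeval ![s.2.1, 1, s.2.2] (MvPolynomial.pderiv 2 (form (e s.1)))) with hΨ
  have hΨd : ContDiffOn ℝ 1 Ψ {s | 0 < s.2.2.im} := by
    refine contDiffOn_hermite (fun p hp => ne_of_gt hp) (by fun_prop) (by fun_prop)
      (contDiff_aeval_form he LinearMap.id)
      (contDiff_aeval_form he (MvPolynomial.pderiv 0).toLinearMap)
      (contDiff_aeval_form he (MvPolynomial.pderiv 2).toLinearMap)
  have hconv : Convex ℝ {s : ℝ × ℂ × ℂ | 0 < s.2.2.im} :=
    convex_halfSpace_gt (f := fun s : ℝ × ℂ × ℂ => s.2.2.im)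
      ⟨fun _ _ => by simp, fun _ _ => by simp⟩ 0
  have hdense := hΨd.dense_compl_image_of_dimH_lt_finrank hconv subset_rfl (by
    refine (dimH_mono (Set.subset_univ _)).trans_lt ?_
    rw [Real.dimH_univ_eq_finrank]
    norm_num)
  refine hdense.mono fun w hw t x z hz => ?_
  rintro ⟨h0, h1, h2⟩
  refine hw ?_
  wlog hpos : 0 < z.im generalizing x z
  · have hv : (![(starRingEnd ℂ) x, 1, (starRingEnd ℂ) z] : Fin 3 → ℂ) =
        fun i => (starRingEnd ℂ) (![x, 1, z] i) := by
      ext i; fin_cases i <;> simp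
    refine this (starRingEnd ℂ x) (starRingEnd ℂ z) (by simpa using hz) ?_ ?_ ?_ ?_
    · rw [hv, aeval_conj, h0, map_zero]
    · rw [hv, aeval_conj, h1, map_zero]
    · rw [hv, aeval_conj, h2, map_zero]
    · rw [Complex.conj_im]
      exact neg_pos.mpr (lt_of_le_of_ne (not_lt.mp hpos) hz)
  refine ⟨(t, x, z), hpos, ?_⟩
  rw [form_add_perturb hm, map_add] at h0
  rw [form_add_perturb hm, map_add, map_add] at h1 h2
  rw [aeval_perturb] at h0
  rw [aeval_pderiv_zero_perturb] at h1
  rw [aeval_pderiv_two_perturb] at h2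
  exact (eq_hermite hz h0 h1 h2).symm

end Perturbation

section Continuation
open Filter Topology

variable {m : ℕ}

lemma continuous_aeval_form (L : Module.End ℝ (MvPolynomial (Fin 3) ℝ)) :
    Continuous fun s : (Idx m → ℝ) × (Fin 3 → ℝ) => MvPolynomial.aeval s.2 (L (form s.1)) := by
  simp only [aeval_pderiv_form]
  have h : ∀ P : MvPolynomial (Fin 3) ℝ,
      Continuous fun s : (Idx m → ℝ) × (Fin 3 → ℝ) => MvPolynomial.aeval s.2 P := fun P => by
    exact (MvPolynomial.continuous_eval P).comp continuous_snd
  exact (h _).add (continuous_finsetSum _ fun p _ => Continuous.fun_smul (by fun_prop) (h _))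

lemma aeval_smul_of_isHomogeneous {P : MvPolynomial (Fin 3) ℝ} {n : ℕ} (hP : P.IsHomogeneous n)
    (r : ℝ) (v : Fin 3 → ℝ) :
    MvPolynomial.aeval (r • v) P = r ^ n * MvPolynomial.aeval v P := by
  rw [MvPolynomial.aeval_def, MvPolynomial.aeval_def, MvPolynomial.eval₂_eq', MvPolynomial.eval₂_eq',
    Finset.mul_sum]
  refine Finset.sum_congr rfl fun d hd => ?_
  have hdeg : d.degree = n := by
    by_contra h
    exact MvPolynomial.mem_support_iff.mp hd (hP.coeff_eq_zero h)
  rw [← hdeg, degree_fin_three, Fin.prod_univ_three, Fin.prod_univ_three]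
  simp only [Pi.smul_apply, smul_eq_mul]
  ring

/-- Simplicity of all real slices is stable under small perturbations, uniformly along a path. -/
lemma eventually_realSimple {e : ℝ → Idx m → ℝ} (he : Continuous e) (h : ∀ t, RealSimple (e t)) :
    ∀ᶠ δ in 𝓝 (0 : Idx m → ℝ), ∀ t ∈ Set.Icc (0 : ℝ) 1, RealSimple (e t + δ) := by
  have hK : IsCompact (Set.Icc (0 : ℝ) 1 ×ˢ Metric.sphere (0 : Fin 3 → ℝ) 1) :=
    isCompact_Icc.prod (isCompact_sphere _ _)
  have key := hK.eventually_forall_of_forall_eventually (x₀ := (0 : Idx m → ℝ))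
    (P := fun δ y => ¬ (MvPolynomial.aeval y.2 (form (e y.1 + δ)) = 0 ∧
      MvPolynomial.aeval y.2 (MvPolynomial.pderiv 0 (form (e y.1 + δ))) = 0)) ?_
  · filter_upwards [key] with δ hδ t ht v hv hzero
    have hv0 : ‖v‖ ≠ 0 := norm_ne_zero_iff.mpr hv
    refine hδ (t, ‖v‖⁻¹ • v) ⟨ht, ?_⟩ ⟨?_, ?_⟩
    · simp [norm_smul, hv0]
    · rw [aeval_smul_of_isHomogeneous (isHomogeneous_form _), hzero.1, mul_zero]
    · rw [aeval_smul_of_isHomogeneous (isHomogeneous_form _).pderiv, hzero.2, mul_zero]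
  · rintro ⟨t, v⟩ ⟨-, hv⟩
    have hv0 : v ≠ 0 := by
      rintro rfl
      simp at hv
    have hc : ∀ L : Module.End ℝ (MvPolynomial (Fin 3) ℝ),
        Continuous fun s : (Idx m → ℝ) × ℝ × (Fin 3 → ℝ) =>
          MvPolynomial.aeval s.2.2 (L (form (e s.2.1 + s.1))) := fun L =>
      (continuous_aeval_form L).comp (f := fun s : (Idx m → ℝ) × ℝ × (Fin 3 → ℝ) =>
        (e s.2.1 + s.1, s.2.2)) (by fun_prop)
    have h' := h t v hv0
    rw [not_and_or] at h'
    rcases h' with h' | h'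
    · filter_upwards [(hc LinearMap.id).continuousAt.eventually_ne (y := 0)
        (by simpa using h')] with s hs hs'
      exact hs hs'.1
    · filter_upwards [(hc (MvPolynomial.pderiv 0).toLinearMap).continuousAt.eventually_ne (y := 0)
        (by simpa using h')] with s hs hs'
      exact hs hs'.2

lemma mem_range_of_path {e : ℝ → Idx m → ℝ} (he : Continuous e)
    (h0 : e 0 ∈ Set.range (detMap (m := m))) (hR : ∀ t ∈ Set.Icc (0 : ℝ) 1, RealSimple (e t))
    (hC : 3 ≤ m → ∀ t, NonrealSmooth (e t)) : e 1 ∈ Set.range (detMap (m := m)) := by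
  have hcl : IsClosed (e ⁻¹' Set.range (detMap (m := m))) := isClosed_range_detMap.preimage he
  refine (hcl.inter isClosed_Icc).Icc_subset_of_forall_mem_nhdsWithin h0 ?_
    (Set.right_mem_Icc.mpr zero_le_one)
  rintro t ⟨⟨c, hc⟩, ht⟩
  refine mem_nhdsWithin_of_mem_nhds (he.continuousAt ?_)
  have hR' := hR t (Set.Ico_subset_Icc_self ht)
  rw [← hc] at hR' ⊢
  exact range_detMap_mem_nhds (paramDiag_injective hR')
    (nonderogatory_pencil hR' fun hm => hc ▸ hC hm t) (nonderogatory_paramSymm hR')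

lemma pathForm_zero (a b : Fin m → ℝ) (S : Matrix (Fin m) (Fin m) ℝ) :
    pathForm a b S 0 = detForm a S := by
  have hmon : (∏ j, (X - C (b j)) : ℝ[X]).Monic := monic_prod_of_monic _ _ fun i _ => monic_X_sub_C _
  rw [pathForm, Finset.sum_eq_single 0]
  · simp [iterate_derivative_eq_factorial hmon (natDegree_prod_X_sub_C b), Nat.factorial_ne_zero]
  · intro i _ hi
    simp [hi]
  · simp

lemma map_jacobi : (jacobi m ℝ).map (algebraMap ℝ ℂ) = jacobi m ℂ := by
  ext i j
  simp only [jacobi, map_apply, Matrix.of_apply]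
  split_ifs <;> simp

/-- The finite free convolution of two simple spectra is realised by a determinantal form. -/
lemma path_one_mem_range {a b : Fin m → ℝ} (ha : Function.Injective a) (hb : Function.Injective b) :
    coeffs (pathForm a b (jacobi m ℝ) 1) ∈ Set.range (detMap (m := m)) := by
  set e : ℝ → Idx m → ℝ := fun t => coeffs (pathForm a b (jacobi m ℝ) t) with he_def
  have hes : ContDiff ℝ 1 e := contDiff_coeffs_pathForm a b _
  have hR : ∀ t, RealSimple (e t) := realSimple_path ha hb
  have h0 : Set.range (detMap (m := m)) ∈ 𝓝 (e 0) := by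
    obtain ⟨c, hca, hcS⟩ := exists_param a (jacobi m ℝ) jacobi_transpose
    have hc : detMap c = e 0 := by
      rw [he_def]
      simp only
      rw [pathForm_zero, detMap, hca, hcS]
    have hdiag : (diagonal a).map (algebraMap ℝ ℂ) = diagonal fun i => (a i : ℂ) := by
      rw [diagonal_map (map_zero _)]; rfl
    rw [← hc]
    refine range_detMap_mem_nhds (hca ▸ ha) (fun z => ?_) ?_
    · rw [hca, hcS, map_jacobi, hdiag]
      by_cases hz : z = 0
      · rw [hz, zero_smul, add_zero]
        exact nonderogatory_diagonal fun i j h => ha (Complex.ofReal_injective h)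
      · simpa using nonderogatory_jacobi (fun i => (a i : ℂ)) 1 hz
    · rw [hcS, map_jacobi]
      simpa using nonderogatory_jacobi (fun i => (a i : ℂ)) 0 one_ne_zero
  rcases Nat.lt_or_ge m 3 with hm | hm
  · exact mem_range_of_path hes.continuous (mem_of_mem_nhds h0) (fun t _ => hR t) fun h => by omega
  · have hι : Tendsto (fun w => (coeffs (perturb m w) : Idx m → ℝ)) (𝓝 0) (𝓝 0) := by
      simpa only [coeffs_perturb_zero] using (continuous_coeffs_perturb (m := m)).tendsto 0
    have hadd : ∀ t, Tendsto (fun w => e t + coeffs (perturb m w)) (𝓝 0) (𝓝 (e t)) := fun t => by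
      simpa using hι.const_add (e t)
    refine isClosed_range_detMap.mem_of_frequently_of_tendsto ?_ (hadd 1)
    have hgood := mem_closure_iff_frequently.mp (dense_nonrealSmooth hm hes 0)
    refine (hgood.and_eventually ((hι.eventually (eventually_realSimple hes.continuous hR)).and
      ((hadd 0).eventually h0))).mono ?_
    rintro w ⟨hw, hwR, hw0⟩
    exact mem_range_of_path (e := fun t => e t + coeffs (perturb m w))
      (hes.continuous.add continuous_const) hw0 hwR fun _ => hw

end Continuation

section Distinct
open Filter Topology

variable {m : ℕ}

lemma boxplus_X_pow {q : ℝ[X]} (hq : q.natDegree ≤ m) : boxplus m (X ^ m) q = q := by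
  have hm : (m.factorial : ℝ) ≠ 0 := Nat.cast_ne_zero.mpr m.factorial_ne_zero
  conv_rhs => rw [as_sum_range_C_mul_X_pow' q (Nat.lt_succ_of_le hq), ← Finset.sum_range_reflect]
  rw [boxplus, Finset.smul_sum]
  refine Finset.sum_congr rfl fun i hi => ?_
  have hi' : i ≤ m := Nat.lt_succ_iff.mp (Finset.mem_range.mp hi)
  rw [iterate_derivative_X_pow_eq_C_mul, ← coeff_zero_eq_eval_zero, coeff_iterate_derivative,
    zero_add, Nat.descFactorial_self, smul_eq_C_mul, ← mul_assoc, ← mul_assoc, ← C_mul, ← C_mul,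
    Nat.succ_sub_one, nsmul_eq_mul]
  congr 2
  rw [← Nat.factorial_mul_descFactorial hi'] at hm ⊢
  push_cast at hm ⊢
  have h1 := left_ne_zero_of_mul hm
  have h2 := right_ne_zero_of_mul hm
  field_simp

/-- In finite free position with a diagonal matrix with distinct entries, the other matrix has
constant diagonal. -/
lemma diag_eq_of_charpoly_eq_boxplus {a b : Fin m → ℝ} (ha : Function.Injective a)
    {S : Matrix (Fin m) (Fin m) ℝ}
    (h : ∀ z : ℝ, (diagonal a + z • S).charpoly =
      boxplus m (diagonal a).charpoly (∏ j, (X - C (z * b j)))) (i : Fin m) :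
    S i i = (∑ j, b j) / m := by
  have hm : 0 < m := i.pos
  have hl : HasDerivAt (fun z : ℝ => (diagonal a + z • S).charpoly.eval (a i))
      (-(S i i * ∏ j ∈ Finset.univ.erase i, (a i - a j))) 0 := by
    have h1 := hasDerivAt_det_add_smul (diagonal fun j => a i - a j) (-S)
    have h2 : ((diagonal fun j => a i - a j).adjugate * (-S)).trace =
        -(S i i * ∏ j ∈ Finset.univ.erase i, (a i - a j)) := by
      rw [adjugate_diagonal, trace, Finset.sum_eq_single i]
      · simp [mul_comm]
      · intro k _ hk
        simp only [diag_apply, diagonal_mul]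
        rw [Finset.prod_eq_zero (Finset.mem_erase.mpr ⟨hk.symm, Finset.mem_univ i⟩) (sub_self _),
          zero_mul]
      · simp
    rw [h2] at h1
    refine h1.congr_of_eventuallyEq (Eventually.of_forall fun z => ?_)
    simp only [eval_charpoly]
    congr 1
    ext k l
    by_cases hkl : k = l
    · subst hkl; simp; ring
    · simp [hkl]
  have hr : HasDerivAt (fun z : ℝ => (boxplus m (diagonal a).charpoly
      (∏ j, (X - C (z * b j)))).eval (a i))
      ((m.factorial : ℝ)⁻¹ * ((derivative^[m - 1] (∏ j, (X - C (b j)))).eval 0 *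
        (derivative (diagonal a).charpoly).eval (a i))) 0 := by
    have h1 : HasDerivAt (fun z : ℝ => (m.factorial : ℝ)⁻¹ * ∑ k ∈ Finset.range (m + 1),
        z ^ k * ((derivative^[m - k] (∏ j, (X - C (b j)))).eval 0 *
          (derivative^[k] (diagonal a).charpoly).eval (a i)))
        ((m.factorial : ℝ)⁻¹ * ∑ k ∈ Finset.range (m + 1),
        (k * 0 ^ (k - 1)) * ((derivative^[m - k] (∏ j, (X - C (b j)))).eval 0 *
          (derivative^[k] (diagonal a).charpoly).eval (a i))) 0 :=
      (HasDerivAt.fun_sum fun k _ => (hasDerivAt_pow k 0).mul_const _).const_mul _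
    rw [Finset.sum_eq_single 1] at h1
    · simp only [Nat.cast_one, Nat.sub_self, pow_zero, one_mul, Function.iterate_one] at h1
      refine h1.congr_of_eventuallyEq (Eventually.of_forall fun z => ?_)
      simp only [boxplus, eval_smul, smul_eq_mul, eval_finsetSum, eval_mul, eval_C]
      congr 1
      refine Finset.sum_congr rfl fun k hk => ?_
      rw [eval_iterate_derivative_scale b z (Nat.lt_succ_iff.mp (Finset.mem_range.mp hk)), mul_assoc]
    · intro k _ hk
      rcases Nat.eq_zero_or_pos k with rfl | hk'
      · simp
      · rw [zero_pow (by omega)]; simp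
    · intro h; exact absurd (Finset.mem_range.mpr (by omega)) h
  have heq := hl.unique (by simpa only [h] using hr)
  have hP : (derivative (diagonal a).charpoly).eval (a i) =
      ∏ j ∈ Finset.univ.erase i, (a i - a j) := by
    rw [charpoly_diagonal, derivative_prod_finset, eval_finsetSum, Finset.sum_eq_single i]
    · simp [eval_prod]
    · intro k _ hk
      rw [eval_mul, eval_prod, Finset.prod_eq_zero (Finset.mem_erase.mpr ⟨hk.symm, Finset.mem_univ i⟩)
        (by simp), zero_mul]
    · simp
  have hP0 : ∏ j ∈ Finset.univ.erase i, (a i - a j) ≠ 0 :=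
    Finset.prod_ne_zero_iff.mpr fun j hj =>
      sub_ne_zero.mpr fun h => Finset.ne_of_mem_erase hj (ha h).symm
  have hq : (derivative^[m - 1] (∏ j, (X - C (b j)))).eval 0 =
      (m - 1).factorial * -∑ j, b j := by
    have := prod_X_sub_C_coeff_card_pred Finset.univ b (by simpa using hm)
    rw [Finset.card_univ, Fintype.card_fin] at this
    rw [← coeff_zero_eq_eval_zero, coeff_iterate_derivative, zero_add, Nat.descFactorial_self,
      nsmul_eq_mul, this]
  rw [hP, hq, ← Nat.mul_factorial_pred hm.ne'] at heq
  have hf : ((m - 1).factorial : ℝ) ≠ 0 := Nat.cast_ne_zero.mpr (Nat.factorial_ne_zero _)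
  have hm' : (m : ℝ) ≠ 0 := Nat.cast_ne_zero.mpr hm.ne'
  push_cast at heq
  field_simp at heq ⊢
  linarith

/-- Real symmetric matrices with the same characteristic polynomial are orthogonally similar. -/
lemma exists_orthogonal_conj_eq {S T : Matrix (Fin m) (Fin m) ℝ} (hS : Sᵀ = S) (hT : Tᵀ = T)
    (h : S.charpoly = T.charpoly) :
    ∃ R : Matrix (Fin m) (Fin m) ℝ, R * Rᵀ = 1 ∧ Rᵀ * S * R = T := by
  have hS' : S.IsHermitian := by rwa [IsHermitian, conjTranspose_eq_transpose_of_trivial]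
  have hT' : T.IsHermitian := by rwa [IsHermitian, conjTranspose_eq_transpose_of_trivial]
  have heig := (hS'.eigenvalues_eq_eigenvalues_iff hT').mpr h
  have h1 := hS'.spectral_theorem
  have h2 := hT'.spectral_theorem
  rw [heig] at h1
  rw [Unitary.conjStarAlgAut_apply] at h1 h2
  set D : Matrix (Fin m) (Fin m) ℝ := diagonal (RCLike.ofReal ∘ hT'.eigenvalues)
  have hU := Unitary.coe_star_mul_self hS'.eigenvectorUnitary
  have hU' := Unitary.coe_mul_star_self hS'.eigenvectorUnitary
  have hV := Unitary.coe_star_mul_self hT'.eigenvectorUnitary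
  set U : Matrix (Fin m) (Fin m) ℝ := ↑hS'.eigenvectorUnitary
  set V : Matrix (Fin m) (Fin m) ℝ := ↑hT'.eigenvectorUnitary
  have hstar : ∀ M : Matrix (Fin m) (Fin m) ℝ, star M = Mᵀ := fun M => by
    rw [star_eq_conjTranspose, conjTranspose_eq_transpose_of_trivial]
  simp only [Unitary.coe_star, hstar] at h1 h2 hU hU' hV
  refine ⟨U * Vᵀ, ?_, ?_⟩
  · rw [transpose_mul, transpose_transpose]
    calc U * Vᵀ * (V * Uᵀ) = U * (Vᵀ * V) * Uᵀ := by simp only [Matrix.mul_assoc]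
      _ = 1 := by rw [hV, Matrix.mul_one, hU']
  · rw [transpose_mul, transpose_transpose]
    conv_lhs => rw [h1]
    conv_rhs => rw [h2]
    calc V * Uᵀ * (U * D * Uᵀ) * (U * Vᵀ) = V * (Uᵀ * U) * D * (Uᵀ * U) * Vᵀ := by
          simp only [Matrix.mul_assoc]
      _ = _ := by rw [hU, Matrix.mul_one, Matrix.mul_one]

lemma exists_perm_of_prod_X_sub_C_eq {a a' : Fin m → ℝ} (ha : Function.Injective a)
    (h : ∏ j, (X - C (a' j)) = ∏ j, (X - C (a j))) : ∃ σ : Equiv.Perm (Fin m), a' = a ∘ σ := by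
  have ha' : Function.Injective a' := by
    rw [← separable_prod_X_sub_C_iff, h]
    exact separable_prod_X_sub_C_iff.mpr ha
  have hroot : ∀ i, ∃ j, a j = a' i := fun i => by
    have h0 : (∏ j, (X - C (a' j))).eval (a' i) = 0 := by
      rw [eval_prod]; exact Finset.prod_eq_zero (Finset.mem_univ i) (by simp)
    rw [h, eval_prod, Finset.prod_eq_zero_iff] at h0
    obtain ⟨j, -, hj⟩ := h0
    refine ⟨j, ?_⟩
    simp at hj
    linarith
  choose σ hσ using hroot
  have hinj : Function.Injective σ := fun i j hij => ha' (by rw [← hσ, ← hσ, hij])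
  exact ⟨Equiv.ofBijective σ (Finite.injective_iff_bijective.mp hinj), by ext i; simp [hσ]⟩

/-- The main theorem for matrices with simple spectrum. -/
lemma exists_orthogonal_of_injective {a b : Fin m → ℝ} (ha : Function.Injective a)
    (hb : Function.Injective b) {B : Matrix (Fin m) (Fin m) ℝ} (hB : Bᵀ = B)
    (hBb : B.charpoly = ∏ j, (X - C (b j))) :
    ∃ R : Matrix (Fin m) (Fin m) ℝ, R * Rᵀ = 1 ∧
      FiniteFreePosition m (diagonal a) (Rᵀ * B * R) ∧
        ∀ i : Fin m, (Rᵀ * B * R) i i = trace B / m := by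
  obtain ⟨c, hc⟩ := path_one_mem_range ha hb
  have hform : detForm (paramDiag c) (paramSymm c) = pathForm a b (jacobi m ℝ) 1 := by
    rw [← form_detMap, hc, form_coeffs_pathForm]
  have hsl : ∀ y z : ℝ, (y • diagonal (paramDiag c) + z • paramSymm c).charpoly =
      boxplus m (y • diagonal a).charpoly (∏ j, (X - C (z * b j))) := fun y z => by
    rw [← slice_detForm, hform, slice_pathForm]
    simp
  have hz : ∏ j, (X - C (paramDiag c j)) = ∏ j, (X - C (a j)) := by
    have := slice_pathForm_of_eq_zero a b (jacobi m ℝ) 1 1 0 (zero_mul 1)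
    rw [← hform, slice_detForm] at this
    simpa [charpoly_diagonal] using this
  obtain ⟨σ, hσ⟩ := exists_perm_of_prod_X_sub_C_eq ha hz
  set S : Matrix (Fin m) (Fin m) ℝ := reindex σ σ (paramSymm c) with hSdef
  have hS : Sᵀ = S := by
    rw [hSdef, transpose_reindex, paramSymm_transpose]
  have hbox : ∀ y z : ℝ, (y • diagonal a + z • S).charpoly =
      boxplus m (y • diagonal a).charpoly (∏ j, (X - C (z * b j))) := fun y z => by
    rw [← hsl, ← charpoly_reindex σ (y • diagonal (paramDiag c) + z • paramSymm c)]
    congr 1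
    ext i j
    by_cases hij : i = j
    · subst hij; simp [hSdef, hσ]
    · simp [hSdef, hij]
  have hchar : ∀ z : ℝ, (z • S).charpoly = ∏ j, (X - C (z * b j)) := fun z => by
    have := hbox 0 z
    rwa [zero_smul, zero_add, charpoly_zero, Fintype.card_fin,
      boxplus_X_pow (natDegree_prod_X_sub_C _).le] at this
  obtain ⟨R, hR, hRS⟩ := exists_orthogonal_conj_eq hB hS
    (by rw [hBb]; simpa using (hchar 1).symm)
  have hdiag := diag_eq_of_charpoly_eq_boxplus ha (S := S) (b := b) fun z => by
    simpa using hbox 1 z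
  refine ⟨R, hR, ?_, fun i => ?_⟩
  · intro y z
    rw [hRS, hbox, hchar]
  · have hm : (m : ℝ) ≠ 0 := Nat.cast_ne_zero.mpr i.pos.ne'
    have htr : trace B = ∑ j, b j := by
      have h1 : trace S = trace B := by
        rw [← hRS, Matrix.mul_assoc, trace_mul_comm, Matrix.mul_assoc, hR, Matrix.mul_one]
      rw [← h1, trace]
      simp only [diag_apply, hdiag, Finset.sum_const, Finset.card_univ, Fintype.card_fin,
        nsmul_eq_mul]
      field_simp
    rw [hRS, hdiag, htr]

end Distinct

section Approximation
open Filter Topology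

variable {m : ℕ}

lemma continuous_coeff_charpoly (k : ℕ) :
    Continuous fun M : Matrix (Fin m) (Fin m) ℝ => M.charpoly.coeff k := by
  have h : ∀ M : Matrix (Fin m) (Fin m) ℝ, M.charpoly.coeff k =
      MvPolynomial.eval (fun p : Fin m × Fin m => M p.1 p.2)
        ((charpoly.univ ℝ (Fin m)).coeff k) := fun M =>
    (charpoly.univ_coeff_eval₂Hom (Fin m) (RingHom.id ℝ) (fun p => M p.1 p.2) k).symm
  simp only [h]
  exact (MvPolynomial.continuous_eval _).comp
    (continuous_pi fun p => continuous_id.matrix_elem p.1 p.2)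

lemma isClosed_finiteFreePosition :
    IsClosed {P : Matrix (Fin m) (Fin m) ℝ × Matrix (Fin m) (Fin m) ℝ |
      FiniteFreePosition m P.1 P.2} := by
  simp only [FiniteFreePosition, Set.ofPred_forall, Polynomial.ext_iff]
  refine isClosed_iInter fun y => isClosed_iInter fun z => isClosed_iInter fun k =>
    isClosed_eq ((continuous_coeff_charpoly k).comp (by fun_prop)) ?_
  simp only [boxplus, coeff_smul, finsetSum_coeff, coeff_C_mul, ← coeff_zero_eq_eval_zero,
    coeff_iterate_derivative, smul_eq_mul, nsmul_eq_mul]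
  refine continuous_const.mul (continuous_finsetSum _ fun i _ => ?_)
  exact (continuous_const.mul ((continuous_coeff_charpoly _).comp (by fun_prop))).mul
    (continuous_const.mul ((continuous_coeff_charpoly _).comp (by fun_prop)))

lemma isCompact_orthogonal : IsCompact {R : Matrix (Fin m) (Fin m) ℝ | R * Rᵀ = 1} := by
  refine (isCompact_univ_pi fun _ : Fin m => isCompact_univ_pi fun _ : Fin m =>
    isCompact_Icc (a := (-1 : ℝ)) (b := 1)).of_isClosed_subset
      (isClosed_eq (by fun_prop) continuous_const) fun R hR i _ j _ => ?_
  rw [Set.mem_Icc, ← abs_le, ← Real.norm_eq_abs]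
  refine entry_norm_bound_of_unitary (U := R) (mem_unitaryGroup_iff.mpr (Eq.trans ?_ hR)) i j
  rfl

lemma eventually_injective_perturb (a : Fin m → ℝ) :
    ∀ᶠ ε : ℝ in 𝓝[≠] 0, Function.Injective fun i => a i + ε * (i : ℕ) := by
  have h : ∀ i j : Fin m, i ≠ j → ∀ᶠ ε : ℝ in 𝓝[≠] 0, a i + ε * (i : ℕ) ≠ a j + ε * (j : ℕ) := by
    intro i j hij
    by_cases haij : a i = a j
    · filter_upwards [self_mem_nhdsWithin] with ε hε heq
      rw [haij, add_right_inj, mul_right_inj' hε, Nat.cast_inj] at heq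
      exact hij (Fin.ext heq)
    · refine Filter.Eventually.filter_mono nhdsWithin_le_nhds ?_
      have hc : ContinuousAt (fun ε : ℝ => a i + ε * (i : ℕ) - (a j + ε * (j : ℕ))) 0 := by fun_prop
      filter_upwards [hc.eventually_ne (by simpa using sub_ne_zero.mpr haij)] with ε hε
      exact sub_ne_zero.mp hε
  have := eventually_all.mpr fun i => eventually_all.mpr fun j => eventually_imp_distrib_left.mpr (h i j)
  filter_upwards [this] with ε hε i j hij
  by_contra hne
  exact hε i j hne hij

/-- A symmetric matrix is a limit of symmetric matrices with simple spectrum. -/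
lemma exists_symm_perturb {B : Matrix (Fin m) (Fin m) ℝ} (hB : Bᵀ = B) :
    ∃ (b : Fin m → ℝ) (Q : ℝ → Matrix (Fin m) (Fin m) ℝ), Continuous Q ∧ Q 0 = B ∧
      ∀ ε, (Q ε)ᵀ = Q ε ∧ (Q ε).charpoly = ∏ i, (X - C (b i + ε * (i : ℕ))) := by
  have hB' : B.IsHermitian := by rwa [IsHermitian, conjTranspose_eq_transpose_of_trivial]
  have h1 := hB'.spectral_theorem
  rw [Unitary.conjStarAlgAut_apply] at h1
  have hU := Unitary.coe_star_mul_self hB'.eigenvectorUnitary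
  set U : Matrix (Fin m) (Fin m) ℝ := ↑hB'.eigenvectorUnitary
  rw [star_eq_conjTranspose, conjTranspose_eq_transpose_of_trivial] at h1 hU
  refine ⟨hB'.eigenvalues, fun ε => U * diagonal (fun i => hB'.eigenvalues i + ε * (i : ℕ)) * Uᵀ,
    ?_, ?_, fun ε => ⟨?_, ?_⟩⟩
  · refine Continuous.matrix_mul (continuous_const.matrix_mul (Continuous.matrix_diagonal ?_))
      continuous_const
    fun_prop
  · conv_rhs => rw [h1]
    simp
  · simp only [transpose_mul, transpose_transpose, diagonal_transpose, Matrix.mul_assoc]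
  · rw [charpoly_mul_comm, ← Matrix.mul_assoc, hU, Matrix.one_mul, charpoly_diagonal]

/-- The conclusion of the main theorem passes to limits. -/
lemma exists_orthogonal_of_eventually {P Q : ℝ → Matrix (Fin m) (Fin m) ℝ} (hP : Continuous P)
    (hQ : Continuous Q)
    (h : ∀ᶠ ε in 𝓝[≠] 0, ∃ R : Matrix (Fin m) (Fin m) ℝ, R * Rᵀ = 1 ∧
      FiniteFreePosition m (P ε) (Rᵀ * Q ε * R) ∧
        ∀ i : Fin m, (Rᵀ * Q ε * R) i i = trace (Q ε) / m) :
    ∃ R : Matrix (Fin m) (Fin m) ℝ, R * Rᵀ = 1 ∧ FiniteFreePosition m (P 0) (Rᵀ * Q 0 * R) ∧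
      ∀ i : Fin m, (Rᵀ * Q 0 * R) i i = trace (Q 0) / m := by
  have : CompactSpace {R : Matrix (Fin m) (Fin m) ℝ // R * Rᵀ = 1} :=
    isCompact_iff_compactSpace.mp isCompact_orthogonal
  set G : {R : Matrix (Fin m) (Fin m) ℝ // R * Rᵀ = 1} × ℝ → Matrix (Fin m) (Fin m) ℝ :=
    fun w => w.1.1ᵀ * Q w.2 * w.1.1
  set F : Set ({R : Matrix (Fin m) (Fin m) ℝ // R * Rᵀ = 1} × ℝ) :=
    {w | FiniteFreePosition m (P w.2) (G w)} ∩ {w | ∀ i : Fin m, G w i i = trace (Q w.2) / m}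
  have hG : Continuous G := by fun_prop
  have hF : IsClosed F := by
    refine IsClosed.inter (isClosed_finiteFreePosition.preimage
      ((hP.comp continuous_snd).prodMk hG)) ?_
    simp only [Set.ofPred_forall]
    exact isClosed_iInter fun i => isClosed_eq (hG.matrix_elem i i)
      ((hQ.comp continuous_snd).matrix_trace.div_const _)
  have hmem : (0 : ℝ) ∈ Prod.snd '' F := by
    refine (isClosedMap_snd_of_compactSpace F hF).mem_of_frequently_of_tendsto
      (b := 𝓝[≠] (0 : ℝ)) (f := id) (Eventually.frequently ?_)
      (tendsto_id.mono_left nhdsWithin_le_nhds)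
    filter_upwards [h] with ε ⟨R, hR, h1, h2⟩
    exact ⟨(⟨R, hR⟩, ε), ⟨h1, h2⟩, rfl⟩
  obtain ⟨⟨⟨R, hR⟩, ε⟩, ⟨h1, h2⟩, rfl⟩ := hmem
  exact ⟨R, hR, h1, h2⟩

end Approximation
end FiniteFree

/-- **Finite free position with constant diagonal.** If `A` is an `m × m` real diagonal
matrix and `B` is an `m × m` real symmetric matrix, then there is an orthogonal `R` such
that `A` and `RᵀBR` are in finite free position and every diagonal entry of `RᵀBR`
equals `Tr(B)/m`. -/
theorem exists_orthogonal_finite_free_position_const_diag (m : ℕ)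
    (A B : Matrix (Fin m) (Fin m) ℝ) (hA : A.IsDiag) (hB : B.IsSymm) :
    ∃ R : Matrix (Fin m) (Fin m) ℝ,
      R * Rᵀ = 1 ∧ FiniteFreePosition m A (Rᵀ * B * R) ∧
        ∀ i : Fin m, (Rᵀ * B * R) i i = Matrix.trace B / m := by
  obtain ⟨b, Q, hQ, rfl, hQb⟩ := FiniteFree.exists_symm_perturb hB
  have hP : Continuous fun ε : ℝ => diagonal fun i => A.diag i + ε * (i : ℕ) := by
    refine Continuous.matrix_diagonal ?_
    fun_prop
  have key := FiniteFree.exists_orthogonal_of_eventually hP hQ <| by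
    filter_upwards [FiniteFree.eventually_injective_perturb A.diag,
      FiniteFree.eventually_injective_perturb b] with ε h1 h2
    exact FiniteFree.exists_orthogonal_of_injective h1 h2 (hQb ε).1 (hQb ε).2
  have h0 : (diagonal fun i => A.diag i + 0 * ((i : ℕ) : ℝ)) = A := by
    simpa only [zero_mul, add_zero] using hA.diagonal_diag
  rwa [h0] at key
end

section
/- Let p and q be monic real polynomials of degree d, each with all roots real, such that the sum of the roots of q equals 0. Then [p ⊞_d q] has all roots real, and the multiset of roots of [p ⊞_d q] majorizes the multiset of roots of p. -/
open Polynomial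

/-- A multiset `x` of reals majorizes a multiset `y` of reals (of the same size) if the
sum of the `k` largest elements of `x` is at least the sum of the `k` largest elements
of `y` for every `k`, with equality of the total sums. (Sorting in increasing order,
the `k` largest elements are obtained by dropping the first `card - k`.) -/
def Majorizes (x y : Multiset ℝ) : Prop :=
  Multiset.card x = Multiset.card y ∧ x.sum = y.sum ∧
    ∀ k : ℕ,
      ((y.sort (· ≤ ·)).drop (Multiset.card y - k)).sum ≤
        ((x.sort (· ≤ ·)).drop (Multiset.card x - k)).sum

open Finset

/-- The value at `z` of `m!` times the additive convolution of two complex polynomials. -/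
noncomputable def convolutionEval (m : ℕ) (p q : ℂ[X]) (z : ℂ) : ℂ :=
  ∑ i ∈ range (m + 1), (derivative^[m - i] q).eval 0 * (derivative^[i] p).eval z

theorem norm_inv_add_le_iff {u : ℂ} (hu : u ≠ 0) {y : ℝ} (hy : 0 < y) :
    ‖1 / u + Complex.I / (2 * y)‖ ≤ 1 / (2 * y) ↔ y ≤ u.im := by
  have hyc : (y : ℂ) ≠ 0 := by exact_mod_cast hy.ne'
  have h : 1 / u + Complex.I / (2 * y) = (2 * y + Complex.I * u) / (2 * y * u) := by
    field_simp
  have hn : ‖(2 * y * u : ℂ)‖ = 2 * y * ‖u‖ := by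
    simp [abs_of_pos hy]
  have hupos : 0 < ‖u‖ := norm_pos_iff.2 hu
  rw [h, norm_div, hn, div_le_div_iff₀ (by positivity) (by positivity), one_mul,
    mul_comm, mul_le_mul_iff_right₀ (by positivity), ← sq_le_sq₀ (norm_nonneg _) (norm_nonneg _),
    Complex.sq_norm, Complex.sq_norm, Complex.normSq_apply, Complex.normSq_apply]
  simp only [Complex.add_re, Complex.add_im, Complex.mul_re, Complex.mul_im, Complex.I_re,
    Complex.I_im, Complex.ofReal_re, Complex.ofReal_im, Complex.re_ofNat, Complex.im_ofNat]
  constructor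
  · intro h
    by_contra! hlt
    nlinarith [mul_pos hy (sub_pos.2 hlt)]
  · intro h
    nlinarith [mul_nonneg hy.le (sub_nonneg.2 h)]

/-- Laguerre's theorem for the upper half-plane: the polar derivative with respect to a point of
the upper half-plane preserves the absence of zeros there. -/
theorem eval_polarDerivative_ne_zero {n : ℕ} {p : ℂ[X]} (hn : 0 < n) (hdeg : p.natDegree ≤ n)
    (hp : ∀ z : ℂ, 0 < z.im → p.eval z ≠ 0) {w x : ℂ} (hw : 0 < w.im) (hx : 0 < x.im) :
    (n : ℂ) * p.eval x - (x - w) * (derivative p).eval x ≠ 0 := by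
  intro h0
  have hpx := hp x hx
  have hs := IsAlgClosed.splits p
  have hv := hs.eval_derivative_div_eval_of_ne_zero hpx
  set v := (p.roots.map fun z ↦ 1 / (x - z)).sum with hvdef
  have hv' : (derivative p).eval x = p.eval x * v := by rw [← hv]; field_simp
  have hnv : (n : ℂ) = (x - w) * v := by
    rw [hv'] at h0
    apply mul_left_cancel₀ hpx
    linear_combination h0
  have hnc : (n : ℂ) ≠ 0 := by exact_mod_cast hn.ne'
  have hxw : x - w ≠ 0 := by
    rintro h
    rw [h, zero_mul] at hnv
    exact hnc hnv
  have hle : ∀ s : Multiset ℂ, (∀ a ∈ s, a.im ≤ 0) →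
      ‖(s.map fun z ↦ 1 / (x - z)).sum + s.card * (Complex.I / (2 * x.im))‖ ≤
        s.card * (1 / (2 * x.im)) := by
    intro s
    induction s using Multiset.induction_on with
    | empty => simp
    | cons a s ih =>
      intro hs
      have ih := ih fun b hb ↦ hs b (Multiset.mem_cons_of_mem hb)
      have ha := hs a (Multiset.mem_cons_self a s)
      have hxa : x - a ≠ 0 := by
        intro h
        have := congrArg Complex.im h
        simp at this
        linarith
      have h1 := (norm_inv_add_le_iff hxa hx).2 (by simp; linarith)
      have h2 := (norm_add_le _ _).trans (add_le_add h1 ih)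
      simp only [Multiset.map_cons, Multiset.sum_cons, Multiset.card_cons, Nat.cast_add,
        Nat.cast_one]
      refine (le_of_eq ?_).trans (h2.trans (le_of_eq ?_))
      · congr 1
        ring
      · ring
  have hroots : ∀ a ∈ p.roots, a.im ≤ 0 := by
    intro a ha
    by_contra! h
    exact hp a h (isRoot_of_mem_roots ha)
  have h1 := hle _ hroots
  have hcard : p.roots.card ≤ n := (card_roots' p).trans hdeg
  obtain ⟨k, rfl⟩ := Nat.exists_eq_add_of_le hcard
  have h2 : ‖(k : ℂ) * (Complex.I / (2 * x.im))‖ ≤ k * (1 / (2 * x.im)) := by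
    simp [abs_of_pos hx]
  have h3 := (norm_add_le _ _).trans (add_le_add h1 h2)
  rw [← hvdef] at h3
  have h4 : v = ((p.roots.card + k : ℕ) : ℂ) * (1 / (x - w)) := by
    rw [hnv]; field_simp
  have h5 : v + p.roots.card * (Complex.I / (2 * x.im)) + k * (Complex.I / (2 * x.im)) =
      ((p.roots.card + k : ℕ) : ℂ) * (1 / (x - w) + Complex.I / (2 * x.im)) := by
    rw [h4]; push_cast; ring
  rw [h5, norm_mul, Complex.norm_natCast, ← add_mul, ← Nat.cast_add] at h3
  have h6 := le_of_mul_le_mul_left h3 (by exact_mod_cast hn)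
  have h7 := (norm_inv_add_le_iff hxw hx).1 h6
  simp at h7
  linarith

theorem iterate_derivative_X_mul_derivative (i : ℕ) (p : ℂ[X]) :
    derivative^[i] (X * derivative p) =
      X * derivative^[i + 1] p + (i : ℂ[X]) * derivative^[i] p := by
  induction i with
  | zero => simp
  | succ i ih =>
    rw [Function.iterate_succ_apply', ih]
    simp only [derivative_add, derivative_mul, derivative_X, derivative_natCast,
      ← Function.iterate_succ_apply']
    push_cast
    ring

theorem iterate_derivative_succ_X_sub_C_mul (i : ℕ) (b : ℂ) (p : ℂ[X]) :
    derivative^[i + 1] ((X - C b) * p) =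
      (X - C b) * derivative^[i + 1] p + ((i + 1 : ℕ) : ℂ[X]) * derivative^[i] p := by
  induction i with
  | zero => simp; ring
  | succ i ih =>
    rw [Function.iterate_succ_apply', ih]
    simp only [derivative_add, derivative_mul, derivative_X, derivative_natCast, derivative_sub,
      derivative_C, ← Function.iterate_succ_apply']
    push_cast
    ring

/-- Removing a linear factor from one argument of the convolution replaces the other argument by a
polar derivative. -/
theorem convolutionEval_X_sub_C_mul {d : ℕ} (p : ℂ[X]) {q : ℂ[X]} (hq : q.natDegree ≤ d)
    (b z : ℂ) :
    convolutionEval (d + 1) p ((X - C b) * q) z =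
      convolutionEval d (((d + 1 : ℕ) : ℂ[X]) * p - (X - C (z - b)) * derivative p) q z := by
  have hA : ∀ i, (derivative^[i]
      (((d + 1 : ℕ) : ℂ[X]) * p - (X - C (z - b)) * derivative p)).eval z =
      ((d : ℂ) + 1 - i) * (derivative^[i] p).eval z - b * (derivative^[i + 1] p).eval z := by
    intro i
    rw [sub_mul, iterate_derivative_sub, iterate_derivative_sub, iterate_derivative_natCast_mul,
      iterate_derivative_C_mul, iterate_derivative_X_mul_derivative,
      ← Function.iterate_succ_apply]
    simp
    ring
  have hB : ∀ i ∈ range (d + 1), (derivative^[d + 1 - i] ((X - C b) * q)).eval 0 =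
      -b * (derivative^[d + 1 - i] q).eval 0 +
        ((d : ℂ) + 1 - i) * (derivative^[d - i] q).eval 0 := by
    intro i hi
    have hi' : i ≤ d := Nat.lt_succ_iff.1 (mem_range.1 hi)
    rw [show d + 1 - i = d - i + 1 by omega, iterate_derivative_succ_X_sub_C_mul]
    simp only [eval_add, eval_mul, eval_sub, eval_X, eval_C, eval_natCast, eval_one, Nat.cast_add,
      Nat.cast_one, Nat.cast_sub hi']
    ring
  have hzero : derivative^[d + 1] q = 0 := iterate_derivative_eq_zero (by omega)
  unfold convolutionEval
  simp_rw [hA]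
  rw [sum_range_succ, sum_congr rfl fun i hi ↦ by rw [hB i hi]]
  have hshift : ∑ i ∈ range (d + 1),
        (derivative^[d + 1 - i] q).eval 0 * (derivative^[i] p).eval z +
        (derivative^[0] q).eval 0 * (derivative^[d + 1] p).eval z =
      ∑ i ∈ range (d + 1), (derivative^[d - i] q).eval 0 * (derivative^[i + 1] p).eval z := by
    have h := sum_range_succ'
      (fun i ↦ (derivative^[d + 1 - i] q).eval 0 * (derivative^[i] p).eval z) (d + 1)
    rw [sum_range_succ] at h
    simpa [hzero] using h
  simp only [mul_sub, sum_sub_distrib, add_mul, sum_add_distrib]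
  have e1 : ∀ i, (derivative^[d - i] q).eval 0 * (b * (derivative^[i + 1] p).eval z) =
      b * ((derivative^[d - i] q).eval 0 * (derivative^[i + 1] p).eval z) := fun i ↦ by ring
  simp_rw [e1, ← mul_sum, ← hshift, mul_add, mul_sum]
  simp
  have e2 : ∀ i, b * (derivative^[d + 1 - i] q).eval 0 * (derivative^[i] p).eval z =
      b * ((derivative^[d + 1 - i] q).eval 0 * (derivative^[i] p).eval z) := fun i ↦ by ring
  simp_rw [e2]
  have e3 : ∀ i : ℕ, ((d : ℂ) + 1 - i) * (derivative^[d - i] q).eval 0 * (derivative^[i] p).eval z =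
      (derivative^[d - i] q).eval 0 * (((d : ℂ) + 1 - i) * (derivative^[i] p).eval z) :=
    fun i ↦ by ring
  simp_rw [e3]
  ring

/-- Convolution with a real-rooted polynomial preserves the absence of zeros in the upper
half-plane. -/
theorem convolutionEval_ne_zero (s : Multiset ℝ) {p : ℂ[X]} (hdeg : p.natDegree ≤ s.card)
    (hp : ∀ z : ℂ, 0 < z.im → p.eval z ≠ 0) {z : ℂ} (hz : 0 < z.im) :
    convolutionEval s.card p (s.map fun b : ℝ ↦ X - C (b : ℂ)).prod z ≠ 0 := by
  induction s using Multiset.induction_on generalizing p with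
  | empty => simpa [convolutionEval] using hp z hz
  | cons b s ih =>
    have hq : (s.map fun b : ℝ ↦ X - C (b : ℂ)).prod.natDegree ≤ s.card := by
      rw [natDegree_multiset_prod_of_monic _ (by simp +contextual [monic_X_sub_C])]
      simp
    rw [Multiset.map_cons, Multiset.prod_cons, Multiset.card_cons,
      convolutionEval_X_sub_C_mul p hq]
    rw [Multiset.card_cons] at hdeg
    refine ih ?_ fun x hx ↦ ?_
    · refine natDegree_le_iff_coeff_eq_zero.2 fun N hN ↦ ?_
      obtain ⟨n, rfl⟩ : ∃ n, N = n + 1 := ⟨N - 1, by omega⟩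
      have h1 : p.coeff (n + 1 + 1) = 0 := coeff_eq_zero_of_natDegree_lt (by omega)
      rw [sub_mul, coeff_sub, coeff_sub, coeff_C_mul, coeff_X_mul, coeff_derivative,
        coeff_derivative, ← C_eq_natCast, coeff_C_mul, h1]
      by_cases hn : n = s.card
      · subst hn; push_cast; ring
      · rw [coeff_eq_zero_of_natDegree_lt (n := n + 1) (by omega)]
        ring
    · have := eval_polarDerivative_ne_zero (Nat.succ_pos s.card) hdeg hp (w := z - b)
        (by simpa using hz) hx
      simpa using this

/-- A real polynomial without zeros in the upper half-plane splits over `ℝ`. -/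
theorem splits_of_aeval_ne_zero {P : ℝ[X]} (hP : ∀ z : ℂ, 0 < z.im → aeval z P ≠ 0) :
    P.Splits := by
  have hP0 : P ≠ 0 := by
    rintro rfl
    exact hP Complex.I (by simp) (by simp)
  refine Splits.of_splits_map_of_injective (i := algebraMap ℝ ℂ)
    (algebraMap ℝ ℂ).injective (IsAlgClosed.splits _) fun a ha ↦ ?_
  have haev : aeval a P = 0 := by
    rw [aeval_def, ← eval_map]
    exact isRoot_of_mem_roots ha
  refine ⟨a.re, ?_⟩
  have him : a.im = 0 := by
    rcases lt_trichotomy a.im 0 with h | h | h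
    · refine absurd ?_ (hP (starRingEnd ℂ a) (by simpa using h))
      rw [aeval_conj, haev, map_zero]
    · exact h
    · exact absurd haev (hP a h)
  exact Complex.ext (by simp) (by simp [him])

/-- The sign condition `0 ≤ Im (P / S)` on the upper half-plane, localized at a real point at
which `P` and `S` vanish to order `k + n` and `k`. -/
theorem im_pow_mul_eval_nonneg {P₁ S₁ : ℝ[X]} {ρ : ℝ} {k n : ℕ}
    (h : ∀ z : ℂ, 0 < z.im → 0 ≤ (aeval z ((X - C ρ) ^ (k + n) * P₁) *
      starRingEnd ℂ (aeval z ((X - C ρ) ^ k * S₁))).im)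
    {ω : ℂ} (hω : 0 < ω.im) :
    0 ≤ (ω ^ n).im * (P₁.eval ρ * S₁.eval ρ) := by
  let F : ℝ → ℝ := fun ε ↦ (ω ^ n * (aeval ((ρ : ℂ) + ε * ω) P₁ *
    starRingEnd ℂ (aeval ((ρ : ℂ) + ε * ω) S₁))).im
  have hcont : Continuous F := by
    have h1 : Continuous fun ε : ℝ ↦ (ρ : ℂ) + ε * ω := by fun_prop
    have h2 : Continuous fun ε : ℝ ↦ aeval ((ρ : ℂ) + ε * ω) P₁ := P₁.continuous_aeval.comp h1
    have h3 : Continuous fun ε : ℝ ↦ aeval ((ρ : ℂ) + ε * ω) S₁ := S₁.continuous_aeval.comp h1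
    exact Complex.continuous_im.comp
      (continuous_const.mul (h2.mul (Complex.continuous_conj.comp h3)))
  have hF0 : F 0 = (ω ^ n).im * (P₁.eval ρ * S₁.eval ρ) := by
    have e : ∀ Q : ℝ[X], aeval (ρ : ℂ) Q = ((Q.eval ρ : ℝ) : ℂ) := fun Q ↦
      aeval_algebraMap_apply_eq_algebraMap_eval ρ Q
    simp only [F, Complex.ofReal_zero, zero_mul, add_zero, e, Complex.conj_ofReal,
      ← Complex.ofReal_mul]
    rw [Complex.im_mul_ofReal]
  have hpos : ∀ ε : ℝ, 0 < ε → 0 ≤ F ε := by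
    intro ε hε
    have hz := h ((ρ : ℂ) + ε * ω) (by simpa using mul_pos hε hω)
    have hc : 0 < (ε ^ (k + n) * ε ^ k * Complex.normSq ω ^ k) := by
      have : 0 < Complex.normSq ω := Complex.normSq_pos.2 (by rintro rfl; simp at hω)
      positivity
    have hE : aeval ((ρ : ℂ) + ε * ω) ((X - C ρ) ^ (k + n) * P₁) *
        starRingEnd ℂ (aeval ((ρ : ℂ) + ε * ω) ((X - C ρ) ^ k * S₁)) =
        ((ε ^ (k + n) * ε ^ k * Complex.normSq ω ^ k : ℝ) : ℂ) *
          (ω ^ n * (aeval ((ρ : ℂ) + ε * ω) P₁ *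
            starRingEnd ℂ (aeval ((ρ : ℂ) + ε * ω) S₁))) := by
      have hX : aeval ((ρ : ℂ) + ε * ω) (X - C ρ) = (ε : ℂ) * ω := by simp
      rw [map_mul, map_mul, map_pow, map_pow, hX]
      simp only [map_mul, map_pow, Complex.conj_ofReal, Complex.ofReal_mul, Complex.ofReal_pow,
        ← Complex.mul_conj]
      ring
    rw [hE, Complex.im_ofReal_mul] at hz
    exact nonneg_of_mul_nonneg_right hz hc
  rw [← hF0]
  refine ge_of_tendsto (hcont.tendsto 0 |>.mono_left (nhdsWithin_le_nhds (s := Set.Ioi 0))) ?_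
  filter_upwards [self_mem_nhdsWithin] with ε hε using hpos ε hε

/-- Under the sign condition, vanishing orders of numerator and denominator differ by at most
one. -/
theorem rootMultiplicity_le_succ {P S : ℝ[X]} (hP : P ≠ 0) (hS : S ≠ 0)
    (h : ∀ z : ℂ, 0 < z.im → 0 ≤ (aeval z P * starRingEnd ℂ (aeval z S)).im) (ρ : ℝ) :
    P.rootMultiplicity ρ ≤ S.rootMultiplicity ρ + 1 := by
  by_contra! hlt
  obtain ⟨n, hn⟩ := Nat.exists_eq_add_of_le (le_of_lt (lt_trans (Nat.lt_succ_self _) hlt))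
  have hn2 : 2 ≤ n := by omega
  obtain ⟨P₁, hP₁, hP₁d⟩ := exists_eq_pow_rootMultiplicity_mul_and_not_dvd P hP ρ
  obtain ⟨S₁, hS₁, hS₁d⟩ := exists_eq_pow_rootMultiplicity_mul_and_not_dvd S hS ρ
  rw [dvd_iff_isRoot] at hP₁d hS₁d
  rw [hn] at hP₁
  have key : ∀ ω : ℂ, 0 < ω.im → 0 ≤ (ω ^ n).im * (P₁.eval ρ * S₁.eval ρ) := fun ω hω ↦
    im_pow_mul_eval_nonneg (k := S.rootMultiplicity ρ) (by rwa [← hP₁, ← hS₁]) hω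
  have hn0 : (0 : ℝ) < n := by positivity
  have hpow : ∀ θ : ℝ, (Complex.exp ((θ / n : ℝ) * Complex.I) ^ n).im = Real.sin θ := by
    intro θ
    rw [← Complex.exp_nat_mul, ← Complex.exp_ofReal_mul_I_im]
    congr 2
    rw [Complex.ofReal_div, Complex.ofReal_natCast, ← mul_assoc,
      mul_div_cancel₀ _ (by exact_mod_cast hn0.ne')]
  have hn2' : (2 : ℝ) ≤ n := by exact_mod_cast hn2
  have hpos : ∀ θ : ℝ, 0 < θ → θ < Real.pi * 2 →
      0 ≤ Real.sin θ * (P₁.eval ρ * S₁.eval ρ) := by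
    intro θ h0 h1
    rw [← hpow]
    refine key _ ?_
    rw [Complex.exp_ofReal_mul_I_im]
    refine Real.sin_pos_of_pos_of_lt_pi (by positivity) ?_
    rw [div_lt_iff₀ hn0]
    nlinarith [Real.pi_pos]
  have h1 := hpos (Real.pi / 2) (by positivity) (by linarith [Real.pi_pos])
  have h2 := hpos (Real.pi / 2 + Real.pi) (by positivity) (by linarith [Real.pi_pos])
  rw [Real.sin_add_pi, Real.sin_pi_div_two] at h2
  rw [Real.sin_pi_div_two] at h1
  exact mul_ne_zero hP₁d hS₁d (by linarith)

/-- The product of the linear factors of `P`, each with its multiplicity lowered by one. -/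
noncomputable def repeatedPart (P : ℝ[X]) : ℝ[X] :=
  ((P.roots - P.roots.dedup).map fun a ↦ X - C a).prod

theorem monic_repeatedPart (P : ℝ[X]) : (repeatedPart P).Monic :=
  monic_multiset_prod_of_monic _ _ fun a _ ↦ monic_X_sub_C a

theorem repeatedPart_mul_prod {P : ℝ[X]} (hP : P.Monic) (hroots : P.roots.card = P.natDegree) :
    repeatedPart P * ∏ σ ∈ P.roots.toFinset, (X - C σ) = P := by
  conv_rhs => rw [← prod_multiset_X_sub_C_of_monic_of_roots_card_eq hP hroots,
    ← Multiset.sub_add_cancel P.roots.dedup_le]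
  rw [Multiset.map_add, Multiset.prod_add]
  rfl

/-- If `0 ≤ Im (P / S)` on the upper half-plane, then `S / P` is a combination of simple fractions
with nonnegative weights at the distinct roots of `P`. -/
theorem exists_eq_mul_and_weights_nonneg {P S : ℝ[X]} (hP : P.Monic)
    (hroots : P.roots.card = P.natDegree)
    (h : ∀ z : ℂ, 0 < z.im → 0 ≤ (aeval z P * starRingEnd ℂ (aeval z S)).im)
    (hPz : ∀ z : ℂ, 0 < z.im → aeval z P ≠ 0) :
    ∃ H : ℝ[X], S = repeatedPart P * H ∧
      ∀ ρ ∈ P.roots.toFinset, 0 ≤ H.eval ρ / ∏ σ ∈ P.roots.toFinset.erase ρ, (ρ - σ) := by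
  have hPG := (repeatedPart_mul_prod hP hroots).symm
  set G := repeatedPart P with hG
  have hdvd : G ∣ S := by
    by_cases hS : S = 0
    · simp [hS]
    · rw [hG, repeatedPart, Multiset.prod_X_sub_C_dvd_iff_le_roots hS, Multiset.le_iff_count]
      intro ρ
      have := rootMultiplicity_le_succ hP.ne_zero hS h ρ
      rw [Multiset.count_sub, Multiset.count_dedup, count_roots, count_roots]
      split_ifs with hρ
      · omega
      · rw [← count_roots, Multiset.count_eq_zero_of_notMem hρ]
        simp
  obtain ⟨H, hH⟩ := hdvd
  refine ⟨H, hH, fun ρ hρ ↦ ?_⟩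
  have hN : ∀ z : ℂ, 0 < z.im → 0 ≤ (aeval z (∏ σ ∈ P.roots.toFinset, (X - C σ)) *
      starRingEnd ℂ (aeval z H)).im := by
    intro z hz
    have h1 := h z hz
    have h2 := hPz z hz
    rw [hPG, map_mul] at h2
    have hGz := left_ne_zero_of_mul h2
    have h3 : aeval z P * starRingEnd ℂ (aeval z S) = (Complex.normSq (aeval z G) : ℂ) *
        (aeval z (∏ σ ∈ P.roots.toFinset, (X - C σ)) * starRingEnd ℂ (aeval z H)) := by
      conv_lhs => rw [hPG, hH]
      rw [map_mul, map_mul, map_mul, ← Complex.mul_conj]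
      ring
    rw [h3, Complex.im_ofReal_mul] at h1
    exact nonneg_of_mul_nonneg_right h1 (Complex.normSq_pos.2 hGz)
  have hpos := im_pow_mul_eval_nonneg (k := 0) (n := 1) (ρ := ρ)
    (P₁ := ∏ σ ∈ P.roots.toFinset.erase ρ, (X - C σ)) (S₁ := H)
    (by
      rw [zero_add, pow_one, pow_zero, one_mul,
        mul_prod_erase _ (fun σ ↦ X - C σ) hρ]
      exact hN) (ω := Complex.I) (by simp)
  simp only [pow_one, Complex.I_im, one_mul, eval_prod, eval_sub, eval_X, eval_C] at hpos
  rw [mul_comm] at hpos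
  exact div_nonneg_iff.2 (mul_nonneg_iff.1 hpos)

theorem coeff_boxplus {d n : ℕ} {f q : ℝ[X]} (hq : q.Monic) (hqd : q.natDegree = d)
    (hnext : q.nextCoeff = 0) (hf : f.natDegree ≤ n + 1) :
    (boxplus d f q).coeff n = f.coeff n := by
  unfold boxplus
  rw [coeff_smul, finsetSum_coeff, sum_eq_single_of_mem 0 (by simp)]
  · have hlead : q.coeff d = 1 := by rw [← hqd]; exact hq
    rw [coeff_C_mul, ← coeff_zero_eq_eval_zero, coeff_iterate_derivative]
    simp [hlead, Nat.descFactorial_self, Nat.factorial_ne_zero]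
  · intro i hi hi0
    rw [coeff_C_mul]
    by_cases hi1 : i = 1
    · subst hi1
      have hd : 0 < d := by simpa using hi
      have h0 : q.coeff (d - 1) = 0 := by
        rwa [nextCoeff_of_natDegree_pos (by omega), hqd] at hnext
      rw [← coeff_zero_eq_eval_zero, coeff_iterate_derivative]
      simp [h0]
    · rw [coeff_iterate_derivative, coeff_eq_zero_of_natDegree_lt (by omega)]
      simp

theorem aeval_boxplus (d : ℕ) (f q : ℝ[X]) (z : ℂ) :
    aeval z (boxplus d f q) = (d.factorial : ℂ)⁻¹ *
      convolutionEval d (f.map (algebraMap ℝ ℂ)) (q.map (algebraMap ℝ ℂ)) z := by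
  unfold boxplus convolutionEval
  rw [map_smul, map_sum, Algebra.smul_def]
  congr 1
  · simp
  · refine sum_congr rfl fun i _ ↦ ?_
    rw [map_mul, aeval_C, iterate_derivative_map, iterate_derivative_map, eval_map_algebraMap,
      eval_map_algebraMap]
    congr 1
    rw [← map_zero (algebraMap ℝ ℂ), aeval_algebraMap_apply_eq_algebraMap_eval]

theorem convolutionEval_add_C_mul (d : ℕ) (f g q : ℂ[X]) (ζ z : ℂ) :
    convolutionEval d (f + C ζ * g) q z =
      convolutionEval d f q z + ζ * convolutionEval d g q z := by
  unfold convolutionEval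
  rw [mul_sum, ← sum_add_distrib]
  refine sum_congr rfl fun i _ ↦ ?_
  rw [iterate_map_add, iterate_derivative_C_mul, eval_add, eval_mul, eval_C]
  ring

theorem boxplus_derivative (d : ℕ) (f q : ℝ[X]) :
    boxplus d (derivative f) q = derivative (boxplus d f q) := by
  unfold boxplus
  rw [derivative_smul, derivative_sum]
  congr 1
  refine sum_congr rfl fun i _ ↦ ?_
  rw [derivative_C_mul, ← Function.iterate_succ_apply,
    ← Function.iterate_succ_apply' derivative]

theorem boxplus_multiset_sum (d : ℕ) (q : ℝ[X]) (s : Multiset ℝ) (f : ℝ → ℝ[X]) :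
    boxplus d (s.map f).sum q = (s.map fun a ↦ boxplus d (f a) q).sum := by
  induction s using Multiset.induction_on with
  | empty => simp [boxplus]
  | cons a s ih =>
    rw [Multiset.map_cons, Multiset.map_cons, Multiset.sum_cons, Multiset.sum_cons, ← ih]
    simp [boxplus, iterate_map_add, mul_add, sum_add_distrib]

theorem aeval_prod_X_sub_C_ne_zero (s : Multiset ℝ) {z : ℂ} (hz : 0 < z.im) :
    aeval z (s.map fun a ↦ X - C a).prod ≠ 0 := by
  rw [map_multiset_prod, Multiset.map_map, Ne, Multiset.prod_eq_zero_iff]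
  simp only [Multiset.mem_map, Function.comp_apply, map_sub, aeval_X, aeval_C, not_exists, not_and]
  intro a _ h
  have := congrArg Complex.im h
  simp at this
  linarith

theorem map_eq_prod_X_sub_C_roots {q : ℝ[X]} (hq : q.Monic) (hqroots : q.roots.card = q.natDegree) :
    q.map (algebraMap ℝ ℂ) = (q.roots.map fun b : ℝ ↦ X - C (b : ℂ)).prod := by
  conv_lhs => rw [← prod_multiset_X_sub_C_of_monic_of_roots_card_eq hq hqroots]
  rw [Polynomial.map_multiset_prod, Multiset.map_map]
  simp

/-- Convolution of monic real-rooted polynomials has no zeros in the upper half-plane. -/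
theorem aeval_boxplus_ne_zero {d : ℕ} {p q : ℝ[X]} (hp : p.Monic) (hq : q.Monic)
    (hpd : p.natDegree = d) (hqd : q.natDegree = d) (hproots : p.roots.card = d)
    (hqroots : q.roots.card = d) {z : ℂ} (hz : 0 < z.im) : aeval z (boxplus d p q) ≠ 0 := by
  have hqmap := map_eq_prod_X_sub_C_roots hq (hqroots.trans hqd.symm)
  have key := convolutionEval_ne_zero q.roots (p := p.map (algebraMap ℝ ℂ))
    (by rw [natDegree_map, hpd, hqroots])
    (fun x hx ↦ by
      rw [eval_map_algebraMap,
        ← prod_multiset_X_sub_C_of_monic_of_roots_card_eq hp (hproots.trans hpd.symm)]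
      exact aeval_prod_X_sub_C_ne_zero _ hx) hz
  rw [← hqmap, hqroots] at key
  rw [aeval_boxplus]
  exact mul_ne_zero (inv_ne_zero (by exact_mod_cast d.factorial_ne_zero)) key

/-- Convolution with a real-rooted polynomial `∏ (X - b)` preserves the absence of zeros in the
upper half-plane, for pencils `(X - a + ζ) h` with `h` real-rooted. -/
theorem aeval_boxplus_add_ne_zero {d : ℕ} {q : ℝ[X]} (hq : q.Monic) (hqd : q.natDegree = d)
    (hqroots : q.roots.card = d) {s : Multiset ℝ} (hs : s.card + 1 = d) (a : ℝ) {ζ z : ℂ}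
    (hζ : 0 ≤ ζ.im) (hz : 0 < z.im) :
    aeval z (boxplus d ((X - C a) * (s.map fun a ↦ X - C a).prod) q) +
      ζ * aeval z (boxplus d (s.map fun a ↦ X - C a).prod q) ≠ 0 := by
  set h := (s.map fun a ↦ X - C a).prod with hh
  have hhdeg : h.natDegree = s.card := natDegree_multiset_prod_X_sub_C_eq_card s
  have hqmap := map_eq_prod_X_sub_C_roots hq (hqroots.trans hqd.symm)
  have hpoly : ((X - C a) * h).map (algebraMap ℝ ℂ) + C ζ * h.map (algebraMap ℝ ℂ) =
      (X - C (a - ζ)) * h.map (algebraMap ℝ ℂ) := by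
    simp only [Polynomial.map_mul, Polynomial.map_sub, map_X, map_C, C_sub, Complex.coe_algebraMap]
    ring
  have hne : ∀ x : ℂ, 0 < x.im →
      ((X - C (a - ζ)) * h.map (algebraMap ℝ ℂ)).eval x ≠ 0 := by
    intro x hx
    rw [eval_mul, eval_map_algebraMap]
    refine mul_ne_zero (fun h0 ↦ ?_) (aeval_prod_X_sub_C_ne_zero s hx)
    have := congrArg Complex.im h0
    simp at this
    linarith
  have hdeg : ((X - C (a - ζ)) * h.map (algebraMap ℝ ℂ)).natDegree ≤ q.roots.card := by
    refine natDegree_mul_le.trans ?_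
    rw [natDegree_X_sub_C, natDegree_map]
    omega
  have key := convolutionEval_ne_zero q.roots hdeg hne hz
  rw [← hpoly, convolutionEval_add_C_mul, ← hqmap, hqroots] at key
  rw [aeval_boxplus, aeval_boxplus]
  intro h0
  apply key
  have hd : (d.factorial : ℂ)⁻¹ ≠ 0 := inv_ne_zero (by exact_mod_cast d.factorial_ne_zero)
  apply mul_left_cancel₀ hd
  linear_combination h0

theorem im_aeval_boxplus_mul_conj_nonneg {d : ℕ} {q : ℝ[X]} (hq : q.Monic)
    (hqd : q.natDegree = d) (hqroots : q.roots.card = d) {s : Multiset ℝ} (hs : s.card + 1 = d)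
    (a : ℝ) {z : ℂ} (hz : 0 < z.im) :
    0 ≤ (aeval z (boxplus d ((X - C a) * (s.map fun a ↦ X - C a).prod) q) *
      starRingEnd ℂ (aeval z (boxplus d (s.map fun a ↦ X - C a).prod q))).im := by
  have hne := fun ζ hζ ↦ aeval_boxplus_add_ne_zero hq hqd hqroots hs a (ζ := ζ) hζ hz
  set A := aeval z (boxplus d ((X - C a) * (s.map fun a ↦ X - C a).prod) q)
  set B := aeval z (boxplus d (s.map fun a ↦ X - C a).prod q)
  by_contra! hneg
  have hB : B ≠ 0 := by
    intro h
    simp [h] at hneg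
  have hBn : 0 < Complex.normSq B := Complex.normSq_pos.2 hB
  refine hne (-A / B) ?_ (by field_simp; ring)
  have : -A / B = ((Complex.normSq B)⁻¹ : ℝ) * -(A * starRingEnd ℂ B) := by
    rw [div_eq_mul_inv, Complex.inv_def]
    push_cast
    ring
  rw [this, Complex.im_ofReal_mul, Complex.neg_im]
  exact mul_nonneg (inv_nonneg.2 hBn.le) (by linarith)

theorem sum_sub_length_mul_le (l : List ℝ) (t : ℝ) :
    l.sum - l.length * t ≤ (l.map fun a ↦ max (a - t) 0).sum := by
  induction l with
  | nil => simp
  | cons a l ih =>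
    simp only [List.sum_cons, List.length_cons, List.map_cons]
    push_cast
    linarith [le_max_left (a - t) 0]

theorem sum_map_max_of_le {l : List ℝ} {t : ℝ} (h : ∀ a ∈ l, a ≤ t) :
    (l.map fun a ↦ max (a - t) 0).sum = 0 := by
  refine List.sum_eq_zero fun x hx ↦ ?_
  obtain ⟨a, ha, rfl⟩ := List.mem_map.1 hx
  exact max_eq_right (by linarith [h a ha])

theorem sum_map_max_of_ge {l : List ℝ} {t : ℝ} (h : ∀ a ∈ l, t ≤ a) :
    (l.map fun a ↦ max (a - t) 0).sum = l.sum - l.length * t := by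
  induction l with
  | nil => simp
  | cons a l ih =>
    simp only [List.sum_cons, List.length_cons, List.map_cons]
    rw [ih fun b hb ↦ h b (List.mem_cons_of_mem a hb),
      max_eq_left (by linarith [h a List.mem_cons_self])]
    push_cast
    ring

/-- Majorization follows from the comparison of the sums of the hinge functions `(a - t)⁺`. -/
theorem majorizes_of_sum_max_le {x y : Multiset ℝ} (hcard : x.card = y.card)
    (hsum : x.sum = y.sum)
    (h : ∀ t : ℝ, (y.map fun a ↦ max (a - t) 0).sum ≤ (x.map fun a ↦ max (a - t) 0).sum) :
    Majorizes x y := by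
  refine ⟨hcard, hsum, fun k ↦ ?_⟩
  have hsx : ((x.sort (· ≤ ·) : List ℝ) : Multiset ℝ) = x := Multiset.sort_eq x _
  have hsy : ((y.sort (· ≤ ·) : List ℝ) : Multiset ℝ) = y := Multiset.sort_eq y _
  have hlx : (x.sort (· ≤ ·)).length = x.card := Multiset.length_sort _
  have hly : (y.sort (· ≤ ·)).length = y.card := Multiset.length_sort _
  have hpx : (x.sort (· ≤ ·)).Pairwise (· ≤ ·) := Multiset.pairwise_sort x _
  set lx := x.sort (· ≤ ·)
  set ly := y.sort (· ≤ ·)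
  rw [← hcard]
  rcases Nat.eq_zero_or_pos k with rfl | hk
  · rw [List.drop_eq_nil_of_le (by omega), List.drop_eq_nil_of_le (by omega)]
  rcases Nat.eq_zero_or_pos x.card with h0 | hpos
  · rw [List.drop_eq_nil_of_le (by omega), List.drop_eq_nil_of_le (by omega)]
  have hlt : x.card - k < lx.length := by omega
  set m := x.card - k
  set t := lx[m]
  have hxd : lx.drop m = t :: lx.drop (m + 1) := List.drop_eq_getElem_cons hlt
  have hpa : (lx.take m ++ lx.drop m).Pairwise (· ≤ ·) := by rwa [List.take_append_drop]
  rw [List.pairwise_append] at hpa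
  obtain ⟨-, hpd, hcross⟩ := hpa
  have ht1 : ∀ a ∈ lx.take m, a ≤ t := fun a ha ↦ hcross a ha t (by rw [hxd]; simp)
  have ht2 : ∀ a ∈ lx.drop m, t ≤ a := by
    rw [hxd] at hpd ⊢
    intro a ha
    rcases List.mem_cons.1 ha with rfl | ha
    · exact le_rfl
    · exact (List.pairwise_cons.1 hpd).1 a ha
  have hX : (x.map fun a ↦ max (a - t) 0).sum = (lx.drop m).sum - (lx.drop m).length * t := by
    rw [← hsx, Multiset.map_coe, Multiset.sum_coe]
    conv_lhs => rw [← List.take_append_drop m lx]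
    rw [List.map_append, List.sum_append, sum_map_max_of_le ht1, sum_map_max_of_ge ht2, zero_add]
  have hY : (ly.drop m).sum - (ly.drop m).length * t ≤ (y.map fun a ↦ max (a - t) 0).sum := by
    rw [← hsy, Multiset.map_coe, Multiset.sum_coe]
    conv_rhs => rw [← List.take_append_drop m ly]
    rw [List.map_append, List.sum_append]
    have h1 : 0 ≤ ((ly.take m).map fun a ↦ max (a - t) 0).sum := by
      refine List.sum_nonneg fun b hb ↦ ?_
      obtain ⟨a, -, rfl⟩ := List.mem_map.1 hb
      exact le_max_right _ _
    linarith [sum_sub_length_mul_le (ly.drop m) t]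
  have hlen : (lx.drop m).length = (ly.drop m).length := by
    rw [List.length_drop, List.length_drop, hlx, hly, hcard]
  have := h t
  rw [hX, hlen] at this
  linarith

/-- Convexity of the hinge functions turns a stochastic representation of `y` through `x` into
majorization. -/
theorem majorizes_of_weights {x y : Multiset ℝ} (hcard : x.card = y.card) (w : ℝ → ℝ → ℝ)
    (hw : ∀ a ∈ y, ∀ r ∈ x.toFinset, 0 ≤ w a r)
    (hrow : ∀ a ∈ y, ∑ r ∈ x.toFinset, w a r = 1)
    (hmean : ∀ a ∈ y, ∑ r ∈ x.toFinset, w a r * r = a)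
    (hcol : ∀ r ∈ x.toFinset, (y.map fun a ↦ w a r).sum = x.count r) :
    Majorizes x y := by
  have hswap : ∀ φ : ℝ → ℝ, (y.map fun a ↦ ∑ r ∈ x.toFinset, w a r * φ r).sum =
      (x.map φ).sum := by
    intro φ
    rw [Multiset.sum_map_sum, Finset.sum_multiset_map_count]
    refine sum_congr rfl fun r hr ↦ ?_
    rw [Multiset.sum_map_mul_right, hcol r hr, nsmul_eq_mul]
  refine majorizes_of_sum_max_le hcard ?_ fun t ↦ ?_
  · have := hswap id
    rw [Multiset.map_id] at this
    rw [← this]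
    conv_rhs => rw [← Multiset.map_id y]
    exact congrArg _ (Multiset.map_congr rfl hmean)
  · rw [← hswap]
    refine Multiset.sum_map_le_sum_map _ _ fun a ha ↦ ?_
    refine max_le ?_ (sum_nonneg fun r hr ↦ mul_nonneg (hw a ha r hr) (le_max_right _ _))
    calc a - t = ∑ r ∈ x.toFinset, w a r * (r - t) := by
          simp only [mul_sub, sum_sub_distrib, ← sum_mul, hrow a ha, hmean a ha, one_mul]
      _ ≤ _ := sum_le_sum fun r hr ↦
          mul_le_mul_of_nonneg_left (le_max_left _ _) (hw a ha r hr)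

/-- The weights of the partial fraction expansion of `S / P` sum to the coefficient of `S` just
below the degree of `P`. -/
theorem sum_weights_eq_coeff {P H : ℝ[X]} (hP : P.Monic) (hroots : P.roots.card = P.natDegree)
    (hdeg : (repeatedPart P * H).natDegree < P.natDegree) :
    ∑ ρ ∈ P.roots.toFinset, H.eval ρ / ∏ σ ∈ P.roots.toFinset.erase ρ, (ρ - σ) =
      (repeatedPart P * H).coeff (P.natDegree - 1) := by
  have hG := monic_repeatedPart P
  have hsplit : (repeatedPart P).natDegree + #P.roots.toFinset = P.natDegree := by
    conv_rhs => rw [← repeatedPart_mul_prod hP hroots]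
    rw [hG.natDegree_mul (monic_prod_of_monic _ _ fun a _ ↦ monic_X_sub_C a),
      natDegree_prod_of_monic _ _ fun a _ ↦ monic_X_sub_C a]
    simp
  have hZ : 0 < #P.roots.toFinset := by
    rw [Finset.card_pos, Multiset.toFinset_nonempty, ← Multiset.card_pos]
    omega
  have hH : H.natDegree < #P.roots.toFinset := by
    by_cases h0 : H = 0
    · simpa [h0] using hZ
    · rw [hG.natDegree_mul' h0] at hdeg
      omega
  have hL := Lagrange.coeff_eq_sum (s := P.roots.toFinset) (v := id) (P := H)
    Function.injective_id.injOn
    ((degree_le_natDegree).trans_lt (by exact_mod_cast hH))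
  simp only [id] at hL
  rw [← hL, show P.natDegree - 1 = (repeatedPart P).natDegree + (#P.roots.toFinset - 1) by omega,
    coeff_mul_add_eq_of_natDegree_le le_rfl (by omega), coeff_natDegree, hG, one_mul]

theorem derivative_eq_repeatedPart_mul_sum {P : ℝ[X]} (hP : P.Monic)
    (hroots : P.roots.card = P.natDegree) :
    derivative P = repeatedPart P *
      (P.roots.map fun r ↦ ∏ σ ∈ P.roots.toFinset.erase r, (X - C σ)).sum := by
  conv_lhs => rw [← prod_multiset_X_sub_C_of_monic_of_roots_card_eq hP hroots]
  rw [derivative_prod, ← Multiset.sum_map_mul_left]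
  refine congrArg _ (Multiset.map_congr rfl fun r hr ↦ ?_)
  rw [derivative_X_sub_C, mul_one]
  apply mul_left_cancel₀ (X_sub_C_ne_zero r)
  rw [mul_left_comm, mul_prod_erase _ (fun σ ↦ X - C σ) (Multiset.mem_toFinset.2 hr),
    repeatedPart_mul_prod hP hroots,
    Multiset.prod_map_erase (f := fun a ↦ (X - C a : ℝ[X])) hr,
    prod_multiset_X_sub_C_of_monic_of_roots_card_eq hP hroots]

theorem eval_sum_prod_erase {s : Multiset ℝ} {ρ : ℝ} (hρ : ρ ∈ s) :
    (s.map fun r ↦ ∏ σ ∈ s.toFinset.erase r, (X - C σ)).sum.eval ρ =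
      s.count ρ * ∏ σ ∈ s.toFinset.erase ρ, (ρ - σ) := by
  rw [Finset.sum_multiset_map_count, eval_finsetSum, sum_eq_single_of_mem ρ (by simpa using hρ)]
  · simp [eval_prod]
  · intro r _ hr
    rw [eval_smul, eval_prod, prod_eq_zero (i := ρ) (by simp [hρ, Ne.symm hr]) (by simp), smul_zero]

/-- **Majorization by the additive convolution.** If `p`, `q` are monic real-rooted real
polynomials of degree `d` and the roots of `q` sum to `0`, then `[p ⊞_d q]` is
real-rooted and its roots majorize the roots of `p`. -/
theorem boxplus_roots_majorize (d : ℕ) (p q : ℝ[X])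
    (hp : p.Monic) (hq : q.Monic) (hpd : p.natDegree = d) (hqd : q.natDegree = d)
    (hproots : Multiset.card p.roots = d) (hqroots : Multiset.card q.roots = d)
    (hqsum : q.roots.sum = 0) :
    Multiset.card (boxplus d p q).roots = d ∧
      Majorizes (boxplus d p q).roots p.roots := by
  have hnext : q.nextCoeff = 0 := by
    rw [(splits_iff_card_roots.2 (hqroots.trans hqd.symm)).nextCoeff_eq_neg_sum_roots_of_monic hq,
      hqsum, neg_zero]
  have hcoeff : ∀ n, d ≤ n + 1 → (boxplus d p q).coeff n = p.coeff n := fun n hn ↦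
    coeff_boxplus hq hqd hnext (by omega)
  have hpprod := prod_multiset_X_sub_C_of_monic_of_roots_card_eq hp (hproots.trans hpd.symm)
  have hPz : ∀ z : ℂ, 0 < z.im → aeval z (boxplus d p q) ≠ 0 := fun z hz ↦
    aeval_boxplus_ne_zero hp hq hpd hqd hproots hqroots hz
  have hPd' : (boxplus d p q).natDegree ≤ d := natDegree_le_iff_coeff_eq_zero.2 fun n hn ↦ by
    rw [hcoeff n (by omega), coeff_eq_zero_of_natDegree_lt (by omega)]
  have hlead : (boxplus d p q).coeff d = 1 := by
    rw [hcoeff d (by omega), ← hpd]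
    exact hp
  have hPm : (boxplus d p q).Monic := monic_of_natDegree_le_of_coeff_eq_one d hPd' hlead
  have hPd : (boxplus d p q).natDegree = d :=
    le_antisymm hPd' (le_natDegree_of_ne_zero (by simp [hlead]))
  have hPcard : (boxplus d p q).roots.card = (boxplus d p q).natDegree :=
    splits_iff_card_roots.1 (splits_of_aeval_ne_zero hPz)
  refine ⟨hPcard.trans hPd, ?_⟩
  set P := boxplus d p q with hP
  let h : ℝ → ℝ[X] := fun a ↦ ((p.roots.erase a).map fun b ↦ X - C b).prod
  have hcardErase : ∀ a ∈ p.roots, (p.roots.erase a).card + 1 = d := fun a ha ↦ by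
    rw [Multiset.card_erase_add_one ha, hproots]
  have hph : ∀ a ∈ p.roots, (X - C a) * h a = p := fun a ha ↦
    (Multiset.prod_map_erase (f := fun a ↦ (X - C a : ℝ[X])) ha).trans hpprod
  have hhd : ∀ a ∈ p.roots, (h a).natDegree + 1 = d := fun a ha ↦ by
    rw [natDegree_multiset_prod_X_sub_C_eq_card, hcardErase a ha]
  have hhm : ∀ a, (h a).Monic := fun a ↦ monic_multiset_prod_of_monic _ _ fun b _ ↦ monic_X_sub_C b
  have hex : ∀ a ∈ p.roots, ∃ H : ℝ[X], boxplus d (h a) q = repeatedPart P * H ∧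
      ∀ ρ ∈ P.roots.toFinset, 0 ≤ H.eval ρ / ∏ σ ∈ P.roots.toFinset.erase ρ, (ρ - σ) := by
    intro a ha
    refine exists_eq_mul_and_weights_nonneg hPm hPcard (fun z hz ↦ ?_) hPz
    have := im_aeval_boxplus_mul_conj_nonneg hq hqd hqroots (hcardErase a ha) a hz
    rwa [hph a ha] at this
  choose! H hH hHpos using hex
  have hScoeff : ∀ a ∈ p.roots, ∀ n, d ≤ n + 2 → (boxplus d (h a) q).coeff n = (h a).coeff n :=
    fun a ha n hn ↦ coeff_boxplus hq hqd hnext (by have := hhd a ha; omega)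
  have hSdeg : ∀ a ∈ p.roots, (boxplus d (h a) q).natDegree < d := fun a ha ↦ by
    have := hhd a ha
    refine Nat.lt_of_le_pred (by omega) (natDegree_le_iff_coeff_eq_zero.2 fun n hn ↦ ?_)
    rw [Nat.pred_eq_sub_one] at hn
    rw [hScoeff a ha n (by omega), coeff_eq_zero_of_natDegree_lt (by omega)]
  have hhlead : ∀ a ∈ p.roots, (h a).coeff (d - 1) = 1 := fun a ha ↦ by
    rw [← hhd a ha, Nat.add_sub_cancel]
    exact hhm a
  refine majorizes_of_weights (hPcard.trans (hPd.trans hproots.symm))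
    (fun a ρ ↦ (H a).eval ρ / ∏ σ ∈ P.roots.toFinset.erase ρ, (ρ - σ)) hHpos ?_ ?_ ?_
  · intro a ha
    rw [sum_weights_eq_coeff hPm hPcard (by rw [← hH a ha, hPd]; exact hSdeg a ha), ← hH a ha, hPd,
      hScoeff a ha _ (by omega), hhlead a ha]
  · intro a ha
    have hsub : repeatedPart P * (X * H a - ∏ σ ∈ P.roots.toFinset, (X - C σ)) =
        X * boxplus d (h a) q - P := by
      rw [mul_sub, repeatedPart_mul_prod hPm hPcard, hH a ha]
      ring
    have hsubcoeff : ∀ n, d ≤ n + 1 → (X * boxplus d (h a) q - P).coeff n =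
        (C a * h a).coeff n := by
      intro n hn
      have e : C a * h a = X * h a - p := by
        rw [← hph a ha]
        ring
      rw [e, coeff_sub, coeff_sub, hcoeff n hn]
      congr 1
      cases n with
      | zero => simp
      | succ n => rw [coeff_X_mul, coeff_X_mul, hScoeff a ha n (by omega)]
    have hsubdeg : (X * boxplus d (h a) q - P).natDegree < d := by
      have := hhd a ha
      refine Nat.lt_of_le_pred (by omega) (natDegree_le_iff_coeff_eq_zero.2 fun n hn ↦ ?_)
      rw [Nat.pred_eq_sub_one] at hn
      rw [hsubcoeff n (by omega), coeff_C_mul, coeff_eq_zero_of_natDegree_lt (by omega), mul_zero]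
    have hsum := sum_weights_eq_coeff (H := X * H a - ∏ σ ∈ P.roots.toFinset, (X - C σ)) hPm hPcard
      (by rwa [hsub, hPd])
    rw [hsub, hPd, hsubcoeff _ (by omega), coeff_C_mul, hhlead a ha, mul_one] at hsum
    refine Eq.trans ?_ hsum
    refine sum_congr rfl fun ρ hρ ↦ ?_
    have h0 : (∏ σ ∈ P.roots.toFinset, (X - C σ)).eval ρ = 0 := by
      rw [eval_prod]
      exact prod_eq_zero hρ (by simp)
    rw [eval_sub, h0, eval_mul, eval_X]
    ring
  · intro ρ hρ
    have hsum : repeatedPart P * (p.roots.map H).sum = repeatedPart P *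
        (P.roots.map fun r ↦ ∏ σ ∈ P.roots.toFinset.erase r, (X - C σ)).sum := by
      rw [← derivative_eq_repeatedPart_mul_sum hPm hPcard, hP, ← boxplus_derivative, ← hP,
        ← Multiset.sum_map_mul_left]
      conv_rhs => rw [← hpprod]
      rw [derivative_prod, boxplus_multiset_sum]
      refine congrArg _ (Multiset.map_congr rfl fun a ha ↦ ?_)
      rw [← hH a ha, derivative_X_sub_C, mul_one]
    have heval := congrArg (eval ρ) (mul_left_cancel₀ (monic_repeatedPart P).ne_zero hsum)
    rw [eval_sum_prod_erase (Multiset.mem_toFinset.1 hρ), ← coe_evalRingHom, map_multiset_sum,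
      Multiset.map_map] at heval
    have hne : ∏ σ ∈ P.roots.toFinset.erase ρ, (ρ - σ) ≠ 0 :=
      prod_ne_zero_iff.2 fun σ hσ ↦ sub_ne_zero.2 (ne_of_mem_erase hσ).symm
    simp only [div_eq_mul_inv]
    rw [Multiset.sum_map_mul_right]
    simp only [Function.comp_def, coe_evalRingHom] at heval
    rw [heval, mul_assoc, mul_inv_cancel₀ hne, mul_one]
end
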